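/- Let k be an even integer ≥ 4. Every zero of E_k' in H is simple: if z ∈ H and E_k'(z) = 0, then E_k''(z) ≠ 0. -/

import Mathlib

/-- The normalized Eisenstein series of even weight `k ≥ 4` (the definition also
makes sense for `k = 2`, giving the quasi-modular Eisenstein series `E₂`), defined by
its Fourier expansion `E_k(z) = 1 - (2k/B_k) ∑_{n≥1} σ_{k-1}(n) qⁿ`, `q = exp(2πiz)`. -/
noncomputable def Ek (k : ℕ) (z : ℂ) : ℂ :=
  1 - (2 * (k : ℂ) / ((bernoulli k : ℚ) : ℂ)) *
    ∑' n : ℕ, (∑ d ∈ n.divisors, (d : ℂ) ^ (k - 1)) * Complex.exp (2 * Real.pi * Complex.I * z) ^ n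

open Complex UpperHalfPlane Filter Topology
open scoped Real Nat ArithmeticFunction.sigma MatrixGroups ModularForm

/-- The `q`-series `∑ nʳ σ_{k-1}(n) qⁿ`. -/
noncomputable def sigmaSeries (k r : ℕ) (z : ℂ) : ℂ :=
  ∑' n : ℕ, ((n : ℂ) ^ r * (σ (k - 1) n : ℂ)) * cexp (2 * π * Complex.I * z) ^ n

theorem norm_cexp_two_pi (z : ℂ) : ‖cexp (2 * π * Complex.I * z)‖ = Real.exp (-2 * π * z.im) := by
  rw [Complex.norm_exp]
  simp

theorem norm_sigma_coeff_le (k r n : ℕ) :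
    ‖(n : ℂ) ^ r * (σ k n : ℂ)‖ ≤ (n : ℝ) ^ (r + k + 1) := by
  rw [norm_mul, norm_pow, Complex.norm_natCast, Complex.norm_natCast, add_assoc, pow_add]
  gcongr
  exact_mod_cast ArithmeticFunction.sigma_le_pow_succ k n

theorem summable_sigmaSeries_bound (m : ℕ) {y : ℝ} (hy : 0 < y) :
    Summable fun n : ℕ => (n : ℝ) ^ m * Real.exp (-2 * π * y) ^ n := by
  apply summable_pow_mul_geometric_of_norm_lt_one
  rw [Real.norm_eq_abs, abs_of_pos (Real.exp_pos _), Real.exp_lt_one_iff]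
  have := Real.pi_pos
  nlinarith [mul_pos this hy]

theorem summable_sigmaSeries (k r : ℕ) {z : ℂ} (hz : 0 < z.im) :
    Summable fun n : ℕ =>
      ((n : ℂ) ^ r * (σ (k - 1) n : ℂ)) * cexp (2 * π * Complex.I * z) ^ n := by
  apply Summable.of_norm_bounded (summable_sigmaSeries_bound (r + (k - 1) + 1) hz)
  intro n
  rw [norm_mul, norm_pow, norm_cexp_two_pi]
  gcongr
  exact norm_sigma_coeff_le _ _ _

theorem hasDerivAt_sigmaSeries (k r : ℕ) {z : ℂ} (hz : 0 < z.im) :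
    HasDerivAt (sigmaSeries k r) (2 * π * Complex.I * sigmaSeries k (r + 1) z) z := by
  set t : Set ℂ := {w | z.im / 2 < w.im}
  have ht : IsOpen t := isOpen_lt continuous_const Complex.continuous_im
  have htc : IsPreconnected t := (convex_halfSpace_im_gt (z.im / 2)).isPreconnected
  have hzt : z ∈ t := by simp only [t, Set.mem_ofPred_eq]; linarith
  have hu : Summable fun n : ℕ => (2 * π) *
      ((n : ℝ) ^ (r + 1 + (k - 1) + 1) * Real.exp (-2 * π * (z.im / 2)) ^ n) :=
    (summable_sigmaSeries_bound _ (half_pos hz)).mul_left _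
  have key := hasDerivAt_tsum_of_isPreconnected (𝕜 := ℂ) (F := ℂ) hu ht htc
    (g := fun (n : ℕ) (w : ℂ) =>
      ((n : ℂ) ^ r * (σ (k - 1) n : ℂ)) * cexp (2 * π * Complex.I * w) ^ n)
    (g' := fun (n : ℕ) (w : ℂ) => (2 * π * Complex.I) *
      (((n : ℂ) ^ (r + 1) * (σ (k - 1) n : ℂ)) * cexp (2 * π * Complex.I * w) ^ n))
    ?_ ?_ hzt (summable_sigmaSeries k r hz) hzt
  · rw [tsum_mul_left] at key
    exact key
  · intro n w _
    simp only [← Complex.exp_nat_mul]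
    have h1 : HasDerivAt (fun w : ℂ => (n : ℂ) * (2 * π * Complex.I * w))
        ((n : ℂ) * (2 * π * Complex.I)) w := by
      simpa using ((hasDerivAt_id w).const_mul (2 * π * Complex.I)).const_mul (n : ℂ)
    exact ((h1.cexp).const_mul ((n : ℂ) ^ r * (σ (k - 1) n : ℂ))).congr_deriv (by ring)
  · intro n w hw
    rw [norm_mul, norm_mul (_ * _) (_ ^ _), norm_pow, norm_cexp_two_pi]
    have h2 : ‖(2 * π * Complex.I : ℂ)‖ = 2 * π := by
      simp [abs_of_pos Real.pi_pos]
    rw [h2]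
    have h3 : Real.exp (-2 * π * w.im) ≤ Real.exp (-2 * π * (z.im / 2)) := by
      have : z.im / 2 < w.im := hw
      have := Real.pi_pos
      rw [Real.exp_le_exp]
      nlinarith
    gcongr
    exact norm_sigma_coeff_le _ _ _

theorem Ek_eq_sigmaSeries (k : ℕ) (z : ℂ) :
    Ek k z = 1 - (2 * (k : ℂ) / ((bernoulli k : ℚ) : ℂ)) * sigmaSeries k 0 z := by
  simp only [Ek, sigmaSeries, pow_zero, one_mul, ArithmeticFunction.sigma_apply]
  push_cast
  rfl

theorem hasDerivAt_Ek (k : ℕ) {z : ℂ} (hz : 0 < z.im) :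
    HasDerivAt (Ek k)
      (-(2 * (k : ℂ) / ((bernoulli k : ℚ) : ℂ)) * (2 * π * Complex.I) * sigmaSeries k 1 z) z := by
  have h := ((hasDerivAt_sigmaSeries k 0 hz).const_mul
    (2 * (k : ℂ) / ((bernoulli k : ℚ) : ℂ))).const_sub 1
  rw [show Ek k = fun z => 1 - (2 * (k : ℂ) / ((bernoulli k : ℚ) : ℂ)) * sigmaSeries k 0 z from
    funext (Ek_eq_sigmaSeries k)]
  exact h.congr_deriv (by ring)

theorem isOpen_im_pos : IsOpen {z : ℂ | 0 < z.im} := isOpen_lt continuous_const continuous_im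

theorem eventually_im_pos {z : ℂ} (hz : 0 < z.im) : ∀ᶠ w : ℂ in 𝓝 z, 0 < w.im :=
  isOpen_im_pos.mem_nhds hz

theorem deriv_Ek (k : ℕ) {z : ℂ} (hz : 0 < z.im) :
    deriv (Ek k) z =
      -(2 * (k : ℂ) / ((bernoulli k : ℚ) : ℂ)) * (2 * π * Complex.I) * sigmaSeries k 1 z :=
  (hasDerivAt_Ek k hz).deriv

theorem hasDerivAt_deriv_Ek (k : ℕ) {z : ℂ} (hz : 0 < z.im) :
    HasDerivAt (deriv (Ek k))
      (-(2 * (k : ℂ) / ((bernoulli k : ℚ) : ℂ)) * (2 * π * Complex.I) ^ 2 * sigmaSeries k 2 z)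
      z := by
  have h := (hasDerivAt_sigmaSeries k 1 hz).const_mul
    (-(2 * (k : ℂ) / ((bernoulli k : ℚ) : ℂ)) * (2 * π * Complex.I))
  have h2 := h.congr_of_eventuallyEq (f₁ := deriv (Ek k))
    ((eventually_im_pos hz).mono fun w hw => deriv_Ek k hw)
  exact h2.congr_deriv (by ring)

theorem deriv_deriv_Ek (k : ℕ) {z : ℂ} (hz : 0 < z.im) :
    deriv (deriv (Ek k)) z =
      -(2 * (k : ℂ) / ((bernoulli k : ℚ) : ℂ)) * (2 * π * Complex.I) ^ 2 * sigmaSeries k 2 z :=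
  (hasDerivAt_deriv_Ek k hz).deriv

theorem differentiableOn_Ek (k : ℕ) : DifferentiableOn ℂ (Ek k) {z | 0 < z.im} :=
  fun _ hz => (hasDerivAt_Ek k hz).differentiableAt.differentiableWithinAt

theorem hasDerivAt_Ek' (k : ℕ) {z : ℂ} (hz : 0 < z.im) :
    HasDerivAt (Ek k) (deriv (Ek k) z) z := (hasDerivAt_Ek k hz).differentiableAt.hasDerivAt

theorem hasDerivAt_deriv_Ek' (k : ℕ) {z : ℂ} (hz : 0 < z.im) :
    HasDerivAt (deriv (Ek k)) (deriv (deriv (Ek k)) z) z :=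
  (hasDerivAt_deriv_Ek k hz).differentiableAt.hasDerivAt

theorem sigmaSeries_eq_tsum_pnat (k r : ℕ) {z : ℂ} (hz : 0 < z.im) :
    sigmaSeries k r z =
      ∑' n : ℕ+, ((n : ℂ) ^ r * (σ (k - 1) n : ℂ)) * cexp (2 * π * Complex.I * z) ^ (n : ℕ) := by
  rw [sigmaSeries, ← tsum_zero_pnat_eq_tsum_nat (summable_sigmaSeries k r hz)]
  simp

theorem Ek_eq_E {k : ℕ} (hk : 3 ≤ k) (hke : Even k) (z : ℍ) : Ek k z = ModularForm.E hk z := by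
  rw [EisensteinSeries.q_expansion_bernoulli hk hke, Ek_eq_sigmaSeries,
    sigmaSeries_eq_tsum_pnat k 0 z.im_pos]
  simp

theorem bernoulli_coeff_eq {k : ℕ} (hke : Even k) (hk : k ≠ 0) :
    -(2 * (k : ℂ) / ((bernoulli k : ℚ) : ℂ)) =
      (riemannZeta k)⁻¹ * (-2 * π * Complex.I) ^ k / (k - 1)! := by
  have h2 : k = 2 * (k / 2 - 1 + 1) := by grind
  set m := k / 2 - 1
  rw [h2, Nat.cast_mul 2 (m + 1), Nat.cast_two, riemannZeta_two_mul_nat (show m + 1 ≠ 0 by grind),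
    show (2 * (m + 1))! = 2 * (m + 1) * (2 * m + 1)! by grind [Nat.factorial_succ],
    show 2 * (m + 1) - 1 = 2 * m + 1 by grind, mul_pow, mul_pow, pow_mul Complex.I, I_sq]
  norm_cast
  simp [field]
  grind

theorem summable_norm_lattice {k : ℕ} (r : ℕ) (hk : 3 ≤ k) {z : ℂ} (hz : 0 < z.im) :
    Summable fun p : ℕ+ × ℤ => ‖((p.1 : ℂ) ^ r / ((p.1 : ℂ) * z + p.2) ^ (k + r))‖ := by
  have h0 : Summable fun x : ℤ × ℤ => ‖EisensteinSeries.eisSummand k ![x.1, x.2] ⟨z, hz⟩‖ :=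
    (summable_prod_eisSummand hk ⟨z, hz⟩).norm
  have hinj : Function.Injective (fun p : ℕ+ × ℤ => (((p.1 : ℕ) : ℤ), p.2)) := by
    rintro ⟨a, b⟩ ⟨c, d⟩ h
    simp only [Prod.mk.injEq, Nat.cast_inj, PNat.coe_inj] at h
    exact Prod.ext h.1 h.2
  have h1 := (h0.comp_injective hinj).mul_left ((z.im ^ r)⁻¹)
  refine Summable.of_nonneg_of_le (fun _ => norm_nonneg _) (fun p => ?_) h1
  have hc : (0 : ℝ) < p.1 := by exact_mod_cast p.1.pos
  have him : ((p.1 : ℂ) * z + p.2).im = p.1 * z.im := by simp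
  have hle : (p.1 : ℝ) * z.im ≤ ‖(p.1 : ℂ) * z + p.2‖ := by
    rw [← him]; exact (le_abs_self _).trans (Complex.abs_im_le_norm _)
  have hpos : 0 < ‖(p.1 : ℂ) * z + p.2‖ := lt_of_lt_of_le (mul_pos hc hz) hle
  simp only [EisensteinSeries.eisSummand, Function.comp_apply]
  simp only [Matrix.cons_val_zero, Matrix.cons_val_one, norm_div, norm_pow, zpow_neg, norm_inv,
    zpow_natCast, Complex.norm_natCast, Int.cast_natCast]
  have h3 : (p.1 : ℝ) ^ r * z.im ^ r ≤ ‖(p.1 : ℂ) * z + p.2‖ ^ r := by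
    rw [← mul_pow]; gcongr
  rw [pow_add, div_le_iff₀ (by positivity)]
  have : (z.im ^ r)⁻¹ * (‖(p.1 : ℂ) * z + p.2‖ ^ k)⁻¹ *
      (‖(p.1 : ℂ) * z + p.2‖ ^ k * ‖(p.1 : ℂ) * z + p.2‖ ^ r) =
      (z.im ^ r)⁻¹ * ‖(p.1 : ℂ) * z + p.2‖ ^ r := by
    field_simp
  rw [this, le_inv_mul_iff₀ (by positivity)]
  linarith

theorem summable_prod_pow_mul_pow (r m : ℕ) {q : ℂ} (hq : ‖q‖ < 1) :
    Summable fun c : ℕ+ × ℕ+ =>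
      (c.1 : ℂ) ^ r * (c.2 : ℂ) ^ (m + r) * q ^ (c.1 * c.2 : ℕ) := by
  obtain ⟨s, hs1, hs2⟩ := exists_between hq
  have hs0 : 0 ≤ s := (norm_nonneg q).trans hs1.le
  have h := summable_prod_mul_pow (𝕜 := ℝ) (m + r + r) (r := s) (by
    rwa [Real.norm_eq_abs, abs_of_nonneg hs0])
  obtain ⟨C, hC⟩ : ∃ C : ℝ, ∀ n : ℕ, (n : ℝ) ^ r * ‖q‖ ^ n ≤ C * s ^ n := by
    rcases eq_or_lt_of_le hs0 with h0 | h0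
    · rw [← h0] at hs1; exact absurd hs1 (not_lt.mpr (norm_nonneg _))
    have := (summable_pow_mul_geometric_of_norm_lt_one r (r := ‖q‖ / s) (by
      rw [norm_div, norm_norm, Real.norm_eq_abs, abs_of_pos h0]; exact (div_lt_one h0).mpr hs1))
    obtain ⟨C, hC⟩ := this.tendsto_atTop_zero.bddAbove_range
    refine ⟨C, fun n => ?_⟩
    have := hC ⟨n, rfl⟩
    simp only [div_pow] at this
    rw [← div_le_iff₀ (by positivity)]
    calc _ = (n : ℝ) ^ r * (‖q‖ ^ n / s ^ n) := by ring
      _ ≤ C := this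
  refine Summable.of_norm_bounded (h.mul_left C) fun c => ?_
  have h1 := hC (c.1 * c.2 : ℕ)
  have hc2 : (1 : ℝ) ≤ (c.2 : ℕ) := by exact_mod_cast c.2.pos
  simp only [norm_mul, norm_pow, Complex.norm_natCast]
  calc ((c.1 : ℕ) : ℝ) ^ r * ((c.2 : ℕ) : ℝ) ^ (m + r) * ‖q‖ ^ (c.1 * c.2 : ℕ)
      = ((c.2 : ℕ) : ℝ) ^ m * (((c.1 * c.2 : ℕ) : ℝ) ^ r * ‖q‖ ^ (c.1 * c.2 : ℕ)) := by
        push_cast; rw [pow_add, mul_pow]; ring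
    _ ≤ ((c.2 : ℕ) : ℝ) ^ m * (C * s ^ (c.1 * c.2 : ℕ)) := by gcongr
    _ ≤ ((c.2 : ℕ) : ℝ) ^ (m + r + r) * (C * s ^ (c.1 * c.2 : ℕ)) := by
        have : 0 ≤ C * s ^ (c.1 * c.2 : ℕ) := le_trans (by positivity) h1
        exact mul_le_mul_of_nonneg_right (pow_le_pow_right₀ hc2 (by omega)) this
    _ = _ := by ring

theorem tsum_prod_pow_mul_pow (r m : ℕ) {q : ℂ} (hq : ‖q‖ < 1) :
    ∑' c : ℕ+ × ℕ+, (c.1 : ℂ) ^ r * (c.2 : ℂ) ^ (m + r) * q ^ (c.1 * c.2 : ℕ) =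
      ∑' n : ℕ+, ((n : ℂ) ^ r * (σ m n : ℂ)) * q ^ (n : ℕ) := by
  have hs := (sigmaAntidiagonalEquivProd.summable_iff.mpr (summable_prod_pow_mul_pow r m hq))
  rw [← sigmaAntidiagonalEquivProd.tsum_eq]
  refine hs.tsum_sigma.trans ?_
  refine tsum_congr fun n => ?_
  simp only [sigmaAntidiagonalEquivProd, divisorsAntidiagonalFactors, PNat.mk_coe,
    Equiv.coe_fn_mk, Function.comp_apply]
  rw [tsum_fintype, Finset.univ_eq_attach,
    (n : ℕ).divisorsAntidiagonal.sum_attach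
      (fun x : ℕ × ℕ => (x.1 : ℂ) ^ r * (x.2 : ℂ) ^ (m + r) * q ^ (x.1 * x.2)),
    Nat.sum_divisorsAntidiagonal' fun x y => (x : ℂ) ^ r * (y : ℂ) ^ (m + r) * q ^ (x * y),
    ArithmeticFunction.sigma_apply, Nat.cast_sum, Finset.mul_sum, Finset.sum_mul]
  refine Finset.sum_congr rfl fun d hd => ?_
  have hdn := Nat.dvd_of_mem_divisors hd
  rw [Nat.div_mul_cancel hdn]
  have h : (n : ℂ) = ((n / d : ℕ) : ℂ) * d := by exact_mod_cast (Nat.div_mul_cancel hdn).symm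
  rw [h, Nat.cast_pow]
  ring

theorem hasSum_lattice {k : ℕ} (r : ℕ) (hk : 3 ≤ k) {z : ℂ} (hz : 0 < z.im) :
    HasSum (fun p : ℕ+ × ℤ => (p.1 : ℂ) ^ r / ((p.1 : ℂ) * z + p.2) ^ (k + r))
      ((-2 * π * Complex.I) ^ (k + r) / (k + r - 1)! * sigmaSeries k r z) := by
  have hs := (summable_norm_lattice r hk hz).of_norm
  have hq : ‖cexp (2 * π * Complex.I * z)‖ < 1 := norm_exp_two_pi_I_lt_one ⟨z, hz⟩
  refine (hs.hasSum_iff).mpr ?_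
  rw [hs.tsum_prod, sigmaSeries_eq_tsum_pnat k r hz, ← tsum_prod_pow_mul_pow r (k - 1) hq,
    (summable_prod_pow_mul_pow r (k - 1) hq).tsum_prod, ← tsum_mul_left]
  refine tsum_congr fun c => ?_
  have hcz : 0 < ((c : ℂ) * z).im := by simpa using hz
  have H := EisensteinSeries.qExpansion_identity_pnat (k := k + r - 1) (by omega)
    ⟨(c : ℂ) * z, hcz⟩
  rw [show k + r - 1 + 1 = k + r by omega] at H
  simp only at H
  simp_rw [div_eq_mul_one_div ((c : ℂ) ^ r), tsum_mul_left]
  rw [H, mul_left_comm, ← tsum_mul_left]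
  congr 1
  refine tsum_congr fun n => ?_
  rw [← Complex.exp_nat_mul, ← Complex.exp_nat_mul, show k - 1 + r = k + r - 1 by omega, ← mul_assoc]
  congr 2
  push_cast
  ring

theorem riemannZeta_natCast_ne_zero {k : ℕ} (hk : 2 ≤ k) : riemannZeta k ≠ 0 :=
  riemannZeta_ne_zero_of_one_lt_re (by norm_cast)

theorem Ek_lattice {k : ℕ} (hk : 3 ≤ k) (hke : Even k) {z : ℂ} (hz : 0 < z.im) :
    HasSum (fun p : ℕ+ × ℤ => 1 / ((p.1 : ℂ) * z + p.2) ^ k)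
      (riemannZeta k * (Ek k z - 1)) := by
  have h := hasSum_lattice 0 hk hz
  simp only [pow_zero, add_zero] at h
  have hz0 := riemannZeta_natCast_ne_zero (k := k) (by omega)
  convert h using 1
  rw [Ek_eq_sigmaSeries, sub_eq_add_neg (1 : ℂ), ← neg_mul, bernoulli_coeff_eq hke (by omega)]
  field_simp
  ring

theorem deriv_Ek_lattice {k : ℕ} (hk : 3 ≤ k) (hke : Even k) {z : ℂ} (hz : 0 < z.im) :
    HasSum (fun p : ℕ+ × ℤ => (p.1 : ℂ) / ((p.1 : ℂ) * z + p.2) ^ (k + 1))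
      (-riemannZeta k * deriv (Ek k) z / k) := by
  have h := hasSum_lattice 1 hk hz
  simp only [pow_one] at h
  have hz0 := riemannZeta_natCast_ne_zero (k := k) (by omega)
  convert h using 1
  have hk0 : (k : ℂ) ≠ 0 := by exact_mod_cast (by omega : k ≠ 0)
  have hf : ((k - 1)! : ℂ) ≠ 0 := by exact_mod_cast Nat.factorial_ne_zero _
  rw [deriv_Ek k hz, bernoulli_coeff_eq hke (by omega), Nat.add_sub_cancel,
    ← Nat.mul_factorial_pred (by omega : k ≠ 0)]
  push_cast
  field_simp
  ring

theorem deriv_deriv_Ek_lattice {k : ℕ} (hk : 3 ≤ k) (hke : Even k) {z : ℂ} (hz : 0 < z.im) :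
    HasSum (fun p : ℕ+ × ℤ => (p.1 : ℂ) ^ 2 / ((p.1 : ℂ) * z + p.2) ^ (k + 2))
      (riemannZeta k * deriv (deriv (Ek k)) z / (k * (k + 1))) := by
  have h := hasSum_lattice 2 hk hz
  have hz0 := riemannZeta_natCast_ne_zero (k := k) (by omega)
  convert h using 1
  have hk0 : (k : ℂ) ≠ 0 := by exact_mod_cast (by omega : k ≠ 0)
  have hk1 : (k : ℂ) + 1 ≠ 0 := by exact_mod_cast (by omega : k + 1 ≠ 0)
  have hf : ((k - 1)! : ℂ) ≠ 0 := by exact_mod_cast Nat.factorial_ne_zero _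
  rw [deriv_deriv_Ek k hz, bernoulli_coeff_eq hke (by omega),
    show k + 2 - 1 = k + 1 by omega, Nat.factorial_succ,
    ← Nat.mul_factorial_pred (by omega : k ≠ 0)]
  push_cast
  field_simp
  ring

/-- Transformation of `Ek` under `SL₂(ℤ)`. -/
theorem Ek_smul {k : ℕ} (hk : 3 ≤ k) (hke : Even k) (γ : Matrix.SpecialLinearGroup (Fin 2) ℤ)
    (z : ℍ) : Ek k ((γ • z : ℍ) : ℂ) = denom γ z ^ k * Ek k z := by
  have h := SlashInvariantForm.slash_action_eqn'' (ModularForm.E hk)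
    (MonoidHom.mem_range.mpr ⟨γ, rfl⟩) z
  rw [Ek_eq_E hk hke, Ek_eq_E hk hke, ← zpow_natCast]
  exact h

theorem coe_specialLinearGroup_smul (γ : Matrix.SpecialLinearGroup (Fin 2) ℤ) (z : ℍ) :
    ((γ • z : ℍ) : ℂ) = ((γ 0 0 : ℂ) * z + γ 0 1) / ((γ 1 0 : ℂ) * z + γ 1 1) := by
  rw [UpperHalfPlane.specialLinearGroup_apply]
  simp

theorem denom_specialLinearGroup (γ : Matrix.SpecialLinearGroup (Fin 2) ℤ) (z : ℍ) :
    denom γ z = (γ 1 0 : ℂ) * z + γ 1 1 := by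
  simp [denom]

theorem linear_ne_zero {γ : Matrix.SpecialLinearGroup (Fin 2) ℤ} {z : ℂ} (hz : 0 < z.im) :
    (γ 1 0 : ℂ) * z + γ 1 1 ≠ 0 := by
  rw [← denom_specialLinearGroup γ ⟨z, hz⟩]
  exact denom_ne_zero _ _

theorem hasDerivAt_moebius (γ : Matrix.SpecialLinearGroup (Fin 2) ℤ) {z : ℂ} (hz : 0 < z.im) :
    HasDerivAt (fun w : ℂ => ((γ 0 0 : ℂ) * w + γ 0 1) / ((γ 1 0 : ℂ) * w + γ 1 1))
      (1 / ((γ 1 0 : ℂ) * z + γ 1 1) ^ 2) z := by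
  have hj := linear_ne_zero (γ := γ) hz
  have h1 : HasDerivAt (fun w : ℂ => (γ 0 0 : ℂ) * w + γ 0 1) (γ 0 0 : ℂ) z := by
    simpa using ((hasDerivAt_id z).const_mul (γ 0 0 : ℂ)).add_const (γ 0 1 : ℂ)
  have h2 : HasDerivAt (fun w : ℂ => (γ 1 0 : ℂ) * w + γ 1 1) (γ 1 0 : ℂ) z := by
    simpa using ((hasDerivAt_id z).const_mul (γ 1 0 : ℂ)).add_const (γ 1 1 : ℂ)
  have hdet : (γ 0 0 : ℂ) * γ 1 1 - γ 0 1 * γ 1 0 = 1 := by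
    have := γ.det_coe
    rw [Matrix.det_fin_two] at this
    exact_mod_cast this
  refine (h1.div h2 hj).congr_deriv ?_
  congr 1
  linear_combination hdet

theorem moebius_im_pos (γ : Matrix.SpecialLinearGroup (Fin 2) ℤ) {z : ℂ} (hz : 0 < z.im) :
    0 < (((γ 0 0 : ℂ) * z + γ 0 1) / ((γ 1 0 : ℂ) * z + γ 1 1)).im := by
  have := coe_specialLinearGroup_smul γ ⟨z, hz⟩
  simp only at this
  rw [← this]
  exact (γ • (⟨z, hz⟩ : ℍ)).im_pos

theorem Ek_moebius {k : ℕ} (hk : 3 ≤ k) (hke : Even k)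
    (γ : Matrix.SpecialLinearGroup (Fin 2) ℤ) {z : ℂ} (hz : 0 < z.im) :
    Ek k (((γ 0 0 : ℂ) * z + γ 0 1) / ((γ 1 0 : ℂ) * z + γ 1 1)) =
      ((γ 1 0 : ℂ) * z + γ 1 1) ^ k * Ek k z := by
  have := Ek_smul hk hke γ ⟨z, hz⟩
  rwa [coe_specialLinearGroup_smul, denom_specialLinearGroup] at this

theorem deriv_Ek_moebius {k : ℕ} (hk : 3 ≤ k) (hke : Even k)
    (γ : Matrix.SpecialLinearGroup (Fin 2) ℤ) {z : ℂ} (hz : 0 < z.im) :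
    deriv (Ek k) (((γ 0 0 : ℂ) * z + γ 0 1) / ((γ 1 0 : ℂ) * z + γ 1 1)) =
      ((γ 1 0 : ℂ) * z + γ 1 1) ^ (k + 1) *
        (k * γ 1 0 * Ek k z + ((γ 1 0 : ℂ) * z + γ 1 1) * deriv (Ek k) z) := by
  have hj := linear_ne_zero (γ := γ) hz
  have h1 := (hasDerivAt_Ek' k (moebius_im_pos γ hz)).comp z (hasDerivAt_moebius γ hz)
  have h2 : HasDerivAt (fun w : ℂ => (γ 1 0 : ℂ) * w + γ 1 1) (γ 1 0 : ℂ) z := by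
    simpa using ((hasDerivAt_id z).const_mul (γ 1 0 : ℂ)).add_const (γ 1 1 : ℂ)
  have h3 := (h2.pow k).mul (hasDerivAt_Ek' k hz)
  have h4 := h1.unique (h3.congr_of_eventuallyEq
    ((eventually_im_pos hz).mono fun w hw => Ek_moebius hk hke γ hw))
  obtain ⟨m, rfl⟩ : ∃ m, k = m + 1 := ⟨k - 1, by omega⟩
  rw [mul_one_div, div_eq_iff (pow_ne_zero _ hj)] at h4
  rw [h4, Nat.add_sub_cancel, Pi.pow_apply]
  ring

theorem deriv_deriv_Ek_moebius {k : ℕ} (hk : 3 ≤ k) (hke : Even k)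
    (γ : Matrix.SpecialLinearGroup (Fin 2) ℤ) {z : ℂ} (hz : 0 < z.im) :
    deriv (deriv (Ek k)) (((γ 0 0 : ℂ) * z + γ 0 1) / ((γ 1 0 : ℂ) * z + γ 1 1)) =
      ((γ 1 0 : ℂ) * z + γ 1 1) ^ (k + 2) *
        (k * (k + 1) * (γ 1 0 : ℂ) ^ 2 * Ek k z +
          2 * (k + 1) * γ 1 0 * ((γ 1 0 : ℂ) * z + γ 1 1) * deriv (Ek k) z +
          ((γ 1 0 : ℂ) * z + γ 1 1) ^ 2 * deriv (deriv (Ek k)) z) := by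
  have hj := linear_ne_zero (γ := γ) hz
  have h1 := (hasDerivAt_deriv_Ek' k (moebius_im_pos γ hz)).comp z (hasDerivAt_moebius γ hz)
  have h2 : HasDerivAt (fun w : ℂ => (γ 1 0 : ℂ) * w + γ 1 1) (γ 1 0 : ℂ) z := by
    simpa using ((hasDerivAt_id z).const_mul (γ 1 0 : ℂ)).add_const (γ 1 1 : ℂ)
  have h3 := (h2.pow (k + 1)).mul (((hasDerivAt_Ek' k hz).const_mul ((k : ℂ) * γ 1 0)).add
    (h2.mul (hasDerivAt_deriv_Ek' k hz)))
  have h4 := h1.unique (h3.congr_of_eventuallyEq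
    ((eventually_im_pos hz).mono fun w hw => deriv_Ek_moebius hk hke γ hw))
  rw [mul_one_div, div_eq_iff (pow_ne_zero _ hj)] at h4
  rw [h4, Nat.add_sub_cancel, Pi.pow_apply]
  simp only [Pi.add_apply, Pi.mul_apply]
  push_cast
  ring

/-- The covariant `(k+1) E_k'² - k E_k E_k''` of weight `2k+4`. -/
noncomputable def rankinCohen (k : ℕ) (z : ℂ) : ℂ :=
  (k + 1) * deriv (Ek k) z ^ 2 - k * Ek k z * deriv (deriv (Ek k)) z

theorem rankinCohen_moebius {k : ℕ} (hk : 3 ≤ k) (hke : Even k)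
    (γ : Matrix.SpecialLinearGroup (Fin 2) ℤ) {z : ℂ} (hz : 0 < z.im) :
    rankinCohen k (((γ 0 0 : ℂ) * z + γ 0 1) / ((γ 1 0 : ℂ) * z + γ 1 1)) =
      ((γ 1 0 : ℂ) * z + γ 1 1) ^ (2 * k + 4) * rankinCohen k z := by
  simp only [rankinCohen, Ek_moebius hk hke γ hz, deriv_Ek_moebius hk hke γ hz,
    deriv_deriv_Ek_moebius hk hke γ hz]
  ring

/-- The filter of complex numbers with imaginary part tending to `+∞`. -/
def imInfty : Filter ℂ := comap Complex.im atTop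

theorem eventually_imInfty_im_gt (A : ℝ) : ∀ᶠ z in imInfty, A < Complex.im z :=
  tendsto_comap.eventually (eventually_gt_atTop A)

theorem tendsto_cexp_imInfty : Tendsto (fun z => cexp (2 * π * Complex.I * z)) imInfty (𝓝 0) := by
  rw [tendsto_zero_iff_norm_tendsto_zero]
  simp only [norm_cexp_two_pi]
  have : Tendsto (fun y : ℝ => Real.exp (-2 * π * y)) atTop (𝓝 0) :=
    Real.tendsto_exp_atBot.comp
      (tendsto_id.const_mul_atTop_of_neg (by linarith [Real.pi_pos] : (-2 * π) < 0))
  exact this.comp tendsto_comap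

theorem tendsto_sigmaSeries_div (k r : ℕ) :
    Tendsto (fun z => sigmaSeries k r z / cexp (2 * π * Complex.I * z)) imInfty (𝓝 1) := by
  have hlim : ∑' n : ℕ, (if n = 1 then (1 : ℂ) else 0) = 1 := tsum_ite_eq 1 _
  rw [← hlim]
  have hb : Summable fun n : ℕ => Real.exp (2 * π) *
      ((n : ℝ) ^ (r + (k - 1) + 1) * Real.exp (-2 * π * 1) ^ n) :=
    (summable_sigmaSeries_bound _ one_pos).mul_left _
  have := tendsto_tsum_of_dominated_convergence (𝓕 := imInfty) hb
    (f := fun z (n : ℕ) => ((n : ℂ) ^ r * (σ (k - 1) n : ℂ)) * cexp (2 * π * Complex.I * z) ^ n /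
      cexp (2 * π * Complex.I * z)) (g := fun n : ℕ => (if n = 1 then (1 : ℂ) else 0)) ?_ ?_
  · refine this.congr fun z => ?_
    rw [sigmaSeries, tsum_div_const]
  · intro n
    rcases n with _ | _ | n
    · simpa using tendsto_const_nhds
    · simpa using tendsto_const_nhds
    · have h : ∀ z, ((n + 1 + 1 : ℕ) : ℂ) ^ r * (σ (k - 1) (n + 1 + 1) : ℂ) *
          cexp (2 * π * Complex.I * z) ^ (n + 1 + 1) / cexp (2 * π * Complex.I * z) =
          ((n + 1 + 1 : ℕ) : ℂ) ^ r * (σ (k - 1) (n + 1 + 1) : ℂ) *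
          cexp (2 * π * Complex.I * z) ^ (n + 1) := by
        intro z
        have := Complex.exp_ne_zero (2 * π * Complex.I * z)
        field_simp
        ring
      simp only [h]
      simpa using (tendsto_cexp_imInfty.pow (n + 1)).const_mul
        (((n + 1 + 1 : ℕ) : ℂ) ^ r * (σ (k - 1) (n + 1 + 1) : ℂ))
  · filter_upwards [eventually_imInfty_im_gt 1] with z hz n
    rcases n with _ | n
    · simp
    · have hq := Complex.exp_ne_zero (2 * π * Complex.I * z)
      have hle : ‖cexp (2 * π * Complex.I * z)‖ ≤ Real.exp (-2 * π * 1) := by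
        rw [norm_cexp_two_pi, Real.exp_le_exp]
        nlinarith [Real.pi_pos]
      rw [pow_succ, ← mul_assoc, mul_div_assoc, div_self hq, mul_one, norm_mul, norm_pow]
      calc _ ≤ ((n + 1 : ℕ) : ℝ) ^ (r + (k - 1) + 1) * Real.exp (-2 * π * 1) ^ n := by
            gcongr
            exact norm_sigma_coeff_le _ _ _
        _ = _ := by
            rw [pow_succ (Real.exp (-2 * π * 1))]
            have : Real.exp (2 * π) * Real.exp (-2 * π * 1) = 1 := by
              rw [← Real.exp_add]; simp
            linear_combination (-((n + 1 : ℕ) : ℝ) ^ (r + (k - 1) + 1) *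
              Real.exp (-2 * π * 1) ^ n) * this

theorem tendsto_sigmaSeries (k r : ℕ) : Tendsto (sigmaSeries k r) imInfty (𝓝 0) := by
  have := (tendsto_sigmaSeries_div k r).mul tendsto_cexp_imInfty
  rw [one_mul] at this
  exact this.congr fun z => div_mul_cancel₀ _ (Complex.exp_ne_zero _)

theorem tendsto_Ek (k : ℕ) : Tendsto (Ek k) imInfty (𝓝 1) := by
  have := ((tendsto_sigmaSeries k 0).const_mul
    (2 * (k : ℂ) / ((bernoulli k : ℚ) : ℂ))).const_sub 1
  rw [mul_zero, sub_zero] at this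
  exact this.congr fun z => (Ek_eq_sigmaSeries k z).symm

theorem tendsto_deriv_Ek_div (k : ℕ) :
    Tendsto (fun z => deriv (Ek k) z / cexp (2 * π * Complex.I * z)) imInfty
      (𝓝 (-(2 * (k : ℂ) / ((bernoulli k : ℚ) : ℂ)) * (2 * π * Complex.I))) := by
  have := (tendsto_sigmaSeries_div k 1).const_mul
    (-(2 * (k : ℂ) / ((bernoulli k : ℚ) : ℂ)) * (2 * π * Complex.I))
  rw [mul_one] at this
  refine this.congr' ?_
  filter_upwards [eventually_imInfty_im_gt 0] with z hz
  rw [deriv_Ek k hz]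
  ring

theorem tendsto_deriv_deriv_Ek_div (k : ℕ) :
    Tendsto (fun z => deriv (deriv (Ek k)) z / cexp (2 * π * Complex.I * z)) imInfty
      (𝓝 (-(2 * (k : ℂ) / ((bernoulli k : ℚ) : ℂ)) * (2 * π * Complex.I) ^ 2)) := by
  have := (tendsto_sigmaSeries_div k 2).const_mul
    (-(2 * (k : ℂ) / ((bernoulli k : ℚ) : ℂ)) * (2 * π * Complex.I) ^ 2)
  rw [mul_one] at this
  refine this.congr' ?_
  filter_upwards [eventually_imInfty_im_gt 0] with z hz
  rw [deriv_deriv_Ek k hz]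
  ring

theorem tendsto_deriv_Ek (k : ℕ) : Tendsto (deriv (Ek k)) imInfty (𝓝 0) := by
  have := (tendsto_deriv_Ek_div k).mul tendsto_cexp_imInfty
  rw [mul_zero] at this
  exact this.congr fun z => div_mul_cancel₀ _ (Complex.exp_ne_zero _)

theorem tendsto_rankinCohen_div (k : ℕ) :
    Tendsto (fun z => rankinCohen k z / cexp (2 * π * Complex.I * z)) imInfty
      (𝓝 (k * (2 * (k : ℂ) / ((bernoulli k : ℚ) : ℂ)) * (2 * π * Complex.I) ^ 2)) := by
  have h := (((tendsto_deriv_Ek k).mul (tendsto_deriv_Ek_div k)).const_mul ((k : ℂ) + 1)).sub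
    (((tendsto_Ek k).mul (tendsto_deriv_deriv_Ek_div k)).const_mul (k : ℂ))
  have h' := h.congr (f₂ := fun z => rankinCohen k z / cexp (2 * π * Complex.I * z)) fun z => by
    simp only [rankinCohen]; ring
  convert h' using 2
  ring

theorem tendsto_rankinCohen (k : ℕ) : Tendsto (rankinCohen k) imInfty (𝓝 0) := by
  have := (tendsto_rankinCohen_div k).mul tendsto_cexp_imInfty
  rw [mul_zero] at this
  exact this.congr fun z => div_mul_cancel₀ _ (Complex.exp_ne_zero _)

instance : NeBot imInfty := by
  refine comap_neBot fun t ht => ?_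
  obtain ⟨y, hy⟩ := (atTop : Filter ℝ).nonempty_of_mem ht
  exact ⟨y * Complex.I, by simpa using hy⟩

theorem bernoulli_coeff_ne_zero {k : ℕ} (hke : Even k) (hk : 3 ≤ k) :
    2 * (k : ℂ) / ((bernoulli k : ℚ) : ℂ) ≠ 0 := by
  rw [← neg_ne_zero, bernoulli_coeff_eq hke (by omega)]
  have := riemannZeta_natCast_ne_zero (k := k) (by omega)
  have hf : ((k - 1)! : ℂ) ≠ 0 := by exact_mod_cast Nat.factorial_ne_zero _
  have hp : (π : ℂ) ≠ 0 := by exact_mod_cast Real.pi_ne_zero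
  simp [this, hf, hp, div_eq_zero_iff]

theorem exists_rankinCohen_ne_zero {k : ℕ} (hke : Even k) (hk : 3 ≤ k) :
    ∃ z : ℂ, 0 < z.im ∧ rankinCohen k z ≠ 0 := by
  have hp : (π : ℂ) ≠ 0 := by exact_mod_cast Real.pi_ne_zero
  have hk0 : (k : ℂ) ≠ 0 := by exact_mod_cast (by omega : k ≠ 0)
  have hne : k * (2 * (k : ℂ) / ((bernoulli k : ℚ) : ℂ)) * (2 * π * Complex.I) ^ 2 ≠ 0 :=
    mul_ne_zero (mul_ne_zero hk0 (bernoulli_coeff_ne_zero hke hk)) (by simp [hp])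
  obtain ⟨z, h1, h2⟩ := (((tendsto_rankinCohen_div k).eventually_ne hne).and
    (eventually_imInfty_im_gt 0)).exists
  exact ⟨z, h2, fun h => h1 (by simp [h])⟩

theorem differentiableOn_rankinCohen (k : ℕ) :
    DifferentiableOn ℂ (rankinCohen k) {z | 0 < z.im} := by
  have h0 := differentiableOn_Ek k
  have h1 := h0.deriv isOpen_im_pos
  have h2 := h1.deriv isOpen_im_pos
  unfold rankinCohen
  exact ((h1.pow 2).const_mul _).sub ((h0.const_mul _).mul h2)

theorem rankinCohen_slash {k : ℕ} (hk : 3 ≤ k) (hke : Even k) (γ : SL(2, ℤ)) :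
    (fun z : ℍ => rankinCohen k z) ∣[((2 * k + 4 : ℕ) : ℤ)] γ = fun z : ℍ => rankinCohen k z := by
  funext z
  rw [ModularForm.SL_slash_apply]
  have h := rankinCohen_moebius hk hke γ z.im_pos
  have hd := denom_ne_zero γ z
  rw [coe_specialLinearGroup_smul, h, ← denom_specialLinearGroup, zpow_neg, zpow_natCast]
  field_simp

/-- The covariant `(k+1) E_k'² - k E_k E_k''` as a cusp form. -/
noncomputable def rankinCohenForm {k : ℕ} (hk : 3 ≤ k) (hke : Even k) :
    CuspForm 𝒮ℒ ((2 * k + 4 : ℕ) : ℤ) where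
  toFun z := rankinCohen k z
  slash_action_eq' := fun _ ⟨γ, hγ⟩ => hγ ▸ rankinCohen_slash hk hke γ
  holo' := by
    rw [UpperHalfPlane.mdifferentiable_iff]
    refine (differentiableOn_rankinCohen k).congr fun z hz => ?_
    simp only [Function.comp_apply, ofComplex_apply_of_im_pos hz]
    rfl
  zero_at_cusps' {c} hc := by
    rw [Subgroup.IsArithmetic.isCusp_iff_isCusp_SL2Z] at hc
    rw [OnePoint.isZeroAt_iff_forall_SL2Z hc]
    intro γ _
    rw [rankinCohen_slash hk hke γ, IsZeroAtImInfty, ZeroAtFilter]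
    exact (tendsto_rankinCohen k).comp (tendsto_comap_iff.mpr tendsto_comap)

/-- The modular function `E₄ ^ 3 / Δ`. -/
noncomputable def jFun (z : ℍ) : ℂ := ModularForm.E₄ z ^ 3 / ModularForm.discriminant z

lemma coeff_zero_E₄ : (qExpansion 1 ModularForm.E₄).coeff 0 = 1 :=
  EisensteinSeries.E_qExpansion_coeff_zero _ ⟨2, rfl⟩

lemma coeff_zero_E₆ : (qExpansion 1 ModularForm.E₆).coeff 0 = 1 :=
  EisensteinSeries.E_qExpansion_coeff_zero _ ⟨3, rfl⟩

lemma exists_form_sub {w : ℤ} (m a b : ℕ) (hw : w = 12 * m + 4 * a + 6 * b)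
    (f : ModularForm 𝒮ℒ w) :
    ∃ (c : ℂ) (g : ModularForm 𝒮ℒ (w - 12)), ∀ z, f z =
      c * (ModularForm.E₄ z ^ (3 * m + a) * ModularForm.E₆ z ^ b) +
        ModularForm.discriminant z * g z := by
  set c := (qExpansion 1 f).coeff 0 with hc
  let g₀ : ModularForm 𝒮ℒ w := ModularForm.mcast (by rw [hw]; push_cast; ring)
    ((ModularForm.E₄.pow (3 * m + a)).mul (ModularForm.E₆.pow b))
  have hg₀ : ∀ z, g₀ z = ModularForm.E₄ z ^ (3 * m + a) * ModularForm.E₆ z ^ b := by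
    intro z
    have h4 : (ModularForm.E₄.pow (3 * m + a)) z = ModularForm.E₄ z ^ (3 * m + a) := by
      rw [ModularForm.coe_pow]; rfl
    have h6 : (ModularForm.E₆.pow b) z = ModularForm.E₆ z ^ b := by
      rw [ModularForm.coe_pow]; rfl
    rw [← h4, ← h6]
    rfl
  have h0 : (qExpansion 1 g₀).coeff 0 = 1 := by
    simp only [g₀, ModularForm.coe_mcast]
    rw [ModularForm.qExpansion_mul one_pos one_mem_strictPeriods_SL,
      ModularForm.qExpansion_pow one_pos one_mem_strictPeriods_SL,
      ModularForm.qExpansion_pow one_pos one_mem_strictPeriods_SL]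
    have h4 := coeff_zero_E₄
    have h6 := coeff_zero_E₆
    simp only [PowerSeries.coeff_zero_eq_constantCoeff] at h4 h6 ⊢
    simp [h4, h6]
  have hcusp : (qExpansion 1 (⇑(f - c • g₀ : ModularForm 𝒮ℒ w))).coeff 0 = 0 := by
    have hs : qExpansion 1 (⇑(c • g₀ : ModularForm 𝒮ℒ w)) = c • qExpansion 1 g₀ :=
      ModularForm.qExpansion_smul one_pos one_mem_strictPeriods_SL c g₀
    rw [FunLike.coe_sub, ModularForm.qExpansion_sub one_pos one_mem_strictPeriods_SL, hs,
      map_sub, PowerSeries.coeff_smul, h0, ← hc]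
    simp
  refine ⟨c, CuspForm.discriminantEquiv (ModularForm.toCuspForm (f - c • g₀) hcusp), fun z => ?_⟩
  rw [ModularForm.discriminant_mul_discriminantEquiv_apply, ModularForm.toCuspForm_apply]
  simp [hg₀]

theorem exists_polynomial_repr (m a b : ℕ) (ha : a ≤ 2) (hb : b ≤ 1) :
    ∀ {w : ℤ} (_ : w = 12 * m + 4 * a + 6 * b) (f : ModularForm 𝒮ℒ w),
    ∃ p : Polynomial ℂ, p.natDegree ≤ m ∧ ∀ z, f z =
      ModularForm.E₄ z ^ a * ModularForm.E₆ z ^ b * ModularForm.discriminant z ^ m *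
        p.eval (jFun z) := by
  induction m with
  | zero =>
    intro w hw f
    obtain ⟨c, g, hg⟩ := exists_form_sub 0 a b hw f
    have hg0 : g = 0 := by
      rcases lt_or_ge (w - 12) 0 with h | h
      · exact rank_zero_iff_forall_zero.mp (ModularForm.levelOne_neg_weight_rank_zero h) g
      · have h2 : w - 12 = 2 := by push_cast at hw; omega
        revert g
        rw [h2]
        exact fun g _ => rank_zero_iff_forall_zero.mp ModularForm.levelOne_weight_two_rank_zero g
    refine ⟨Polynomial.C c, by simp, fun z => ?_⟩
    rw [hg, hg0]
    simp
    ring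
  | succ m ih =>
    intro w hw f
    obtain ⟨c, g, hg⟩ := exists_form_sub (m + 1) a b hw f
    obtain ⟨p, hp, hpg⟩ := ih (by rw [hw]; push_cast; ring) g
    refine ⟨p + Polynomial.C c * Polynomial.X ^ (m + 1), ?_, fun z => ?_⟩
    · refine (Polynomial.natDegree_add_le _ _).trans (max_le (hp.trans (by simp)) ?_)
      exact Polynomial.natDegree_C_mul_X_pow_le _ _
    · have hΔ := ModularForm.discriminant_ne_zero z
      rw [hg, hpg]
      simp only [Polynomial.eval_add, Polynomial.eval_mul, Polynomial.eval_C, Polynomial.eval_pow, Polynomial.eval_X]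
      have : ModularForm.discriminant z ^ (m + 1) * jFun z ^ (m + 1) =
          ModularForm.E₄ z ^ (3 * (m + 1)) := by
        rw [jFun, ← mul_pow, mul_div_cancel₀ _ hΔ, ← pow_mul]
      rw [pow_add, ← this]
      ring

namespace PeriodPair

lemma weierstrassPExcept_zero_eventuallyEq {L L' : PeriodPair} (h : ∀ n, 3 ≤ n → L.G n = L'.G n) :
    L.weierstrassPExcept 0 =ᶠ[𝓝 0] L'.weierstrassPExcept 0 := by
  have h0 (L : PeriodPair) : L.weierstrassPExcept 0 0 = 0 := by
    simp [weierstrassPExcept]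
  have h1 := L.hasFPowerSeriesAt_weierstrassPExcept 0
  have h2 := L'.hasFPowerSeriesAt_weierstrassPExcept 0
  have : (fun i : ℕ ↦ if i = 0 then L.weierstrassPExcept 0 0 else (i + 1) * L.sumInvPow 0 (i + 2)) =
      (fun i : ℕ ↦ if i = 0 then L'.weierstrassPExcept 0 0
        else (i + 1) * L'.sumInvPow 0 (i + 2)) := by
    ext i
    rcases Nat.eq_zero_or_pos i with rfl | hi
    · simp [h0]
    · simp only [hi.ne', if_false, sumInvPow_zero]
      rw [h (i + 2) (by omega)]
  rw [this] at h1
  filter_upwards [h1.eventually_hasSum_sub, h2.eventually_hasSum_sub] with z hz hz'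
  exact hz.unique hz'

lemma countable_lattice (L : PeriodPair) : (L.lattice : Set ℂ).Countable := by
  have : Countable L.lattice := L.latticeEquivProd.toEquiv.countable_iff.mpr inferInstance
  exact Set.countable_coe_iff.mp this

lemma lattice_le_of_G_eq {L L' : PeriodPair} (h : ∀ n, 3 ≤ n → L.G n = L'.G n) :
    L.lattice ≤ L'.lattice := by
  intro v hv
  by_contra hv'
  have hv0 : v ≠ 0 := fun h => hv' (h ▸ zero_mem _)
  set S : Set ℂ := ((L.lattice : Set ℂ) \ {0}) ∪ ((L'.lattice : Set ℂ) \ {0})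
  have hSc : S.Countable := (L.countable_lattice.mono Set.sdiff_subset).union
    (L'.countable_lattice.mono Set.sdiff_subset)
  have hconn : IsConnected Sᶜ := hSc.isConnected_compl_of_one_lt_rank (by
    rw [Complex.rank_real_complex]; exact_mod_cast one_lt_two)
  have hEq : Set.EqOn (L.weierstrassPExcept 0) (L'.weierstrassPExcept 0) Sᶜ := by
    refine AnalyticOnNhd.eqOn_of_preconnected_of_eventuallyEq (z₀ := 0)
      ((L.analyticOnNhd_weierstrassPExcept 0).mono ?_)
      ((L'.analyticOnNhd_weierstrassPExcept 0).mono ?_) hconn.isPreconnected ?_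
      (weierstrassPExcept_zero_eventuallyEq h)
    · exact Set.compl_subset_compl.mpr Set.subset_union_left
    · exact Set.compl_subset_compl.mpr Set.subset_union_right
    · simp [S]
  have hnear : L.weierstrassP =ᶠ[𝓝[≠] v] fun z => L'.weierstrassPExcept 0 z + 1 / z ^ 2 := by
    have e1 : ∀ᶠ z in 𝓝 v, z ∈ ((L.lattice : Set ℂ) \ {v})ᶜ :=
      L.compl_lattice_sdiff_singleton_mem_nhds v
    have e2 : ∀ᶠ z in 𝓝 v, z ∈ (L'.lattice : Set ℂ)ᶜ :=
      L'.isClosed_lattice.isOpen_compl.mem_nhds hv'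
    filter_upwards [e1.filter_mono nhdsWithin_le_nhds, e2.filter_mono nhdsWithin_le_nhds,
      self_mem_nhdsWithin] with z h1 h2 h3
    have hz : z ∈ Sᶜ := by
      simp only [S, Set.mem_compl_iff, Set.mem_union, Set.mem_sdiff, Set.mem_singleton_iff,
        not_or, not_and] at *
      exact ⟨fun hz => (h1 hz h3).elim, fun hz => (h2 hz).elim⟩
    have := L.weierstrassPExcept_def ⟨0, zero_mem _⟩ z
    rw [← hEq hz, this]
    simp
  have hord := L.order_weierstrassP v hv
  rw [meromorphicOrderAt_congr hnear] at hord
  have han : AnalyticAt ℂ (fun z => L'.weierstrassPExcept 0 z + 1 / z ^ 2) v := by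
    have := L'.analyticOnNhd_weierstrassPExcept 0 v (by simp [hv'])
    refine this.add (analyticAt_const.div (analyticAt_id.pow 2) (by simpa using hv0))
  have := han.meromorphicOrderAt_nonneg
  rw [hord] at this
  exact absurd this (by decide)

/-- The period pair `(c, c z)`. -/
noncomputable def scaled (c z : ℂ) (hc : c ≠ 0) (hz : 0 < z.im) : PeriodPair where
  ω₁ := c
  ω₂ := c * z
  indep := by
    rw [LinearIndependent.pair_iff]
    intro s t h
    have h' : c * ((s : ℂ) + t * z) = 0 := by
      rw [← h]; simp; ring
    have h2 := (mul_eq_zero.mp h').resolve_left hc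
    have him := congrArg Complex.im h2
    have hre := congrArg Complex.re h2
    simp at him hre
    have ht : t = 0 := him.resolve_right hz.ne'
    subst ht
    simpa using hre

lemma G_scaled {n : ℕ} (hn : 3 ≤ n) (c : ℂ) (hc : c ≠ 0) (z : ℍ) :
    (scaled c z hc z.im_pos).G n = (c ^ n)⁻¹ * (2 * riemannZeta n * ModularForm.E hn z) := by
  have h1 : ModularForm.E hn z =
      (1 / 2 : ℂ) * eisensteinSeries (N := 1) 0 n z := rfl
  have h2 := tsum_eisSummand_eq_riemannZeta_mul_eisensteinSeries hn z
  rw [h1, show 2 * riemannZeta n * (1 / 2 * eisensteinSeries (N := 1) 0 n z) =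
    riemannZeta n * eisensteinSeries (N := 1) 0 n z by ring, ← h2, G,
    ← (scaled c z hc z.im_pos).latticeEquivProd.symm.toEquiv.tsum_eq,
    ← (finTwoArrowEquiv ℤ).symm.tsum_eq, ← (Equiv.prodComm ℤ ℤ).tsum_eq, ← tsum_mul_left]
  congr with p
  have h3 : (((scaled c z hc z.im_pos).latticeEquivProd.symm.toEquiv
      (Equiv.prodComm ℤ ℤ p) : (scaled c z hc z.im_pos).lattice) : ℂ) =
      c * ((p.1 : ℂ) * z + p.2) := by
    refine (latticeEquiv_symm_apply _ _).trans ?_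
    simp [scaled]
    ring
  rw [h3, mul_pow, mul_inv]
  simp [EisensteinSeries.eisSummand]

end PeriodPair

lemma eq_zero_of_int_add_int_mul {z : ℂ} (hz : 0 < z.im) {m n : ℤ} (h : (m : ℂ) + n * z = 0) :
    m = 0 ∧ n = 0 := by
  have him := congrArg Complex.im h
  have hre := congrArg Complex.re h
  simp at him hre
  have ht : n = 0 := him.resolve_right hz.ne'
  subst ht
  simpa using hre

lemma E₆_sq (z : ℍ) : ModularForm.E₆ z ^ 2 =
    ModularForm.discriminant z * (jFun z - 1728) := by
  have h := ModularForm.discriminant_eq_E₄_cube_sub_E₆_sq z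
  have h0 := ModularForm.discriminant_ne_zero z
  rw [jFun, mul_sub, mul_div_cancel₀ _ h0]
  linear_combination 1728 * h

lemma E₄_cube (z : ℍ) : ModularForm.E₄ z ^ 3 = ModularForm.discriminant z * jFun z := by
  rw [jFun, mul_div_cancel₀ _ (ModularForm.discriminant_ne_zero z)]

lemma exists_scaling {z₁ z₂ : ℍ} (h : jFun z₁ = jFun z₂) : ∃ l : ℂ, l ≠ 0 ∧
    ModularForm.E₄ z₂ = l ^ 4 * ModularForm.E₄ z₁ ∧
    ModularForm.E₆ z₂ = l ^ 6 * ModularForm.E₆ z₁ := by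
  have h41 := E₄_cube z₁
  have h42 := E₄_cube z₂
  have h61 := E₆_sq z₁
  have h62 := E₆_sq z₂
  have hd1 := ModularForm.discriminant_ne_zero z₁
  have hd2 := ModularForm.discriminant_ne_zero z₂
  rw [← h] at h42 h62
  set x₁ := ModularForm.E₄ z₁
  set x₂ := ModularForm.E₄ z₂
  set y₁ := ModularForm.E₆ z₁
  set y₂ := ModularForm.E₆ z₂
  set d₁ := ModularForm.discriminant z₁
  set d₂ := ModularForm.discriminant z₂
  set J := jFun z₁
  by_cases hJ : J = 0
  · rw [hJ, mul_zero] at h41 h42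
    have hx1 : x₁ = 0 := by simpa using h41
    have hx2 : x₂ = 0 := by simpa using h42
    have hy1 : y₁ ≠ 0 := by
      intro h0; rw [h0, hJ] at h61; simp [hd1] at h61
    have hy2 : y₂ ≠ 0 := by
      intro h0; rw [h0, hJ] at h62; simp [hd2] at h62
    obtain ⟨l, hl⟩ := IsAlgClosed.exists_pow_nat_eq (y₂ / y₁) (show 0 < 6 by norm_num)
    refine ⟨l, ?_, by simp [hx1, hx2], by rw [hl]; field_simp⟩
    rintro rfl
    rw [zero_pow (by norm_num)] at hl
    exact div_ne_zero hy2 hy1 hl.symm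
  have hx1 : x₁ ≠ 0 := by
    intro h0; rw [h0] at h41; simp [hd1, hJ, eq_comm] at h41
  have hx2 : x₂ ≠ 0 := by
    intro h0; rw [h0] at h42; simp [hd2, hJ, eq_comm] at h42
  by_cases hJ' : J - 1728 = 0
  · rw [hJ', mul_zero] at h61 h62
    have hy1 : y₁ = 0 := by simpa using h61
    have hy2 : y₂ = 0 := by simpa using h62
    obtain ⟨l, hl⟩ := IsAlgClosed.exists_pow_nat_eq (x₂ / x₁) (show 0 < 4 by norm_num)
    refine ⟨l, ?_, by rw [hl]; field_simp, by simp [hy1, hy2]⟩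
    rintro rfl
    rw [zero_pow (by norm_num)] at hl
    exact div_ne_zero hx2 hx1 hl.symm
  have hy1 : y₁ ≠ 0 := by
    intro h0; rw [h0] at h61; simp [hd1, hJ', eq_comm] at h61
  have hy2 : y₂ ≠ 0 := by
    intro h0; rw [h0] at h62; simp [hd2, hJ', eq_comm] at h62
  obtain ⟨l, hl⟩ := IsAlgClosed.exists_pow_nat_eq ((y₂ / y₁) / (x₂ / x₁)) (show 0 < 2 by norm_num)
  have hxy : x₂ ^ 3 * y₁ ^ 2 = y₂ ^ 2 * x₁ ^ 3 := by rw [h41, h42, h61, h62]; ring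
  refine ⟨l, ?_, ?_, ?_⟩
  · rintro rfl
    rw [zero_pow (by norm_num)] at hl
    exact div_ne_zero (div_ne_zero hy2 hy1) (div_ne_zero hx2 hx1) hl.symm
  · rw [show l ^ 4 = (l ^ 2) ^ 2 by ring, hl]
    field_simp
    linear_combination hxy
  · rw [show l ^ 6 = (l ^ 2) ^ 3 by ring, hl]
    field_simp
    linear_combination hxy

lemma exists_scaling_forms {z₁ z₂ : ℍ} (h : jFun z₁ = jFun z₂) : ∃ l : ℂ, l ≠ 0 ∧
    ∀ n : ℕ, 4 ≤ n → Even n → ∀ f : ModularForm 𝒮ℒ (n : ℤ), f z₂ = l ^ n * f z₁ := by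
  obtain ⟨l, hl, h4, h6⟩ := exists_scaling h
  refine ⟨l, hl, fun n hn hne f => ?_⟩
  have hd : ModularForm.discriminant z₂ = l ^ 12 * ModularForm.discriminant z₁ := by
    rw [ModularForm.discriminant_eq_E₄_cube_sub_E₆_sq, ModularForm.discriminant_eq_E₄_cube_sub_E₆_sq,
      h4, h6]
    ring
  obtain ⟨m, a, b, ha, hb, hw⟩ : ∃ m a b : ℕ, a ≤ 2 ∧ b ≤ 1 ∧ n = 12 * m + 4 * a + 6 * b := by
    have : n % 12 = 0 ∨ n % 12 = 2 ∨ n % 12 = 4 ∨ n % 12 = 6 ∨ n % 12 = 8 ∨ n % 12 = 10 := by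
      obtain ⟨r, rfl⟩ := hne; omega
    rcases this with h | h | h | h | h | h
    · exact ⟨n / 12, 0, 0, by omega, by omega, by omega⟩
    · exact ⟨n / 12 - 1, 2, 1, by omega, by omega, by omega⟩
    · exact ⟨n / 12, 1, 0, by omega, by omega, by omega⟩
    · exact ⟨n / 12, 0, 1, by omega, by omega, by omega⟩
    · exact ⟨n / 12, 2, 0, by omega, by omega, by omega⟩
    · exact ⟨n / 12, 1, 1, by omega, by omega, by omega⟩
  obtain ⟨p, -, hp⟩ := exists_polynomial_repr m a b ha hb (by exact_mod_cast hw) f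
  rw [hp z₁, hp z₂, ← h, h4, h6, hd, hw]
  ring

/-- The function `E₄ ^ 3 / Δ` separates orbits of the modular group. -/
theorem exists_smul_eq_of_jFun_eq {z₁ z₂ : ℍ} (h : jFun z₁ = jFun z₂) :
    ∃ γ : SL(2, ℤ), γ • z₁ = z₂ := by
  obtain ⟨l, hl, hf⟩ := exists_scaling_forms h
  set L₁ := PeriodPair.scaled 1 z₁ one_ne_zero z₁.im_pos
  set L₂ := PeriodPair.scaled l z₂ hl z₂.im_pos
  have hG : ∀ n, 3 ≤ n → L₁.G n = L₂.G n := by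
    intro n hn
    rcases Nat.even_or_odd n with he | ho
    · rw [PeriodPair.G_scaled hn, PeriodPair.G_scaled hn,
        hf n (by obtain ⟨r, rfl⟩ := he; omega) he]
      field_simp
      ring
    · rw [L₁.G_eq_zero_of_odd n ho, L₂.G_eq_zero_of_odd n ho]
  have h12 := PeriodPair.lattice_le_of_G_eq hG
  have h21 := PeriodPair.lattice_le_of_G_eq fun n hn => (hG n hn).symm
  -- `l` and `l z₂` lie in the lattice spanned by `1` and `z₁`, and conversely
  obtain ⟨d, c, hcd⟩ := PeriodPair.mem_lattice.mp (h21 L₂.ω₁_mem_lattice)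
  obtain ⟨b, a, hab⟩ := PeriodPair.mem_lattice.mp (h21 L₂.ω₂_mem_lattice)
  obtain ⟨p, q, hpq⟩ := PeriodPair.mem_lattice.mp (h12 L₁.ω₁_mem_lattice)
  obtain ⟨r, s, hrs⟩ := PeriodPair.mem_lattice.mp (h12 L₁.ω₂_mem_lattice)
  simp only [L₁, L₂, PeriodPair.scaled, mul_one, one_mul] at hcd hab hpq hrs
  have hz1 := z₁.im_pos
  obtain ⟨e1, e2⟩ := eq_zero_of_int_add_int_mul (m := p * d + q * b - 1) (n := p * c + q * a) hz1
    (by push_cast; linear_combination hpq + p * hcd + q * hab)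
  obtain ⟨e3, e4⟩ := eq_zero_of_int_add_int_mul (m := r * d + s * b) (n := r * c + s * a - 1) hz1
    (by push_cast; linear_combination hrs + r * hcd + s * hab)
  have hdet : (a * d - b * c) * (p * s - q * r) = 1 := by
    linear_combination (r * c + s * a) * e1 - (r * d + s * b) * e2 + e4
  have hpos : 0 < a * d - b * c := by
    have hne : (d : ℂ) + c * z₁ ≠ 0 := hcd ▸ hl
    have hz2 : (z₂ : ℂ) = (b + a * z₁) / (d + c * z₁) := by
      rw [eq_div_iff hne, hcd, hab]; ring
    have him : (z₂ : ℂ).im = (a * d - b * c) * (z₁ : ℂ).im / Complex.normSq (d + c * z₁) := by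
      rw [hz2, Complex.div_im]
      simp
      ring
    have h2 : 0 < (z₂ : ℂ).im := z₂.im_pos
    rw [him, div_pos_iff_of_pos_right (Complex.normSq_pos.mpr hne)] at h2
    exact_mod_cast pos_of_mul_pos_left h2 hz1.le
  have hdet1 : a * d - b * c = 1 := by
    rcases Int.mul_eq_one_iff_eq_one_or_neg_one.mp hdet with h | h
    · exact h.1
    · omega
  let γ : SL(2, ℤ) := ⟨!![a, b; c, d], by rw [Matrix.det_fin_two_of]; exact hdet1⟩
  refine ⟨γ, UpperHalfPlane.ext ?_⟩
  rw [coe_specialLinearGroup_smul]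
  simp only [show γ 0 0 = a from rfl, show γ 0 1 = b from rfl, show γ 1 0 = c from rfl,
    show γ 1 1 = d from rfl]
  rw [div_eq_iff (by rw [add_comm, hcd]; exact hl)]
  linear_combination hab - (z₂ : ℂ) * hcd

theorem exists_polynomial_rankinCohen {k : ℕ} (hk : 3 ≤ k) (hke : Even k) {j a : ℕ}
    (hj : k + 2 = 6 * (j + 1) + 2 * a) (ha : a ≤ 2) :
    ∃ p : Polynomial ℂ, p ≠ 0 ∧ p.natDegree ≤ j ∧ ∀ z : ℍ, rankinCohen k z =
      ModularForm.E₄ z ^ a * ModularForm.discriminant z ^ (j + 1) * p.eval (jFun z) := by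
  obtain ⟨p, hp, hpz⟩ := exists_polynomial_repr j a 0 ha (by norm_num) (w := ((2 * k + 4 : ℕ) : ℤ) - 12)
    (by push_cast; omega) (CuspForm.discriminantEquiv (rankinCohenForm hk hke))
  have hrep : ∀ z : ℍ, rankinCohen k z =
      ModularForm.E₄ z ^ a * ModularForm.discriminant z ^ (j + 1) * p.eval (jFun z) := by
    intro z
    have h := ModularForm.discriminant_mul_discriminantEquiv_apply (rankinCohenForm hk hke) z
    rw [hpz] at h
    refine Eq.trans ?_ (h.symm.trans ?_)
    · rfl
    · ring
  refine ⟨p, ?_, hp, hrep⟩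
  rintro rfl
  obtain ⟨z, hz, hne⟩ := exists_rankinCohen_ne_zero hke (by omega)
  exact hne (by simpa using hrep ⟨z, hz⟩)

/-- The point `1 / 2 + i y`. -/
noncomputable def linePt (y : ℝ) : ℂ := 1 / 2 + y * Complex.I

@[simp] lemma linePt_im (y : ℝ) : (linePt y).im = y := by simp [linePt]
@[simp] lemma linePt_re (y : ℝ) : (linePt y).re = 1 / 2 := by simp [linePt]

lemma one_le_int_quadratic {c d : ℤ} (h : c ≠ 0 ∨ d ≠ 0) : 1 ≤ c ^ 2 + c * d + d ^ 2 := by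
  by_contra hlt
  have h0 : c ^ 2 + c * d + d ^ 2 ≤ 0 := by omega
  have hc : c = 0 := by
    by_contra hc; have := sq_pos_of_ne_zero hc; nlinarith [sq_nonneg (c + 2 * d)]
  have hd : d = 0 := by
    by_contra hd; have := sq_pos_of_ne_zero hd; nlinarith [sq_nonneg (d + 2 * c)]
  exact h.elim (· hc) (· hd)

lemma normSq_linePt (c d : ℤ) (y : ℝ) : Complex.normSq (c * linePt y + d) =
    c ^ 2 * (y ^ 2 - 3 / 4) + (c ^ 2 + c * d + d ^ 2) := by
  simp [Complex.normSq_apply]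
  ring

lemma sqrt_three_half_pos : 0 < √3 / 2 := by positivity

lemma three_quarters_le_sq {y : ℝ} (hy : √3 / 2 ≤ y) : 3 / 4 ≤ y ^ 2 := by
  have h3 := Real.sq_sqrt (show (0 : ℝ) ≤ 3 by norm_num)
  nlinarith [sqrt_three_half_pos]

lemma le_of_smul_linePt {y₁ y₂ : ℝ} (h₁ : √3 / 2 ≤ y₁) (h₁' : 0 < (linePt y₁).im)
    (h₂' : 0 < (linePt y₂).im) {γ : SL(2, ℤ)}
    (h : γ • (⟨linePt y₁, h₁'⟩ : ℍ) = ⟨linePt y₂, h₂'⟩) : y₂ ≤ y₁ := by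
  have him := congrArg UpperHalfPlane.im h
  rw [ModularGroup.im_smul_eq_div_normSq, denom_specialLinearGroup] at him
  change (linePt y₁).im / _ = (linePt y₂).im at him
  change (linePt y₁).im / Complex.normSq ((γ 1 0 : ℂ) * linePt y₁ + γ 1 1) = _ at him
  rw [normSq_linePt, linePt_im, linePt_im] at him
  rw [← him]
  have hq : 1 ≤ (γ 1 0) ^ 2 + (γ 1 0) * (γ 1 1) + (γ 1 1) ^ 2 := by
    apply one_le_int_quadratic
    by_contra! hcon
    have hdet := γ.det_coe
    rw [Matrix.det_fin_two, hcon.1, hcon.2] at hdet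
    simp at hdet
  have hq' : (1 : ℝ) ≤ (γ 1 0 : ℝ) ^ 2 + (γ 1 0) * (γ 1 1) + (γ 1 1) ^ 2 := by exact_mod_cast hq
  have := three_quarters_le_sq h₁
  refine div_le_self (sqrt_three_half_pos.le.trans h₁) ?_
  nlinarith [sq_nonneg (γ 1 0 : ℝ)]

lemma eq_of_jFun_linePt_eq {y₁ y₂ : ℝ} (h₁ : √3 / 2 ≤ y₁) (h₂ : √3 / 2 ≤ y₂)
    (h₁' : 0 < (linePt y₁).im) (h₂' : 0 < (linePt y₂).im)
    (h : jFun ⟨linePt y₁, h₁'⟩ = jFun ⟨linePt y₂, h₂'⟩) : y₁ = y₂ := by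
  obtain ⟨γ, hγ⟩ := exists_smul_eq_of_jFun_eq h
  exact le_antisymm (le_of_smul_linePt h₂ h₂' h₁' (γ := γ⁻¹) (by rw [← hγ, inv_smul_smul]))
    (le_of_smul_linePt h₁ h₁' h₂' hγ)

/-- The primitive sixth root of unity `e ^ (π i / 3)`. -/
noncomputable def rhoPt : ℂ := linePt (√3 / 2)

lemma rhoPt_im_pos : 0 < rhoPt.im := by rw [rhoPt, linePt_im]; exact sqrt_three_half_pos

lemma rhoPt_sq : rhoPt ^ 2 = rhoPt - 1 := by
  have h3 : ((√3 : ℝ) : ℂ) ^ 2 = 3 := by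
    rw [← Complex.ofReal_pow, Real.sq_sqrt (by norm_num)]; norm_num
  simp only [rhoPt, linePt]
  push_cast
  linear_combination (Complex.I ^ 2 / 4) * h3 + (3 / 4) * Complex.I_sq

lemma rhoPt_cube : rhoPt ^ 3 = -1 := by
  linear_combination (rhoPt + 1) * rhoPt_sq

lemma rhoPt_ne_zero : rhoPt ≠ 0 := by
  intro h; have := rhoPt_im_pos; simp [h] at this

/-- The element of the modular group fixing `rhoPt`. -/
def rhoStab : SL(2, ℤ) := ⟨!![1, -1; 1, 0], by simp [Matrix.det_fin_two_of]⟩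

lemma rhoStab_rhoPt : ((rhoStab 0 0 : ℂ) * rhoPt + rhoStab 0 1) / ((rhoStab 1 0 : ℂ) * rhoPt + rhoStab 1 1)
    = rhoPt := by
  have := rhoPt_ne_zero
  simp only [show rhoStab 0 0 = 1 from rfl, show rhoStab 0 1 = -1 from rfl,
    show rhoStab 1 0 = 1 from rfl, show rhoStab 1 1 = 0 from rfl]
  push_cast
  rw [div_eq_iff (by simpa using this)]
  linear_combination -rhoPt_sq

lemma Ek_rhoPt {k : ℕ} (hk : 3 ≤ k) (hke : Even k) : Ek k rhoPt = rhoPt ^ k * Ek k rhoPt := by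
  have h := Ek_moebius hk hke rhoStab rhoPt_im_pos
  rw [rhoStab_rhoPt] at h
  simpa only [show rhoStab 1 0 = 1 from rfl, show rhoStab 1 1 = 0 from rfl, Int.cast_one,
    Int.cast_zero, one_mul, add_zero] using h

lemma deriv_Ek_rhoPt {k : ℕ} (hk : 3 ≤ k) (hke : Even k) : deriv (Ek k) rhoPt =
    rhoPt ^ (k + 1) * (k * Ek k rhoPt + rhoPt * deriv (Ek k) rhoPt) := by
  have h := deriv_Ek_moebius hk hke rhoStab rhoPt_im_pos
  rw [rhoStab_rhoPt] at h
  simpa only [show rhoStab 1 0 = 1 from rfl, show rhoStab 1 1 = 0 from rfl, Int.cast_one,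
    Int.cast_zero, one_mul, add_zero, mul_one] using h

lemma rhoPt_pow_six : rhoPt ^ 6 = 1 := by
  linear_combination (rhoPt ^ 3 - 1) * rhoPt_cube

lemma rhoPt_pow_mod (k : ℕ) : rhoPt ^ k = rhoPt ^ (k % 6) := by
  conv_lhs => rw [← Nat.div_add_mod k 6, pow_add, pow_mul, rhoPt_pow_six, one_pow, one_mul]

lemma Ek_rhoPt_eq_zero {k : ℕ} (hk : 3 ≤ k) (hke : Even k) (h6 : k % 6 ≠ 0) :
    Ek k rhoPt = 0 := by
  have h := Ek_rhoPt hk hke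
  by_contra hne
  have h1 : rhoPt ^ (k % 6) = 1 := by
    rw [← rhoPt_pow_mod]
    exact (mul_right_cancel₀ hne (by rw [one_mul]; exact h)).symm
  have hmod : k % 6 = 2 ∨ k % 6 = 4 := by obtain ⟨r, rfl⟩ := hke; omega
  have hr := rhoPt_sq
  have him := rhoPt_im_pos
  rcases hmod with hm | hm <;> rw [hm] at h1
  · have : rhoPt = 2 := by linear_combination h1 - hr
    rw [this] at him; simp at him
  · have : rhoPt = -1 := by linear_combination -h1 + rhoPt * rhoPt_cube
    rw [this] at him; simp at him

lemma deriv_Ek_rhoPt_eq_zero {k : ℕ} (hk : 3 ≤ k) (hke : Even k) (h6 : k % 6 = 2) :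
    deriv (Ek k) rhoPt = 0 := by
  have h := deriv_Ek_rhoPt hk hke
  rw [Ek_rhoPt_eq_zero hk hke (by omega)] at h
  have h4 : rhoPt ^ (k + 1) * rhoPt = -rhoPt := by
    rw [← pow_succ, rhoPt_pow_mod, show (k + 1 + 1) % 6 = 4 by omega]
    linear_combination rhoPt * rhoPt_cube
  have h5 : (1 + rhoPt) * deriv (Ek k) rhoPt = 0 := by
    linear_combination h + deriv (Ek k) rhoPt * h4
  refine (mul_eq_zero.mp h5).resolve_left fun h0 => ?_
  have := congrArg Complex.im h0
  have him := rhoPt_im_pos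
  simp at this
  exact him.ne' this

lemma deriv_Ek_rhoPt_of_dvd {k : ℕ} (hk : 3 ≤ k) (hke : Even k) (h6 : k % 6 = 0) :
    (1 - rhoPt ^ 2) * deriv (Ek k) rhoPt = k * rhoPt * Ek k rhoPt := by
  have h := deriv_Ek_rhoPt hk hke
  rw [pow_succ, rhoPt_pow_mod k, h6] at h
  linear_combination h

lemma E₄_rhoPt (h : 0 < rhoPt.im) : ModularForm.E₄ ⟨rhoPt, h⟩ = 0 := by
  have := Ek_rhoPt_eq_zero (k := 4) (by norm_num) (by decide) (by norm_num)
  have h' := Ek_eq_E (k := 4) (by norm_num) (by decide) ⟨rhoPt, h⟩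
  simp only at h'
  rw [this] at h'
  exact h'.symm

lemma jFun_eq_zero_iff {z : ℍ} : jFun z = 0 ↔ ModularForm.E₄ z = 0 := by
  simp [jFun, ModularForm.discriminant_ne_zero z]

lemma exists_smul_rhoPt_of_E₄_eq_zero {z : ℍ} (h : ModularForm.E₄ z = 0) :
    ∃ γ : SL(2, ℤ), γ • (⟨rhoPt, rhoPt_im_pos⟩ : ℍ) = z :=
  exists_smul_eq_of_jFun_eq
    ((jFun_eq_zero_iff.mpr (E₄_rhoPt rhoPt_im_pos)).trans (jFun_eq_zero_iff.mpr h).symm)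

lemma E₄_linePt_ne_zero {y : ℝ} (hy : √3 / 2 < y) (hy' : 0 < (linePt y).im) :
    ModularForm.E₄ ⟨linePt y, hy'⟩ ≠ 0 := fun h =>
  hy.ne (eq_of_jFun_linePt_eq le_rfl hy.le rhoPt_im_pos hy'
    ((jFun_eq_zero_iff.mpr (E₄_rhoPt rhoPt_im_pos)).trans (jFun_eq_zero_iff.mpr h).symm))

/-- Zeros of the Rankin–Cohen bracket on the half-line above `rhoPt`: there are at most `j` of them,
and if there are exactly `j`, every other zero is equivalent to `rhoPt` or one of them. -/
theorem rankinCohen_zeros {k : ℕ} (hk : 3 ≤ k) (hke : Even k) {j a : ℕ}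
    (hj : k + 2 = 6 * (j + 1) + 2 * a) (ha : a ≤ 2) (S : Finset ℝ)
    (hS : ∀ y ∈ S, √3 / 2 < y ∧ rankinCohen k (linePt y) = 0) :
    S.card ≤ j ∧ (S.card = j → ∀ z : ℂ, 0 < z.im → rankinCohen k z = 0 →
      ∃ γ : SL(2, ℤ), ∃ y : ℝ, (y = √3 / 2 ∧ a ≠ 0 ∨ y ∈ S) ∧
        z = ((γ 0 0 : ℂ) * linePt y + γ 0 1) / ((γ 1 0 : ℂ) * linePt y + γ 1 1)) := by
  obtain ⟨p, hp0, hpj, hp⟩ := exists_polynomial_rankinCohen hk hke hj ha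
  have hpos : ∀ y ∈ S, 0 < (linePt y).im := fun y hy => by
    rw [linePt_im]; exact sqrt_three_half_pos.trans (hS y hy).1
  let g : ℝ → ℂ := fun y => if h : 0 < (linePt y).im then jFun ⟨linePt y, h⟩ else 0
  have hg : ∀ y (h : 0 < (linePt y).im), g y = jFun ⟨linePt y, h⟩ := fun y h => dif_pos h
  have hinj : Set.InjOn g S := by
    intro y₁ h₁ y₂ h₂ h
    rw [hg _ (hpos _ h₁), hg _ (hpos _ h₂)] at h
    exact eq_of_jFun_linePt_eq (hS _ h₁).1.le (hS _ h₂).1.le _ _ h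
  have hroot : S.image g ⊆ p.roots.toFinset := by
    intro w hw
    obtain ⟨y, hy, rfl⟩ := Finset.mem_image.mp hw
    rw [Multiset.mem_toFinset, Polynomial.mem_roots hp0, Polynomial.IsRoot, hg _ (hpos y hy)]
    have h := hp ⟨linePt y, hpos y hy⟩
    simp only at h
    rw [(hS y hy).2] at h
    refine (mul_eq_zero.mp h.symm).resolve_left (mul_ne_zero (pow_ne_zero _ ?_) (pow_ne_zero _ ?_))
    · exact E₄_linePt_ne_zero (hS y hy).1 _
    · exact ModularForm.discriminant_ne_zero _
  have hcard : p.roots.toFinset.card ≤ j :=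
    (Multiset.toFinset_card_le _).trans (p.card_roots'.trans hpj)
  have himg : (S.image g).card = S.card := Finset.card_image_of_injOn hinj
  refine ⟨himg ▸ (Finset.card_le_card hroot).trans hcard, fun hSj z hz hz0 => ?_⟩
  have heq : S.image g = p.roots.toFinset :=
    Finset.eq_of_subset_of_card_le hroot (by rw [himg, hSj]; exact hcard)
  have hz' := hp ⟨z, hz⟩
  simp only at hz'
  rw [hz0] at hz'
  rcases mul_eq_zero.mp hz'.symm with h | h
  · have h4 := (mul_eq_zero.mp h).resolve_right (pow_ne_zero _ (ModularForm.discriminant_ne_zero _))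
    have ha0 : a ≠ 0 := by rintro rfl; simp at h4
    obtain ⟨γ, hγ⟩ := exists_smul_rhoPt_of_E₄_eq_zero (pow_eq_zero_iff ha0 |>.mp h4)
    refine ⟨γ, √3 / 2, Or.inl ⟨rfl, ha0⟩, ?_⟩
    exact (congrArg UpperHalfPlane.coe hγ).symm.trans (coe_specialLinearGroup_smul _ _)
  · have hmem : jFun ⟨z, hz⟩ ∈ S.image g := by
      rw [heq, Multiset.mem_toFinset, Polynomial.mem_roots hp0]; exact h
    obtain ⟨y, hy, hyz⟩ := Finset.mem_image.mp hmem
    rw [hg _ (hpos y hy)] at hyz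
    obtain ⟨γ, hγ⟩ := exists_smul_eq_of_jFun_eq hyz
    exact ⟨γ, y, Or.inr hy,
      (congrArg UpperHalfPlane.coe hγ).symm.trans (coe_specialLinearGroup_smul _ _)⟩

/-- The series `∑ nʳ σ_{k-1}(n) qⁿ` at `q = -e^{-2πy}`. -/
noncomputable def lineSum (k r : ℕ) (y : ℝ) : ℝ :=
  ∑' n : ℕ, ((n : ℝ) ^ r * (σ (k - 1) n : ℝ)) * (-Real.exp (-2 * π * y)) ^ n

/-- The constant `-2k / B_k`. -/
noncomputable def eisCoeff (k : ℕ) : ℝ := -(2 * k / ((bernoulli k : ℚ) : ℝ))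

/-- The restriction of the Eisenstein series to the line `Re z = 1 / 2`. -/
noncomputable def lineEk (k : ℕ) (y : ℝ) : ℝ := 1 + eisCoeff k * lineSum k 0 y

/-- The derivative of `lineEk`. -/
noncomputable def lineEk' (k : ℕ) (y : ℝ) : ℝ := -2 * π * eisCoeff k * lineSum k 1 y

/-- The second derivative of `lineEk`. -/
noncomputable def lineEk'' (k : ℕ) (y : ℝ) : ℝ := (2 * π) ^ 2 * eisCoeff k * lineSum k 2 y

lemma cexp_linePt (y : ℝ) :
    cexp (2 * π * Complex.I * linePt y) = ((-Real.exp (-2 * π * y) : ℝ) : ℂ) := by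
  rw [show 2 * π * Complex.I * linePt y = π * Complex.I + ((-2 * π * y : ℝ) : ℂ) by
    rw [linePt]; push_cast; linear_combination 2 * π * y * Complex.I_sq, Complex.exp_add,
    Complex.exp_pi_mul_I]
  push_cast
  ring

lemma sigmaSeries_linePt (k r : ℕ) (y : ℝ) :
    sigmaSeries k r (linePt y) = (lineSum k r y : ℂ) := by
  rw [sigmaSeries, lineSum, Complex.ofReal_tsum, cexp_linePt]
  push_cast
  rfl

lemma ofReal_eisCoeff (k : ℕ) :
    (eisCoeff k : ℂ) = -(2 * (k : ℂ) / ((bernoulli k : ℚ) : ℂ)) := by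
  simp [eisCoeff]

lemma Ek_linePt (k : ℕ) (y : ℝ) : Ek k (linePt y) = (lineEk k y : ℂ) := by
  rw [Ek_eq_sigmaSeries, sigmaSeries_linePt, lineEk]
  push_cast
  rw [ofReal_eisCoeff]
  ring

lemma deriv_Ek_linePt (k : ℕ) {y : ℝ} (hy : 0 < y) :
    deriv (Ek k) (linePt y) = -Complex.I * (lineEk' k y : ℂ) := by
  rw [deriv_Ek k (by simpa using hy), sigmaSeries_linePt, lineEk']
  push_cast
  rw [ofReal_eisCoeff]
  ring

lemma deriv_deriv_Ek_linePt (k : ℕ) {y : ℝ} (hy : 0 < y) :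
    deriv (deriv (Ek k)) (linePt y) = -(lineEk'' k y : ℂ) := by
  rw [deriv_deriv_Ek k (by simpa using hy), sigmaSeries_linePt, lineEk'']
  push_cast
  rw [ofReal_eisCoeff, mul_pow _ Complex.I, I_sq]
  ring

lemma hasDerivAt_linePt (w : ℂ) :
    HasDerivAt (fun w : ℂ => 1 / 2 + w * Complex.I) Complex.I w := by
  simpa using ((hasDerivAt_id w).mul_const Complex.I).const_add (1 / 2)

lemma hasDerivAt_lineEk (k : ℕ) {y : ℝ} (hy : 0 < y) :
    HasDerivAt (lineEk k) (lineEk' k y) y := by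
  have h : HasDerivAt (Ek k) (deriv (Ek k) (linePt y)) ((fun w : ℂ => 1 / 2 + w * Complex.I) y) :=
    hasDerivAt_Ek' k (z := linePt y) (by simpa using hy)
  have := (h.comp (y : ℂ) (hasDerivAt_linePt y)).real_of_complex
  rw [deriv_Ek_linePt k hy] at this
  refine (this.congr_of_eventuallyEq (f₁ := lineEk k) (.of_forall fun x => ?_)).congr_deriv ?_
  · change lineEk k x = (Ek k (linePt x)).re
    rw [Ek_linePt, ofReal_re]
  · simp

lemma hasDerivAt_lineEk' (k : ℕ) {y : ℝ} (hy : 0 < y) :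
    HasDerivAt (lineEk' k) (lineEk'' k y) y := by
  have h : HasDerivAt (deriv (Ek k)) (deriv (deriv (Ek k)) (linePt y))
      ((fun w : ℂ => 1 / 2 + w * Complex.I) y) :=
    hasDerivAt_deriv_Ek' k (z := linePt y) (by simpa using hy)
  have := ((h.comp (y : ℂ) (hasDerivAt_linePt y)).const_mul Complex.I).real_of_complex
  rw [deriv_deriv_Ek_linePt k hy] at this
  refine (this.congr_of_eventuallyEq (f₁ := lineEk' k) ?_).congr_deriv ?_
  · filter_upwards [eventually_gt_nhds hy] with x hx
    change lineEk' k x = (Complex.I * deriv (Ek k) (linePt x)).re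
    rw [deriv_Ek_linePt k hx]
    simp
  · simp

lemma rankinCohen_linePt (k : ℕ) {y : ℝ} (hy : 0 < y) : rankinCohen k (linePt y) =
    ((k * lineEk k y * lineEk'' k y - (k + 1) * lineEk' k y ^ 2 : ℝ) : ℂ) := by
  rw [rankinCohen, Ek_linePt, deriv_Ek_linePt k hy, deriv_deriv_Ek_linePt k hy]
  push_cast
  linear_combination ((k + 1) * (lineEk' k y : ℂ) ^ 2) * I_sq

lemma tendsto_linePt_imInfty : Tendsto linePt atTop imInfty := by
  rw [imInfty, tendsto_comap_iff]
  exact tendsto_id.congr fun y => (linePt_im y).symm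

lemma tendsto_lineEk (k : ℕ) : Tendsto (lineEk k) atTop (𝓝 1) := by
  have := (Complex.continuous_re.tendsto _).comp ((tendsto_Ek k).comp tendsto_linePt_imInfty)
  rw [one_re] at this
  refine this.congr fun y => ?_
  simp [Ek_linePt]

lemma tendsto_lineEk' (k : ℕ) : Tendsto (lineEk' k) atTop (𝓝 0) := by
  have := (Complex.continuous_re.tendsto _).comp
    (((tendsto_deriv_Ek k).comp tendsto_linePt_imInfty).const_mul Complex.I)
  rw [mul_zero, zero_re] at this
  refine this.congr' ?_
  filter_upwards [eventually_gt_atTop 0] with y hy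
  simp [deriv_Ek_linePt k hy]

/-- Rolle's theorem on `[x, ∞)`. -/
lemma exists_hasDerivAt_eq_zero_of_tendsto {g g' : ℝ → ℝ} {x : ℝ}
    (hg : ∀ y, x ≤ y → HasDerivAt g (g' y) y) (hlim : Tendsto g atTop (𝓝 0)) (hx : g x = 0) :
    ∃ c, x < c ∧ g' c = 0 := by
  have hder : ∀ t ∈ Set.Ioo (0 : ℝ) 1, HasDerivAt (fun t => g (x - 1 + t⁻¹))
      (g' (x - 1 + t⁻¹) * (-(t ^ 2)⁻¹)) t := by
    intro t ht
    have hy : x ≤ x - 1 + t⁻¹ := by linarith [(one_lt_inv₀ ht.1).mpr ht.2]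
    exact (hg _ hy).comp t ((hasDerivAt_inv ht.1.ne').const_add (x - 1))
  have h0 : Tendsto (fun t => g (x - 1 + t⁻¹)) (𝓝[>] (0 : ℝ)) (𝓝 0) :=
    hlim.comp (tendsto_atTop_add_const_left _ _ tendsto_inv_nhdsGT_zero)
  have h1 : Tendsto (fun t => g (x - 1 + t⁻¹)) (𝓝[<] (1 : ℝ)) (𝓝 0) := by
    have hc : ContinuousAt (fun t : ℝ => x - 1 + t⁻¹) 1 :=
      (continuousAt_const.add (continuousAt_inv₀ one_ne_zero))
    have hgc : ContinuousAt g (x - 1 + (1 : ℝ)⁻¹) := by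
      simpa using (hg x le_rfl).continuousAt
    have := (ContinuousAt.comp (f := fun t : ℝ => x - 1 + t⁻¹) hgc hc).tendsto
    simp only [Function.comp_def, inv_one, sub_add_cancel, hx] at this
    exact this.mono_left nhdsWithin_le_nhds
  obtain ⟨t, ht, hz⟩ := exists_hasDerivAt_eq_zero' one_pos h0 h1 hder
  refine ⟨x - 1 + t⁻¹, by linarith [(one_lt_inv₀ ht.1).mpr ht.2], ?_⟩
  rcases mul_eq_zero.mp hz with h | h
  · exact h
  · have := ht.1
    have : 0 < (t ^ 2)⁻¹ := by positivity
    linarith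

/-- A function tending to `0` at infinity has at least as many critical points as zeros. -/
lemma exists_finset_deriv_eq_zero {g g' : ℝ → ℝ} {a : ℝ}
    (hg : ∀ y, a < y → HasDerivAt g (g' y) y) (hlim : Tendsto g atTop (𝓝 0)) (A : Finset ℝ)
    (hA : ∀ x ∈ A, a < x ∧ g x = 0) :
    ∃ B : Finset ℝ, B.card = A.card ∧ (∀ b ∈ B, a < b ∧ g' b = 0) ∧ Disjoint B A := by
  suffices h : ∃ B : Finset ℝ, B.card = A.card ∧ (∀ b ∈ B, g' b = 0 ∧ ∃ x ∈ A, x < b) ∧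
      Disjoint B A by
    obtain ⟨B, h1, h2, h3⟩ := h
    refine ⟨B, h1, fun b hb => ?_, h3⟩
    obtain ⟨h0, x, hx, hxb⟩ := h2 b hb
    exact ⟨(hA x hx).1.trans hxb, h0⟩
  induction A using Finset.induction_on_min with
  | empty => exact ⟨∅, by simp⟩
  | insert x A hmin ih =>
    obtain ⟨B, h1, h2, h3⟩ := ih fun y hy => hA y (Finset.mem_insert_of_mem hy)
    have hx := hA x (Finset.mem_insert_self x A)
    have hxA : x ∉ A := fun h => lt_irrefl _ (hmin x h)
    have hxB : x ∉ B := by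
      intro h
      obtain ⟨-, y, hy, hlt⟩ := h2 x h
      exact lt_asymm hlt (hmin y hy)
    have key : ∃ c, x < c ∧ g' c = 0 ∧ ∀ y ∈ A, c < y := by
      rcases A.eq_empty_or_nonempty with rfl | hne
      · obtain ⟨c, hc, hc'⟩ := exists_hasDerivAt_eq_zero_of_tendsto
          (fun y hy => hg y (hx.1.trans_le hy)) hlim hx.2
        exact ⟨c, hc, hc', by simp⟩
      · have hm := Finset.min'_mem A hne
        have hxm := hmin _ hm
        have hcont : ContinuousOn g (Set.Icc x (A.min' hne)) := fun y hy =>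
          (hg y (hx.1.trans_le hy.1)).continuousAt.continuousWithinAt
        obtain ⟨c, hc, hc'⟩ := exists_hasDerivAt_eq_zero hxm hcont
          (hx.2.trans (hA _ (Finset.mem_insert_of_mem hm)).2.symm)
          fun y hy => hg y (hx.1.trans hy.1)
        exact ⟨c, hc.1, hc', fun y hy => hc.2.trans_le (Finset.min'_le A y hy)⟩
    obtain ⟨c, hxc, hc0, hcA⟩ := key
    have hcB : c ∉ B := by
      intro h
      obtain ⟨-, y, hy, hlt⟩ := h2 c h
      exact lt_asymm hlt (hcA y hy)
    refine ⟨insert c B, ?_, ?_, ?_⟩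
    · rw [Finset.card_insert_of_notMem hcB, Finset.card_insert_of_notMem hxA, h1]
    · intro b hb
      rcases Finset.mem_insert.mp hb with rfl | hb
      · exact ⟨hc0, x, Finset.mem_insert_self _ _, hxc⟩
      · obtain ⟨h0, y, hy, hlt⟩ := h2 b hb
        exact ⟨h0, y, Finset.mem_insert_of_mem hy, hlt⟩
    · rw [Finset.disjoint_insert_left, Finset.disjoint_insert_right]
      refine ⟨?_, hxB, h3⟩
      rw [Finset.mem_insert]
      rintro (rfl | h)
      · exact lt_irrefl _ hxc
      · exact lt_irrefl _ (hcA c h)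

/-- Zeros of the derivative of an Eisenstein series on the line `Re z = 1 / 2` yield zeros of its
Rankin–Cohen bracket. -/
lemma exists_rankinCohen_zeros {k : ℕ} (hk : 3 ≤ k)
    (hpos : ∀ y, √3 / 2 < y → 0 < lineEk k y) (A : Finset ℝ)
    (hA : ∀ y ∈ A, √3 / 2 < y ∧ lineEk' k y = 0) :
    ∃ B : Finset ℝ, B.card = A.card ∧
      (∀ y ∈ B, √3 / 2 < y ∧ rankinCohen k (linePt y) = 0) ∧ Disjoint B A := by
  have hk0 : (0 : ℝ) < k := by positivity
  have hlim : Tendsto (fun y => lineEk' k y * lineEk k y ^ (-(1 + 1 / (k : ℝ)))) atTop (𝓝 0) := by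
    have := (tendsto_lineEk' k).mul
      ((tendsto_lineEk k).rpow_const (p := -(1 + 1 / (k : ℝ))) (Or.inl one_ne_zero))
    simpa using this
  obtain ⟨B, h1, h2, h3⟩ := exists_finset_deriv_eq_zero (a := √3 / 2)
    (fun y hy => (hasDerivAt_lineEk' k (sqrt_three_half_pos.trans hy)).mul
      ((hasDerivAt_lineEk k (sqrt_three_half_pos.trans hy)).rpow_const
        (p := -(1 + 1 / (k : ℝ))) (Or.inl (hpos y hy).ne'))) hlim A
    (fun y hy => ⟨(hA y hy).1, by simp [(hA y hy).2]⟩)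
  refine ⟨B, h1, fun y hy => ⟨(h2 y hy).1, ?_⟩, h3⟩
  obtain ⟨hy1, hy2⟩ := h2 y hy
  rw [rankinCohen_linePt k (sqrt_three_half_pos.trans hy1)]
  have hp := hpos y hy1
  rw [Real.rpow_sub_one hp.ne'] at hy2
  have hr : lineEk k y ^ (-(1 + 1 / (k : ℝ))) ≠ 0 := (Real.rpow_pos_of_pos hp _).ne'
  generalize lineEk k y ^ (-(1 + 1 / (k : ℝ))) = r at hy2 hr
  rw [Complex.ofReal_eq_zero]
  field_simp at hy2
  rw [mul_zero] at hy2
  linear_combination (mul_eq_zero.mp hy2).resolve_left hr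

lemma moebius_double_zero {k : ℕ} (hk : 3 ≤ k) (hke : Even k) {γ : SL(2, ℤ)} {z : ℂ}
    (hz : 0 < z.im)
    (h1 : deriv (Ek k) (((γ 0 0 : ℂ) * z + γ 0 1) / ((γ 1 0 : ℂ) * z + γ 1 1)) = 0)
    (h2 : deriv (deriv (Ek k)) (((γ 0 0 : ℂ) * z + γ 0 1) / ((γ 1 0 : ℂ) * z + γ 1 1)) = 0) :
    k * γ 1 0 * Ek k z + ((γ 1 0 : ℂ) * z + γ 1 1) * deriv (Ek k) z = 0 ∧
      (k + 1) * γ 1 0 * deriv (Ek k) z +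
        ((γ 1 0 : ℂ) * z + γ 1 1) * deriv (deriv (Ek k)) z = 0 := by
  have hj := linear_ne_zero (γ := γ) hz
  rw [deriv_Ek_moebius hk hke γ hz] at h1
  rw [deriv_deriv_Ek_moebius hk hke γ hz] at h2
  have h1' := (mul_eq_zero.mp h1).resolve_left (pow_ne_zero _ hj)
  have h2' := (mul_eq_zero.mp h2).resolve_left (pow_ne_zero _ hj)
  refine ⟨h1', mul_left_cancel₀ hj ?_⟩
  linear_combination h2' - (k + 1) * γ 1 0 * h1'

lemma not_double_zero_rhoPt {k : ℕ} (hk : 3 ≤ k) (hke : Even k) (h6 : k % 6 ≠ 4)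
    (h0 : k % 6 = 0 → Ek k rhoPt ≠ 0) (h2 : k % 6 = 2 → deriv (deriv (Ek k)) rhoPt ≠ 0)
    {γ : SL(2, ℤ)}
    (hd : deriv (Ek k) (((γ 0 0 : ℂ) * rhoPt + γ 0 1) / ((γ 1 0 : ℂ) * rhoPt + γ 1 1)) = 0) :
    deriv (deriv (Ek k)) (((γ 0 0 : ℂ) * rhoPt + γ 0 1) / ((γ 1 0 : ℂ) * rhoPt + γ 1 1)) ≠ 0 := by
  intro hdd
  have hj := linear_ne_zero (γ := γ) rhoPt_im_pos
  obtain ⟨e1, e2⟩ := moebius_double_zero hk hke rhoPt_im_pos hd hdd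
  rcases (show k % 6 = 0 ∨ k % 6 = 2 by grind) with h | h
  · have hd := deriv_Ek_rhoPt_of_dvd hk hke h
    have hk0 : (k : ℂ) ≠ 0 := by simp; omega
    have : (k * Ek k rhoPt) * ((γ 1 0 : ℂ) + γ 1 1 * rhoPt) = 0 := by
      linear_combination (1 - rhoPt ^ 2) * e1 - ((γ 1 0 : ℂ) * rhoPt + γ 1 1) * hd
    obtain ⟨hc, hd⟩ := eq_zero_of_int_add_int_mul rhoPt_im_pos
      ((mul_eq_zero.mp this).resolve_left (mul_ne_zero hk0 (h0 h)))
    simp [hc, hd] at hj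
  · rw [deriv_Ek_rhoPt_eq_zero hk hke h, mul_zero, zero_add] at e2
    exact h2 h ((mul_eq_zero.mp e2).resolve_left hj)

lemma not_double_zero_linePt {k : ℕ} (hk : 3 ≤ k) (hke : Even k) {y : ℝ} (hy : 0 < y)
    (hW : 0 < k * lineEk k y + y * lineEk' k y)
    (hne : lineEk' k y = 0 → lineEk'' k y ≠ 0) {γ : SL(2, ℤ)}
    (hd : deriv (Ek k) (((γ 0 0 : ℂ) * linePt y + γ 0 1) / ((γ 1 0 : ℂ) * linePt y + γ 1 1)) = 0) :
    deriv (deriv (Ek k))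
      (((γ 0 0 : ℂ) * linePt y + γ 0 1) / ((γ 1 0 : ℂ) * linePt y + γ 1 1)) ≠ 0 := by
  intro hdd
  have hz : 0 < (linePt y).im := by simpa using hy
  have hj := linear_ne_zero (γ := γ) hz
  obtain ⟨e1, e2⟩ := moebius_double_zero hk hke hz hd hdd
  rw [Ek_linePt, deriv_Ek_linePt k hy] at e1
  rw [deriv_Ek_linePt k hy, deriv_deriv_Ek_linePt k hy] at e2
  have hre := congrArg Complex.re e1
  simp [linePt] at hre
  have hc : (γ 1 0 : ℝ) = 0 := by
    have : (γ 1 0 : ℝ) * (k * lineEk k y + y * lineEk' k y) = 0 := by linear_combination hre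
    exact (mul_eq_zero.mp this).resolve_right hW.ne'
  have hc' : γ 1 0 = 0 := by exact_mod_cast hc
  rw [hc'] at e1 e2 hj
  simp at e1 e2 hj
  exact hne (e1.resolve_left hj) (e2.resolve_left hj)

/-- If the derivative has the maximal number `j` of zeros on the half-line above `rhoPt`, then
all its zeros are simple. -/
theorem simple_zeros_of_lineEk {k : ℕ} (hk : 3 ≤ k) (hke : Even k) {j a : ℕ}
    (hj : k + 2 = 6 * (j + 1) + 2 * a) (ha : a ≤ 2)
    (hρ0 : k % 6 = 0 → Ek k rhoPt ≠ 0) (hρ2 : k % 6 = 2 → deriv (deriv (Ek k)) rhoPt ≠ 0)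
    (hpos : ∀ y, √3 / 2 < y → 0 < lineEk k y)
    (hW : ∀ y, √3 / 2 < y → 0 < k * lineEk k y + y * lineEk' k y)
    (A : Finset ℝ) (hA : ∀ y ∈ A, √3 / 2 < y ∧ lineEk' k y = 0) (hcard : A.card = j)
    {z : ℂ} (hz : 0 < z.im) (h0 : deriv (Ek k) z = 0) : deriv (deriv (Ek k)) z ≠ 0 := by
  intro h1
  obtain ⟨B, hB, hB0, hdisj⟩ := exists_rankinCohen_zeros hk hpos A hA
  have hrc : rankinCohen k z = 0 := by simp [rankinCohen, h0, h1]
  obtain ⟨γ, y, hy, rfl⟩ := (rankinCohen_zeros hk hke hj ha B hB0).2 (hB.trans hcard) z hz hrc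
  rcases hy with ⟨rfl, ha0⟩ | hy
  · exact not_double_zero_rhoPt hk hke (by omega) hρ0 hρ2 h0 h1
  · refine not_double_zero_linePt hk hke (sqrt_three_half_pos.trans (hB0 y hy).1)
      (hW y (hB0 y hy).1) ?_ h0 h1
    intro hy' _
    have hyA : y ∉ A := Finset.disjoint_left.mp hdisj hy
    obtain ⟨B', hB', hB0', -⟩ := exists_rankinCohen_zeros hk hpos (insert y A) (by
      intro x hx
      rcases Finset.mem_insert.mp hx with rfl | hx
      · exact ⟨(hB0 x hy).1, hy'⟩
      · exact hA x hx)
    have := (rankinCohen_zeros hk hke hj ha B' hB0').1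
    rw [hB', Finset.card_insert_of_notMem hyA] at this
    omega

theorem simple_zeros_of_le_eight {k : ℕ} (hk : 3 ≤ k) (hk8 : k ≤ 8) (hke : Even k)
    (hρ0 : k % 6 = 0 → Ek k rhoPt ≠ 0) (hρ2 : k % 6 = 2 → deriv (deriv (Ek k)) rhoPt ≠ 0)
    {z : ℂ} (hz : 0 < z.im) (h0 : deriv (Ek k) z = 0) : deriv (deriv (Ek k)) z ≠ 0 := by
  intro h1
  obtain ⟨a, ha, hj⟩ : ∃ a ≤ 2, k + 2 = 6 * (0 + 1) + 2 * a := ⟨(k - 4) / 2, by grind⟩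
  have hrc : rankinCohen k z = 0 := by simp [rankinCohen, h0, h1]
  obtain ⟨γ, y, hy, rfl⟩ := (rankinCohen_zeros hk hke hj ha ∅ (by simp)).2 rfl z hz hrc
  rcases hy with ⟨rfl, ha0⟩ | hy
  · exact not_double_zero_rhoPt hk hke (by omega) hρ0 hρ2 h0 h1
  · simp at hy

lemma Ek_six_rhoPt_ne_zero : Ek 6 rhoPt ≠ 0 := by
  intro h
  have h6 := Ek_eq_E (k := 6) (by norm_num) (by decide) ⟨rhoPt, rhoPt_im_pos⟩
  have hΔ := ModularForm.discriminant_eq_E₄_cube_sub_E₆_sq ⟨rhoPt, rhoPt_im_pos⟩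
  have h6' : ModularForm.E₆ ⟨rhoPt, rhoPt_im_pos⟩ = 0 := h6.symm.trans h
  rw [E₄_rhoPt, h6'] at hΔ
  exact ModularForm.discriminant_ne_zero ⟨rhoPt, rhoPt_im_pos⟩ (by simpa using hΔ)

lemma deriv_Ek_four_rhoPt_ne_zero : deriv (Ek 4) rhoPt ≠ 0 := by
  intro h
  obtain ⟨p, hp, hdeg, hrep⟩ := exists_polynomial_rankinCohen (k := 4) (j := 0) (a := 0)
    (by norm_num) (by decide) (by norm_num) (by norm_num)
  have := hrep ⟨rhoPt, rhoPt_im_pos⟩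
  obtain ⟨c, rfl⟩ := Polynomial.natDegree_eq_zero.mp (Nat.le_zero.mp hdeg)
  have hc : c ≠ 0 := by simpa using hp
  have hE := Ek_rhoPt_eq_zero (k := 4) (by norm_num) (by decide) (by norm_num)
  simp [rankinCohen, h, hE, hc, ModularForm.discriminant_ne_zero] at this

lemma exists_Ek_eight_eq : ∃ c : ℂ, c ≠ 0 ∧ ∀ z : ℂ, 0 < z.im → Ek 8 z = c * Ek 4 z ^ 2 := by
  obtain ⟨p, hdeg, hrep⟩ := exists_polynomial_repr 0 2 0 (by norm_num) (by norm_num) (w := 8)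
    (by norm_num) (ModularForm.E (k := 8) (by norm_num))
  obtain ⟨c, rfl⟩ := Polynomial.natDegree_eq_zero.mp (Nat.le_zero.mp hdeg)
  have key : ∀ z : ℂ, 0 < z.im → Ek 8 z = c * Ek 4 z ^ 2 := by
    intro z hz
    have h4 := Ek_eq_E (k := 4) (by norm_num) (by decide) ⟨z, hz⟩
    have h8 := Ek_eq_E (k := 8) (by norm_num) (by decide) ⟨z, hz⟩
    have hr := hrep ⟨z, hz⟩
    simp only at h4 h8
    rw [h8, h4]
    refine hr.trans ?_
    simp [mul_comm]
  refine ⟨c, ?_, key⟩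
  rintro rfl
  have hlim := (tendsto_Ek 8).comp tendsto_linePt_imInfty
  refine one_ne_zero (tendsto_nhds_unique hlim (tendsto_const_nhds.congr' ?_))
  filter_upwards [eventually_gt_atTop 0] with y hy
  simp [key (linePt y) (by simpa using hy)]

lemma deriv_deriv_Ek_eight_rhoPt_ne_zero : deriv (deriv (Ek 8)) rhoPt ≠ 0 := by
  obtain ⟨c, hc, h8⟩ := exists_Ek_eight_eq
  have hd : ∀ z : ℂ, 0 < z.im → deriv (Ek 8) z = c * (2 * Ek 4 z * deriv (Ek 4) z) := by
    intro z hz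
    have h := (((hasDerivAt_Ek' 4 hz).pow 2).const_mul c).congr_of_eventuallyEq (f₁ := Ek 8)
      ((eventually_im_pos hz).mono fun w hw => h8 w hw)
    rw [h.deriv]
    push_cast
    ring
  have h := ((((hasDerivAt_Ek' 4 rhoPt_im_pos).const_mul 2).mul
    (hasDerivAt_deriv_Ek' 4 rhoPt_im_pos)).const_mul c).congr_of_eventuallyEq
      (f₁ := deriv (Ek 8)) ((eventually_im_pos rhoPt_im_pos).mono fun w hw => hd w hw)
  rw [h.deriv, Ek_rhoPt_eq_zero (k := 4) (by norm_num) (by decide) (by norm_num)]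
  simp [hc, deriv_Ek_four_rhoPt_ne_zero]

theorem simple_zeros_small {k : ℕ} (hk : 4 ≤ k) (hk8 : k ≤ 8) (hke : Even k)
    {z : ℂ} (hz : 0 < z.im) (h0 : deriv (Ek k) z = 0) : deriv (deriv (Ek k)) z ≠ 0 := by
  refine simple_zeros_of_le_eight (by omega) hk8 hke (fun h => ?_) (fun h => ?_) hz h0
  · obtain rfl : k = 6 := by omega
    exact Ek_six_rhoPt_ne_zero
  · obtain rfl : k = 8 := by omega
    exact deriv_deriv_Ek_eight_rhoPt_ne_zero

/-- The value `ζ(k)` as a real number. -/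
noncomputable def realZeta (k : ℕ) : ℝ := ∑' n : ℕ, 1 / (n : ℝ) ^ k

lemma ofReal_realZeta {k : ℕ} (hk : 3 ≤ k) : (realZeta k : ℂ) = riemannZeta k := by
  rw [zeta_nat_eq_tsum_of_gt_one (by omega), realZeta, Complex.ofReal_tsum]
  push_cast
  rfl

lemma one_le_realZeta {k : ℕ} (hk : 3 ≤ k) : 1 ≤ realZeta k := by
  have h : Summable fun n : ℕ => 1 / (n : ℝ) ^ k :=
    Real.summable_one_div_nat_pow.mpr (by omega)
  simpa [realZeta] using h.le_tsum 1 (fun _ _ => by positivity)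

lemma eisCoeff_eq {k : ℕ} (hk : 3 ≤ k) (hke : Even k) :
    eisCoeff k = (-1) ^ (k / 2) * ((2 * π) ^ k / (realZeta k * (k - 1)!)) := by
  have h := bernoulli_coeff_eq hke (by omega : k ≠ 0)
  rw [← ofReal_eisCoeff, ← ofReal_realZeta hk] at h
  have hI : (-2 * π * Complex.I) ^ k = (-1) ^ (k / 2) * (2 * π) ^ k := by
    have h2 : k = 2 * (k / 2) := by grind
    rw [h2, pow_mul, pow_mul (2 * π : ℂ), mul_pow, I_sq,
      show 2 * (k / 2) / 2 = k / 2 by omega, ← mul_pow]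
    ring
  rw [hI] at h
  apply Complex.ofReal_injective
  rw [h]
  push_cast
  field_simp

lemma eisCoeff_sign {k : ℕ} (hk : 3 ≤ k) (hke : Even k) : 0 < (-1) ^ (k / 2) * eisCoeff k := by
  rw [eisCoeff_eq hk hke, ← mul_assoc, ← mul_pow]
  have := one_le_realZeta hk
  simp only [mul_neg, mul_one, neg_neg, one_pow, one_mul]
  positivity

lemma hasSum_inv_sq_succ : HasSum (fun n : ℕ => 1 / ((n : ℝ) + 1) ^ 2) (π ^ 2 / 6) := by
  simpa using (hasSum_nat_add_iff' 1).mpr hasSum_zeta_two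

lemma hasSum_inv_max_int : HasSum (fun d : ℤ => 1 / max 1 ((d : ℝ) ^ 2)) (1 + 2 * (π ^ 2 / 6)) := by
  have hmax : ∀ n : ℕ, max 1 (((n : ℝ) + 1) ^ 2) = ((n : ℝ) + 1) ^ 2 := fun n =>
    max_eq_right (by nlinarith [(Nat.cast_nonneg n : (0 : ℝ) ≤ n)])
  have h2 : HasSum (fun n : ℕ => 1 / max 1 (((n : ℤ) : ℝ) ^ 2)) (1 + π ^ 2 / 6) := by
    rw [← hasSum_nat_add_iff' 1]
    simpa [hmax] using hasSum_inv_sq_succ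
  have h3 := h2.of_nat_of_neg_add_one (f := fun d : ℤ => 1 / max 1 ((d : ℝ) ^ 2)) (m' := π ^ 2 / 6) (by
    have : ∀ n : ℕ, (-((n : ℝ) + 1)) ^ 2 = ((n : ℝ) + 1) ^ 2 := fun n => by ring
    simpa [hmax, this, -neg_add_rev] using hasSum_inv_sq_succ)
  rwa [add_assoc, ← two_mul] at h3

/-- A majorant for the lattice sums. -/
noncomputable def latticeMajorant (p : ℕ+ × ℤ) : ℝ := 1 / (p.1 : ℝ) ^ 2 * (1 / max 1 ((p.2 : ℝ) ^ 2))

lemma exists_hasSum_latticeMajorant : ∃ s ≤ (7.1 : ℝ), HasSum latticeMajorant s := by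
  have h1 : HasSum (fun n : ℕ+ => 1 / (n : ℝ) ^ 2) (π ^ 2 / 6) := by
    rw [← Equiv.pnatEquivNat.symm.hasSum_iff]
    simpa [Function.comp_def] using hasSum_inv_sq_succ
  have h2 := hasSum_inv_max_int
  refine ⟨_, ?_, h1.mul h2 (h1.summable.mul_of_nonneg h2.summable (fun _ => by positivity)
    (fun _ => by positivity))⟩
  have hπ : π ^ 2 ≤ 3.1416 ^ 2 := pow_le_pow_left₀ Real.pi_pos.le Real.pi_lt_d4.le 2
  nlinarith [sq_nonneg π]

lemma HasSum.norm_sub_sub_le {ι : Type*} {F : ι → ℂ} {s : ℂ} {M : ι → ℝ} {S : ℝ} {a b : ι}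
    (hab : a ≠ b) (hF : HasSum F s) (hM : HasSum M S) (hM0 : ∀ i, 0 ≤ M i)
    (h : ∀ i, i ≠ a → i ≠ b → ‖F i‖ ≤ M i) : ‖s - F a - F b‖ ≤ S := by
  classical
  have h1 := (hF.sub (hasSum_ite_eq a (F a))).sub (hasSum_ite_eq b (F b))
  refine h1.norm_le_of_bounded hM fun i => ?_
  by_cases hia : i = a
  · subst hia
    simpa [hab] using hM0 i
  by_cases hib : i = b
  · subst hib
    simpa [hia] using hM0 i
  · simpa [hia, hib] using h i hia hib

lemma three_le_quadratic {p : ℕ+ × ℤ} (h0 : p ≠ (1, 0)) (h1 : p ≠ (1, -1)) :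
    (3 : ℝ) ≤ (p.1 : ℝ) ^ 2 + p.1 * p.2 + (p.2 : ℝ) ^ 2 := by
  obtain ⟨c, d⟩ := p
  have hc : (1 : ℤ) ≤ ((c : ℕ) : ℤ) := by exact_mod_cast c.pos
  have key : (3 : ℤ) ≤ ((c : ℕ) : ℤ) ^ 2 + (c : ℕ) * d + d ^ 2 := by
    rcases eq_or_ne c 1 with rfl | hc1
    · have hd0 : d ≠ 0 := by rintro rfl; exact h0 rfl
      have hd1 : d ≠ -1 := by rintro rfl; exact h1 rfl
      rcases (show 1 ≤ d ∨ d ≤ -2 by omega) with h | h <;> simp <;> nlinarith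
    · have hc2 : (2 : ℤ) ≤ ((c : ℕ) : ℤ) := by
        have : (c : ℕ) ≠ 1 := by simpa using hc1
        omega
      nlinarith [sq_nonneg (2 * d + ((c : ℕ) : ℤ))]
  exact_mod_cast key

lemma normSq_linePt_pnat (p : ℕ+ × ℤ) (y : ℝ) : ‖(p.1 : ℂ) * linePt y + p.2‖ ^ 2 =
    (p.1 : ℝ) ^ 2 * (y ^ 2 - 3 / 4) + ((p.1 : ℝ) ^ 2 + p.1 * p.2 + (p.2 : ℝ) ^ 2) := by
  rw [← Complex.normSq_eq_norm_sq]
  have := normSq_linePt ((p.1 : ℕ) : ℤ) p.2 y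
  push_cast at this
  exact this

lemma mul_le_norm_linePt (p : ℕ+ × ℤ) (y : ℝ) :
    (p.1 : ℝ) * y ≤ ‖(p.1 : ℂ) * linePt y + p.2‖ := by
  have := Complex.abs_im_le_norm ((p.1 : ℂ) * linePt y + p.2)
  simp at this
  exact (mul_le_mul_of_nonneg_left (le_abs_self y) (by positivity)).trans this

lemma abs_re_le_norm_linePt (p : ℕ+ × ℤ) (y : ℝ) :
    |(p.1 : ℝ) / 2 + p.2| ≤ ‖(p.1 : ℂ) * linePt y + p.2‖ := by
  have := Complex.abs_re_le_norm ((p.1 : ℂ) * linePt y + p.2)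
  simp at this
  rwa [div_eq_mul_inv]

lemma latticeMajorant_nonneg (p : ℕ+ × ℤ) : 0 ≤ latticeMajorant p := by
  rw [latticeMajorant]; positivity

lemma inv_quadratic_sq_le (p : ℕ+ × ℤ) :
    1 / ((p.1 : ℝ) ^ 2 + p.1 * p.2 + (p.2 : ℝ) ^ 2) ^ 2 ≤ 16 / 9 * latticeMajorant p := by
  obtain ⟨c, d⟩ := p
  have hc : (1 : ℝ) ≤ ((c : ℕ) : ℝ) := by exact_mod_cast c.pos
  simp only [latticeMajorant]
  generalize ((c : ℕ) : ℝ) = x at *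
  have hd : (1 : ℝ) ≤ (d : ℝ) ^ 2 ∨ (d : ℝ) = 0 := by
    rcases eq_or_ne d 0 with rfl | h
    · right; simp
    · left
      have : 1 ≤ d ^ 2 := by have := sq_pos_of_ne_zero h; omega
      exact_mod_cast this
  generalize (d : ℝ) = t at *
  have hQ : 0 < x ^ 2 + x * t + t ^ 2 := by nlinarith [sq_nonneg (x + 2 * t)]
  have hm : 0 < max 1 (t ^ 2) := by positivity
  have h : 9 / 16 * (x ^ 2 * max 1 (t ^ 2)) ≤ (x ^ 2 + x * t + t ^ 2) ^ 2 := by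
    rcases hd with h | rfl
    · rw [max_eq_right h]
      have h1 : 3 / 4 * x ^ 2 ≤ x ^ 2 + x * t + t ^ 2 := by nlinarith [sq_nonneg (x + 2 * t)]
      have h2 : 3 / 4 * t ^ 2 ≤ x ^ 2 + x * t + t ^ 2 := by nlinarith [sq_nonneg (2 * x + t)]
      nlinarith [mul_le_mul h1 h2 (by positivity) hQ.le]
    · norm_num
      have : 1 ≤ x ^ 2 := by nlinarith
      nlinarith
  rw [one_div_mul_one_div, mul_one_div, div_le_div_iff₀ (by positivity) (by positivity)]
  linarith

/-- The error bound for the lattice sums of weight `k`. -/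
noncomputable def latticeErr (k : ℕ) : ℝ := 16 / 9 * (1 / 3) ^ (k / 2 - 2)

lemma inv_norm_pow_le {k : ℕ} (hk : 4 ≤ k) (hke : Even k) {y : ℝ} (hy : √3 / 2 ≤ y) {p : ℕ+ × ℤ}
    (h0 : p ≠ (1, 0)) (h1 : p ≠ (1, -1)) :
    1 / ‖(p.1 : ℂ) * linePt y + p.2‖ ^ k ≤ latticeErr k * latticeMajorant p := by
  have hQ3 := three_le_quadratic h0 h1
  have hn := normSq_linePt_pnat p y
  have hQ : (p.1 : ℝ) ^ 2 + p.1 * p.2 + (p.2 : ℝ) ^ 2 ≤ ‖(p.1 : ℂ) * linePt y + p.2‖ ^ 2 := by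
    have := three_quarters_le_sq hy
    nlinarith [sq_nonneg (p.1 : ℝ)]
  have hmaj := inv_quadratic_sq_le p
  set Q := (p.1 : ℝ) ^ 2 + p.1 * p.2 + (p.2 : ℝ) ^ 2
  have hk2 : k = 2 * (k / 2 - 2 + 2) := by grind
  have hQ0 : 0 < Q := by linarith
  calc 1 / ‖(p.1 : ℂ) * linePt y + p.2‖ ^ k
      ≤ 1 / Q ^ (k / 2 - 2 + 2) := by
        conv_lhs => rw [hk2, pow_mul]
        gcongr
    _ = (1 / Q) ^ (k / 2 - 2) * (1 / Q ^ 2) := by rw [pow_add, one_div_pow]; field_simp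
    _ ≤ (1 / 3) ^ (k / 2 - 2) * (16 / 9 * latticeMajorant p) := by gcongr
    _ = _ := by rw [latticeErr]; ring

lemma linePt_sub_one (y : ℝ) : linePt y - 1 = -(starRingEnd ℂ) (linePt y) := by
  simp [linePt, Complex.ext_iff]
  norm_num

lemma main_pair_odd {k : ℕ} (hke : Even k) (y : ℝ) :
    1 / (linePt y - 1) ^ (k + 1) = -(starRingEnd ℂ) (1 / linePt y ^ (k + 1)) := by
  rw [linePt_sub_one, Odd.neg_pow hke.add_one]
  simp [div_neg]

lemma main_pair_even {k : ℕ} (hke : Even k) (y : ℝ) :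
    1 / (linePt y - 1) ^ (k + 2) = (starRingEnd ℂ) (1 / linePt y ^ (k + 2)) := by
  rw [linePt_sub_one, Even.neg_pow (by grind)]
  simp

lemma pnat_prod_ne : ((1, 0) : ℕ+ × ℤ) ≠ (1, -1) := by simp

lemma norm_sub_main_le {F : ℕ+ × ℤ → ℂ} {s : ℂ} {C : ℝ} (hC : 0 ≤ C) (hF : HasSum F s)
    (h : ∀ p, p ≠ (1, 0) → p ≠ (1, -1) → ‖F p‖ ≤ C * latticeMajorant p) :
    ‖s - F (1, 0) - F (1, -1)‖ ≤ C * 7.1 := by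
  obtain ⟨S, hS, hM⟩ := exists_hasSum_latticeMajorant
  have := hF.norm_sub_sub_le pnat_prod_ne (hM.mul_left C)
    (fun p => mul_nonneg hC (latticeMajorant_nonneg p)) h
  exact this.trans (by gcongr)

lemma latticeErr_nonneg (k : ℕ) : 0 ≤ latticeErr k := by rw [latticeErr]; positivity

lemma linePt_norm_pos {y : ℝ} (hy : √3 / 2 ≤ y) (p : ℕ+ × ℤ) :
    0 < ‖(p.1 : ℂ) * linePt y + p.2‖ := by
  have : (0 : ℝ) < (p.1 : ℝ) * y :=
    mul_pos (by exact_mod_cast p.1.pos) (sqrt_three_half_pos.trans_le hy)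
  exact this.trans_le (mul_le_norm_linePt p y)

lemma lineW_estimate {k : ℕ} (hk : 4 ≤ k) (hke : Even k) {y : ℝ} (hy : √3 / 2 ≤ y) :
    |realZeta k * (lineEk k y + y * lineEk' k y / k - 1) - (1 / linePt y ^ (k + 1)).re| ≤
      latticeErr k * 7.1 := by
  have hy0 := sqrt_three_half_pos.trans_le hy
  have hz : 0 < (linePt y).im := by simpa using hy0
  have hF := (Ek_lattice (by omega : 3 ≤ k) hke hz).sub
    ((deriv_Ek_lattice (by omega : 3 ≤ k) hke hz).mul_left (y * Complex.I))
  have h := norm_sub_main_le (latticeErr_nonneg k) hF (fun p h0 h1 => ?_)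
  · have hre := (Complex.abs_re_le_norm _).trans h
    refine le_of_eq_of_le (congrArg abs ?_) hre
    have e0 := main_pair_odd hke y
    have hz0 : linePt y ≠ 0 := fun h => by simp [h] at hz
    have hz1 : linePt y - 1 ≠ 0 := fun h => by
      have := congrArg Complex.im h; simp at this; linarith
    have e1 : 1 / linePt y ^ k - y * Complex.I * (1 / linePt y ^ (k + 1)) =
        1 / 2 * (1 / linePt y ^ (k + 1)) := by
      field_simp
      rw [pow_succ]
      field_simp
      simp [linePt]
    have e2 : 1 / (linePt y - 1) ^ k - y * Complex.I * (1 / (linePt y - 1) ^ (k + 1)) =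
        -(1 / 2) * (1 / (linePt y - 1) ^ (k + 1)) := by
      field_simp
      rw [pow_succ]
      field_simp
      simp [linePt]
      ring
    simp only [PNat.one_coe, Nat.cast_one, one_mul, Int.cast_zero, add_zero, Int.cast_neg,
      Int.cast_one, ← sub_eq_add_neg]
    rw [e1, e2, e0, Ek_linePt, deriv_Ek_linePt k hy0, ← ofReal_realZeta (by omega : 3 ≤ k)]
    have e3 : (realZeta k : ℂ) * (lineEk k y - 1) -
        y * Complex.I * (-realZeta k * (-Complex.I * lineEk' k y) / k) =
        ((realZeta k * (lineEk k y + y * lineEk' k y / k - 1) : ℝ) : ℂ) := by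
      push_cast
      linear_combination -(y * realZeta k * lineEk' k y / k : ℂ) * I_sq
    rw [e3]
    simp only [Complex.sub_re, Complex.ofReal_re, Complex.mul_re, Complex.neg_re, Complex.conj_re,
      Complex.neg_im]
    norm_num
    ring
  · have hpos := linePt_norm_pos hy p
    have hne : (p.1 : ℂ) * linePt y + p.2 ≠ 0 := norm_pos_iff.mp hpos
    have e : 1 / ((p.1 : ℂ) * linePt y + p.2) ^ k -
        y * Complex.I * ((p.1 : ℂ) / ((p.1 : ℂ) * linePt y + p.2) ^ (k + 1)) =
        (((p.1 : ℝ) / 2 + p.2 : ℝ) : ℂ) / ((p.1 : ℂ) * linePt y + p.2) ^ (k + 1) := by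
      rw [pow_succ]
      field_simp
      simp only [linePt]
      push_cast
      ring
    rw [e, norm_div, Complex.norm_real, norm_pow, Real.norm_eq_abs, pow_succ]
    refine le_trans ?_ (inv_norm_pow_le hk hke hy h0 h1)
    rw [div_le_div_iff₀ (by positivity) (by positivity)]
    have := abs_re_le_norm_linePt p y
    nlinarith [pow_pos hpos k]

lemma pnat_le_norm_linePt {y : ℝ} (hy : √3 / 2 ≤ y) (p : ℕ+ × ℤ) :
    (p.1 : ℝ) ^ 2 ≤ 4 / 3 * ‖(p.1 : ℂ) * linePt y + p.2‖ ^ 2 := by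
  have h1 := mul_le_norm_linePt p y
  have hy0 := sqrt_three_half_pos.trans_le hy
  have h2 := pow_le_pow_left₀ (by positivity) h1 2
  have := three_quarters_le_sq hy
  nlinarith [sq_nonneg (p.1 : ℝ)]

lemma lineEk'_estimate_of_majorant {k : ℕ} (hk : 3 ≤ k) (hke : Even k) {y : ℝ} (hy : 0 < y)
    {M : ℕ+ × ℤ → ℝ} {S : ℝ} (hM : HasSum M S) (hM0 : ∀ p, 0 ≤ M p)
    (h : ∀ p : ℕ+ × ℤ, p ≠ (1, 0) → p ≠ (1, -1) →
      (p.1 : ℝ) / ‖(p.1 : ℂ) * linePt y + p.2‖ ^ (k + 1) ≤ M p) :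
    |realZeta k * lineEk' k y / k - 2 * (1 / linePt y ^ (k + 1)).im| ≤ S := by
  have hz : 0 < (linePt y).im := by simpa using hy
  have hF := (deriv_Ek_lattice hk hke hz).norm_sub_sub_le pnat_prod_ne hM hM0 fun p h0 h1 => by
    simpa using h p h0 h1
  refine le_of_eq_of_le (congrArg abs ?_) ((Complex.abs_im_le_norm _).trans hF)
  simp only [PNat.one_coe, Nat.cast_one, one_mul, Int.cast_zero, add_zero, Int.cast_neg,
    Int.cast_one, ← sub_eq_add_neg]
  rw [main_pair_odd hke, deriv_Ek_linePt k hy, ← ofReal_realZeta hk]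
  have e3 : -(realZeta k : ℂ) * (-Complex.I * lineEk' k y) / k =
      ((realZeta k * lineEk' k y / k : ℝ) : ℂ) * Complex.I := by
    push_cast
    ring
  rw [e3, Complex.sub_im, Complex.sub_im, Complex.neg_im, Complex.conj_im, Complex.im_ofReal_mul,
    Complex.I_im]
  ring

lemma lineEk'_estimate {k : ℕ} (hk : 4 ≤ k) (hke : Even k) {y : ℝ} (hy : √3 / 2 ≤ y) :
    |realZeta k * lineEk' k y / k - 2 * (1 / linePt y ^ (k + 1)).im| ≤
      4 / 3 * latticeErr k * 7.1 := by
  obtain ⟨S, hS, hM⟩ := exists_hasSum_latticeMajorant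
  have h0 := latticeErr_nonneg k
  refine (lineEk'_estimate_of_majorant (by omega) hke (sqrt_three_half_pos.trans_le hy)
    (hM.mul_left (4 / 3 * latticeErr k))
    (fun p => mul_nonneg (by positivity) (latticeMajorant_nonneg p)) fun p h0 h1 => ?_).trans
    (by gcongr)
  have hpos := linePt_norm_pos hy p
  have h3 := pnat_le_norm_linePt hy p
  have h4 := inv_norm_pow_le hk hke hy h0 h1
  have h5 : (p.1 : ℝ) ≤ 4 / 3 * ‖(p.1 : ℂ) * linePt y + p.2‖ := by
    have : (0 : ℝ) < p.1 := by exact_mod_cast p.1.pos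
    nlinarith
  calc _ ≤ 4 / 3 * ‖(p.1 : ℂ) * linePt y + p.2‖ / ‖(p.1 : ℂ) * linePt y + p.2‖ ^ (k + 1) := by
        gcongr
    _ = 4 / 3 * (1 / ‖(p.1 : ℂ) * linePt y + p.2‖ ^ k) := by
        rw [pow_succ]; field_simp
    _ ≤ 4 / 3 * (latticeErr k * latticeMajorant p) := by gcongr
    _ = _ := by ring

lemma lineEk''_estimate {k : ℕ} (hk : 4 ≤ k) (hke : Even k) {y : ℝ} (hy : √3 / 2 ≤ y) :
    |realZeta k * lineEk'' k y / (k * (k + 1)) + 2 * (1 / linePt y ^ (k + 2)).re| ≤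
      4 / 3 * latticeErr k * 7.1 := by
  have hy0 := sqrt_three_half_pos.trans_le hy
  have hz : 0 < (linePt y).im := by simpa using hy0
  have hF := deriv_deriv_Ek_lattice (by omega : 3 ≤ k) hke hz
  have h := norm_sub_main_le (C := 4 / 3 * latticeErr k)
    (by have := latticeErr_nonneg k; positivity) hF (fun p h0 h1 => ?_)
  · have hre := (Complex.abs_re_le_norm _).trans h
    rw [← abs_neg]
    refine le_of_eq_of_le (congrArg abs ?_) hre
    simp only [PNat.one_coe, Nat.cast_one, one_mul, Int.cast_zero, add_zero, Int.cast_neg,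
      Int.cast_one, ← sub_eq_add_neg, one_pow]
    rw [main_pair_even hke, deriv_deriv_Ek_linePt k hy0, ← ofReal_realZeta (by omega : 3 ≤ k)]
    have e3 : (realZeta k : ℂ) * -(lineEk'' k y : ℂ) / (k * (k + 1)) =
        ((-(realZeta k * lineEk'' k y / (k * (k + 1))) : ℝ) : ℂ) := by
      push_cast
      ring
    rw [e3, Complex.sub_re, Complex.sub_re, Complex.conj_re, Complex.ofReal_re]
    ring
  · have hpos := linePt_norm_pos hy p
    rw [norm_div, norm_pow, norm_pow, Complex.norm_natCast]
    have h3 := pnat_le_norm_linePt hy p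
    have h4 := inv_norm_pow_le hk hke hy h0 h1
    calc _ ≤ 4 / 3 * ‖(p.1 : ℂ) * linePt y + p.2‖ ^ 2 / ‖(p.1 : ℂ) * linePt y + p.2‖ ^ (k + 2) := by
          gcongr
      _ = 4 / 3 * (1 / ‖(p.1 : ℂ) * linePt y + p.2‖ ^ k) := by
          rw [pow_add]; field_simp
      _ ≤ 4 / 3 * (latticeErr k * latticeMajorant p) := by gcongr
      _ = _ := by ring

lemma linePt_tan {α : ℝ} (hα : Real.cos α ≠ 0) :
    (linePt (Real.tan α / 2))⁻¹ = 2 * Real.cos α * cexp (-(α * Complex.I)) := by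
  have hz : linePt (Real.tan α / 2) * (2 * Real.cos α) = cexp (α * Complex.I) := by
    have hc : (Real.cos α : ℂ) ≠ 0 := by exact_mod_cast hα
    rw [Complex.exp_mul_I, linePt, Real.tan_eq_sin_div_cos]
    push_cast at hc ⊢
    field_simp
  have h1 : cexp (α * Complex.I) * cexp (-(α * Complex.I)) = 1 := by
    rw [← Complex.exp_add]; simp
  apply inv_eq_of_mul_eq_one_right
  linear_combination cexp (-(α * Complex.I)) * hz + h1

lemma linePt_tan_pow {α : ℝ} (hα : Real.cos α ≠ 0) (n : ℕ) :
    1 / linePt (Real.tan α / 2) ^ n =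
      (((2 * Real.cos α) ^ n * Real.cos (n * α) : ℝ) : ℂ) -
        (((2 * Real.cos α) ^ n * Real.sin (n * α) : ℝ) : ℂ) * Complex.I := by
  rw [one_div, ← inv_pow, linePt_tan hα, mul_pow, ← Complex.exp_nat_mul,
    show (n : ℂ) * -(α * Complex.I) = ((-(n * α) : ℝ) : ℂ) * Complex.I by push_cast; ring,
    Complex.exp_mul_I, ← Complex.ofReal_cos, ← Complex.ofReal_sin, Real.cos_neg, Real.sin_neg]
  push_cast
  ring

lemma linePt_tan_pow_re {α : ℝ} (hα : Real.cos α ≠ 0) (n : ℕ) :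
    (1 / linePt (Real.tan α / 2) ^ n).re = (2 * Real.cos α) ^ n * Real.cos (n * α) := by
  rw [linePt_tan_pow hα, Complex.sub_re, Complex.re_ofReal_mul, Complex.I_re, Complex.ofReal_re]
  ring

lemma linePt_tan_pow_im {α : ℝ} (hα : Real.cos α ≠ 0) (n : ℕ) :
    (1 / linePt (Real.tan α / 2) ^ n).im = -((2 * Real.cos α) ^ n * Real.sin (n * α)) := by
  rw [linePt_tan_pow hα, Complex.sub_im, Complex.im_ofReal_mul, Complex.I_im, Complex.ofReal_im]
  ring

/-- The argument of `linePt y`, measured from that of `rhoPt`. -/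
noncomputable def lineAngle (y : ℝ) : ℝ := Real.arctan (2 * y) - π / 3

lemma tan_lineAngle (y : ℝ) : Real.tan (π / 3 + lineAngle y) / 2 = y := by
  rw [lineAngle, add_sub_cancel, Real.tan_arctan]
  ring

lemma lineAngle_mono {x y : ℝ} (h : x ≤ y) : lineAngle x ≤ lineAngle y := by
  have := Real.arctan_mono (show 2 * x ≤ 2 * y by linarith)
  simp only [lineAngle]
  linarith

lemma lineAngle_sqrt_three : lineAngle (√3 / 2) = 0 := by
  rw [lineAngle, mul_div_cancel₀ _ (by norm_num), Real.arctan_sqrt_three, sub_self]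

lemma lineAngle_nonneg {y : ℝ} (hy : √3 / 2 ≤ y) : 0 ≤ lineAngle y := by
  rw [← lineAngle_sqrt_three]
  exact lineAngle_mono hy

lemma lineAngle_lt (y : ℝ) : lineAngle y < π / 6 := by
  have := Real.arctan_lt_pi_div_two (2 * y)
  rw [lineAngle]
  linarith

lemma cos_lineAngle_pos {ε : ℝ} (h0 : 0 ≤ ε) (h1 : ε < π / 6) : 0 < Real.cos (π / 3 + ε) :=
  Real.cos_pos_of_mem_Ioo ⟨by linarith [Real.pi_pos], by linarith⟩

lemma two_cos_add {ε : ℝ} : 2 * Real.cos (π / 3 + ε) = Real.cos ε - √3 * Real.sin ε := by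
  rw [Real.cos_add, Real.cos_pi_div_three, Real.sin_pi_div_three]
  ring

lemma nine_tenths_mul_le_sin {x : ℝ} (h0 : 0 ≤ x) (h1 : x ≤ π / 6) : 0.9 * x ≤ Real.sin x := by
  rcases h0.eq_or_lt with rfl | h0
  · simp
  have hπ := Real.pi_lt_d2
  have h := Real.sin_gt_sub_cube h0
  have h2 : x ^ 2 ≤ 0.6 := by nlinarith
  nlinarith [mul_le_mul_of_nonneg_left h2 h0.le]

lemma sqrt_three_gt : 1.732 < √3 := Real.lt_sqrt_of_sq_lt (by norm_num)

lemma sqrt_three_lt : √3 < 1.7321 := by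
  rw [Real.sqrt_lt' (by norm_num)]; norm_num

lemma two_cos_le {ε : ℝ} (h0 : 0 ≤ ε) (h1 : ε ≤ π / 6) :
    2 * Real.cos (π / 3 + ε) ≤ Real.exp (-(1.55 * ε)) := by
  rw [two_cos_add]
  have h2 := nine_tenths_mul_le_sin h0 h1
  have h3 := sqrt_three_gt
  have h4 := Real.add_one_le_exp (-(1.55 * ε))
  nlinarith [Real.cos_le_one ε]

lemma two_cos_pow_le {ε x : ℝ} (h0 : 0 ≤ ε) (h1 : ε < π / 6) {n : ℕ} (hx : 0 ≤ x)
    (h : x ≤ 1.55 * (n * ε)) : (2 * Real.cos (π / 3 + ε)) ^ n ≤ 1 / (1 + x + x ^ 2 / 2) := by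
  have hc := cos_lineAngle_pos h0 h1
  calc (2 * Real.cos (π / 3 + ε)) ^ n ≤ Real.exp (-(1.55 * ε)) ^ n :=
        pow_le_pow_left₀ (by positivity) (two_cos_le h0 h1.le) n
    _ = Real.exp (-(1.55 * (n * ε))) := by rw [← Real.exp_nat_mul]; ring_nf
    _ ≤ Real.exp (-x) := by gcongr
    _ ≤ _ := by
        rw [Real.exp_neg, ← one_div]
        gcongr
        exact Real.quadratic_le_exp_of_nonneg hx

lemma latticeErr_le_of_ten_le {k : ℕ} (hk : 10 ≤ k) : latticeErr k * 7.1 ≤ 0.468 := by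
  have : ((1 : ℝ) / 3) ^ (k / 2 - 2) ≤ (1 / 3) ^ 3 :=
    pow_le_pow_of_le_one (by norm_num) (by norm_num) (by omega)
  rw [latticeErr]
  norm_num at this ⊢
  linarith

lemma latticeErr_le_of_fourteen_le {k : ℕ} (hk : 14 ≤ k) : latticeErr k * 7.1 ≤ 0.052 := by
  have : ((1 : ℝ) / 3) ^ (k / 2 - 2) ≤ (1 / 3) ^ 5 :=
    pow_le_pow_of_le_one (by norm_num) (by norm_num) (by omega)
  rw [latticeErr]
  norm_num at this ⊢
  linarith

/-- `lineEk k y + y * lineEk' k y / k` is proportional to the derivative of `y ^ k * lineEk k y`. -/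
noncomputable def lineW (k : ℕ) (y : ℝ) : ℝ := lineEk k y + y * lineEk' k y / k

lemma lineW_pos_of_main {k : ℕ} (hk : 4 ≤ k) (hke : Even k) {y : ℝ} (hy : √3 / 2 ≤ y) {e : ℝ}
    (he : latticeErr k * 7.1 ≤ e)
    (h : e - 1 < (2 * Real.cos (π / 3 + lineAngle y)) ^ (k + 1) *
      Real.cos (((k + 1 : ℕ) : ℝ) * (π / 3 + lineAngle y))) : 0 < lineW k y := by
  have hest := lineW_estimate hk hke hy
  have hc := (cos_lineAngle_pos (lineAngle_nonneg hy) (lineAngle_lt y)).ne'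
  have hm := linePt_tan_pow_re hc (k + 1)
  rw [tan_lineAngle] at hm
  rw [← hm] at h
  have hζ := one_le_realZeta (by omega : 3 ≤ k)
  have h1 := (abs_le.mp hest).1
  have h2 : 0 < realZeta k * lineW k y := by rw [lineW]; nlinarith
  exact pos_of_mul_pos_right h2 (by linarith)

lemma lineW_pos_of_large {k : ℕ} (hk : 4 ≤ k) (hke : Even k) {y : ℝ} (hy : √3 / 2 ≤ y) {e x : ℝ}
    (he : latticeErr k * 7.1 ≤ e) (hx : 0 ≤ x) (h : x ≤ 1.55 * (((k + 1 : ℕ) : ℝ) * lineAngle y))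
    (hex : e + 1 / (1 + x + x ^ 2 / 2) < 1) : 0 < lineW k y := by
  refine lineW_pos_of_main hk hke hy he ?_
  have h1 := two_cos_pow_le (lineAngle_nonneg hy) (lineAngle_lt y) hx h
  have hc := cos_lineAngle_pos (lineAngle_nonneg hy) (lineAngle_lt y)
  have h2 : 0 ≤ (2 * Real.cos (π / 3 + lineAngle y)) ^ (k + 1) := by positivity
  have h3 := Real.neg_one_le_cos (((k + 1 : ℕ) : ℝ) * (π / 3 + lineAngle y))
  nlinarith

lemma lineW_pos_of_mod {k : ℕ} (hk : 10 ≤ k) (hke : Even k) (h6 : k % 6 ≠ 2) {y : ℝ}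
    (hy : √3 / 2 ≤ y) : 0 < lineW k y := by
  have he := latticeErr_le_of_ten_le hk
  have hε := lineAngle_nonneg hy
  have hπ := Real.pi_gt_d2
  rcases le_or_gt (((k + 1 : ℕ) : ℝ) * lineAngle y) (π / 6) with h | h
  · refine lineW_pos_of_main (by omega) hke hy he ?_
    have hc := cos_lineAngle_pos hε (lineAngle_lt y)
    have hcos : 0 ≤ Real.cos (((k + 1 : ℕ) : ℝ) * (π / 3 + lineAngle y)) := by
      have hδ : 0 ≤ ((k + 1 : ℕ) : ℝ) * lineAngle y := by positivity
      rw [mul_add]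
      generalize ((k + 1 : ℕ) : ℝ) * lineAngle y = δ at *
      rcases (show k % 6 = 0 ∨ k % 6 = 4 by grind) with h6 | h6
      · rw [show ((k + 1 : ℕ) : ℝ) * (π / 3) + δ = π / 3 + δ + ((k / 6 : ℕ) : ℝ) * (2 * π) by
          conv_lhs => rw [show k + 1 = 6 * (k / 6) + 1 by omega]
          push_cast; ring, Real.cos_add_nat_mul_two_pi]
        exact Real.cos_nonneg_of_mem_Icc ⟨by linarith, by linarith⟩
      · rw [show ((k + 1 : ℕ) : ℝ) * (π / 3) + δ = -(π / 3) + δ + ((k / 6 + 1 : ℕ) : ℝ) * (2 * π) by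
          conv_lhs => rw [show k + 1 = 6 * (k / 6) + 5 by omega]
          push_cast; ring, Real.cos_add_nat_mul_two_pi]
        exact Real.cos_nonneg_of_mem_Icc ⟨by linarith, by linarith⟩
    have : 0 ≤ (2 * Real.cos (π / 3 + lineAngle y)) ^ (k + 1) *
      Real.cos (((k + 1 : ℕ) : ℝ) * (π / 3 + lineAngle y)) := by positivity
    linarith
  · exact lineW_pos_of_large (x := 0.81) (by omega) hke hy he (by norm_num) (by linarith)
      (by norm_num)

lemma lineEk''_pos {k : ℕ} (hk : 14 ≤ k) (hke : Even k) (h6 : k % 6 = 2) {y : ℝ}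
    (hy : √3 / 2 ≤ y) (h : ((k + 2 : ℕ) : ℝ) * lineAngle y ≤ π / 12) : 0 < lineEk'' k y := by
  have he := latticeErr_le_of_fourteen_le hk
  have hest := lineEk''_estimate (by omega) hke hy
  have hε := lineAngle_nonneg hy
  have hc := cos_lineAngle_pos hε (lineAngle_lt y)
  have hm := linePt_tan_pow_re hc.ne' (k + 2)
  rw [tan_lineAngle] at hm
  rw [hm] at hest
  have hπ := Real.pi_lt_d4
  have h3 := sqrt_three_lt
  have h3' := sqrt_three_gt
  have hδ : 0 ≤ ((k + 2 : ℕ) : ℝ) * lineAngle y := by positivity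
  have hcos : Real.cos (((k + 2 : ℕ) : ℝ) * (π / 3 + lineAngle y)) ≤ -0.25 := by
    rw [mul_add]
    generalize ((k + 2 : ℕ) : ℝ) * lineAngle y = δ at *
    rw [show ((k + 2 : ℕ) : ℝ) * (π / 3) + δ = π / 3 + δ + π + ((k / 6 : ℕ) : ℝ) * (2 * π) by
      conv_lhs => rw [show k + 2 = 6 * (k / 6) + 4 by omega]
      push_cast; ring, Real.cos_add_nat_mul_two_pi, Real.cos_add_pi]
    have h1 := two_cos_add (ε := δ)
    have h2 := Real.one_sub_sq_div_two_le_cos (x := δ)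
    have h4 := Real.sin_le hδ
    have h5 : Real.sin δ ≤ 0.2619 := by linarith
    have h7 : δ ^ 2 ≤ 0.0687 := by nlinarith
    nlinarith
  have hpow : 0.5 ≤ (2 * Real.cos (π / 3 + lineAngle y)) ^ (k + 2) := by
    have hlow : 1 + -(1.75 * lineAngle y) ≤ 2 * Real.cos (π / 3 + lineAngle y) := by
      have hsmall : lineAngle y ≤ 0.02 := by
        have : (16 : ℝ) ≤ ((k + 2 : ℕ) : ℝ) := by exact_mod_cast (by omega : 16 ≤ k + 2)
        nlinarith
      rw [two_cos_add]
      have h2 := Real.one_sub_sq_div_two_le_cos (x := lineAngle y)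
      have h4 := Real.sin_le hε
      nlinarith
    have hsmall : lineAngle y ≤ 0.53 := by linarith [lineAngle_lt y]
    have hb := one_add_mul_le_pow (a := -(1.75 * lineAngle y)) (by linarith) (k + 2)
    have := pow_le_pow_left₀ (by linarith) hlow (k + 2)
    linarith
  have hprod : 0.125 ≤ -((2 * Real.cos (π / 3 + lineAngle y)) ^ (k + 2) *
      Real.cos (((k + 2 : ℕ) : ℝ) * (π / 3 + lineAngle y))) := by nlinarith
  have h1 := (abs_le.mp hest).1
  have hζ := one_le_realZeta (by omega : 3 ≤ k)
  have h2 : 0 < realZeta k * lineEk'' k y / (k * (k + 1)) := by linarith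
  have h3 : 0 < realZeta k * lineEk'' k y := by
    have hk0 : (0 : ℝ) < k := by positivity
    exact (div_pos_iff_of_pos_right (by positivity)).mp h2
  exact pos_of_mul_pos_right h3 (by linarith)

lemma lineEk_sqrt_three_eq_zero {k : ℕ} (hk : 3 ≤ k) (hke : Even k) (h6 : k % 6 ≠ 0) :
    lineEk k (√3 / 2) = 0 := by
  have h := Ek_rhoPt_eq_zero hk hke h6
  rw [rhoPt, Ek_linePt] at h
  exact_mod_cast h

lemma lineEk'_sqrt_three_eq_zero {k : ℕ} (hk : 3 ≤ k) (hke : Even k) (h6 : k % 6 = 2) :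
    lineEk' k (√3 / 2) = 0 := by
  have h := deriv_Ek_rhoPt_eq_zero hk hke h6
  rw [rhoPt, deriv_Ek_linePt k sqrt_three_half_pos] at h
  simpa using h

lemma strictMonoOn_Icc_of_hasDerivAt_pos {f f' : ℝ → ℝ} {a b : ℝ}
    (hf : ∀ x ∈ Set.Icc a b, HasDerivAt f (f' x) x) (hf' : ∀ x ∈ Set.Ioo a b, 0 < f' x) :
    StrictMonoOn f (Set.Icc a b) := by
  refine strictMonoOn_of_deriv_pos (convex_Icc a b)
    (fun x hx => (hf x hx).continuousAt.continuousWithinAt) fun x hx => ?_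
  rw [interior_Icc] at hx
  rw [(hf x (Set.Ioo_subset_Icc_self hx)).deriv]
  exact hf' x hx

lemma lineW_pos_of_mod_two {k : ℕ} (hk : 14 ≤ k) (hke : Even k) (h6 : k % 6 = 2) {y : ℝ}
    (hy : √3 / 2 < y) : 0 < lineW k y := by
  have hs := sqrt_three_half_pos
  rcases le_or_gt (((k + 2 : ℕ) : ℝ) * lineAngle y) (π / 12) with h | h
  · have h'' : ∀ x ∈ Set.Icc (√3 / 2) y, 0 < lineEk'' k x := fun x hx =>
      lineEk''_pos hk hke h6 hx.1
        ((mul_le_mul_of_nonneg_left (lineAngle_mono hx.2) (by positivity)).trans h)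
    have hm' := strictMonoOn_Icc_of_hasDerivAt_pos
      (fun x hx => hasDerivAt_lineEk' k (hs.trans_le hx.1))
      (fun x hx => h'' x (Set.Ioo_subset_Icc_self hx))
    have hl : √3 / 2 ∈ Set.Icc (√3 / 2) y := Set.left_mem_Icc.mpr hy.le
    have h' : ∀ x ∈ Set.Ioc (√3 / 2) y, 0 < lineEk' k x := fun x hx => by
      have := hm' hl (Set.Ioc_subset_Icc_self hx) hx.1
      rwa [lineEk'_sqrt_three_eq_zero (by omega) hke h6] at this
    have hm := strictMonoOn_Icc_of_hasDerivAt_pos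
      (fun x hx => hasDerivAt_lineEk k (hs.trans_le hx.1))
      (fun x hx => h' x (Set.Ioo_subset_Ioc_self hx))
    have h0 : 0 < lineEk k y := by
      have := hm hl (Set.right_mem_Icc.mpr hy.le) hy
      rwa [lineEk_sqrt_three_eq_zero (by omega) hke (by omega)] at this
    have h1 := h' y (Set.right_mem_Ioc.mpr hy)
    have hy0 := hs.trans hy
    rw [lineW]
    positivity
  · refine lineW_pos_of_large (x := 0.37) (by omega) hke hy.le (latticeErr_le_of_fourteen_le hk)
      (by norm_num) ?_ (by norm_num)
    have hk' : (14 : ℝ) ≤ k := by exact_mod_cast hk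
    have hπ := Real.pi_gt_d2
    have h0 := lineAngle_nonneg hy.le
    push_cast at h ⊢
    nlinarith

lemma lineW_pos {k : ℕ} (hk : 10 ≤ k) (hke : Even k) {y : ℝ} (hy : √3 / 2 < y) :
    0 < lineW k y := by
  by_cases h6 : k % 6 = 2
  · exact lineW_pos_of_mod_two (by omega) hke h6 hy
  · exact lineW_pos_of_mod hk hke h6 hy.le

lemma lineEk_sqrt_three_pos {k : ℕ} (hk : 10 ≤ k) (hke : Even k) (h6 : k % 6 = 0) :
    0 < lineEk k (√3 / 2) := by
  have hW := lineW_pos_of_mod hk hke (by omega) le_rfl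
  have h := deriv_Ek_rhoPt_of_dvd (by omega) hke h6
  rw [rhoPt_sq, rhoPt, deriv_Ek_linePt k sqrt_three_half_pos, Ek_linePt, linePt] at h
  have hre := congrArg Complex.re h
  simp at hre
  have hk0 : (0 : ℝ) < k := by positivity
  rw [lineW] at hW
  have : √3 / 2 * lineEk' k (√3 / 2) / k = -(lineEk k (√3 / 2) / 2) := by
    field_simp
    linarith
  linarith

lemma lineEk_pos {k : ℕ} (hk : 10 ≤ k) (hke : Even k) {y : ℝ} (hy : √3 / 2 < y) :
    0 < lineEk k y := by
  have hs := sqrt_three_half_pos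
  have h0 : 0 ≤ lineEk k (√3 / 2) := by
    by_cases h6 : k % 6 = 0
    · exact (lineEk_sqrt_three_pos hk hke h6).le
    · exact (lineEk_sqrt_three_eq_zero (by omega) hke h6).ge
  have hd : ∀ x, 0 < x → HasDerivAt (fun x => x ^ k * lineEk k x)
      (k * x ^ (k - 1) * lineW k x) x := fun x hx => by
    refine ((hasDerivAt_pow k x).mul (hasDerivAt_lineEk k hx)).congr_deriv ?_
    have hk0 : (k : ℝ) ≠ 0 := by positivity
    rw [lineW]
    obtain ⟨n, rfl⟩ : ∃ n, k = n + 1 := ⟨k - 1, by omega⟩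
    simp only [add_tsub_cancel_right]
    field_simp
    ring
  have hm := strictMonoOn_Icc_of_hasDerivAt_pos (b := y) (fun x hx => hd x (hs.trans_le hx.1))
    (fun x hx => by
      have := lineW_pos hk hke hx.1
      have := hs.trans hx.1
      positivity)
  have h := hm (Set.left_mem_Icc.mpr hy.le) (Set.right_mem_Icc.mpr hy.le) hy
  have h1 : 0 < y ^ k * lineEk k y := lt_of_le_of_lt (by positivity) h
  exact pos_of_mul_pos_right h1 (pow_nonneg (hs.trans hy).le k)

lemma lineEk'_sqrt_three_pos {k : ℕ} (hk : 10 ≤ k) (hke : Even k) (h6 : k % 6 = 4) :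
    0 < lineEk' k (√3 / 2) := by
  have hest := lineEk'_estimate (by omega) hke (le_refl (√3 / 2))
  have he := latticeErr_le_of_ten_le hk
  have hc := cos_lineAngle_pos (lineAngle_nonneg le_rfl) (lineAngle_lt (√3 / 2))
  have hm := linePt_tan_pow_im hc.ne' (k + 1)
  rw [tan_lineAngle, lineAngle_sqrt_three, add_zero, Real.cos_pi_div_three,
    show ((k + 1 : ℕ) : ℝ) * (π / 3) = -(π / 3) + ((k / 6 + 1 : ℕ) : ℝ) * (2 * π) by
      conv_lhs => rw [show k + 1 = 6 * (k / 6) + 5 by omega]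
      push_cast; ring, Real.sin_add_nat_mul_two_pi, Real.sin_neg, Real.sin_pi_div_three] at hm
  rw [mul_one_div_cancel two_ne_zero, one_pow, one_mul, neg_neg] at hm
  have h3 := sqrt_three_gt
  have h1 := (abs_le.mp hest).1
  have hζ := one_le_realZeta (by omega : 3 ≤ k)
  rw [hm] at h1
  have h2 : 0 < realZeta k * lineEk' k (√3 / 2) / k := by linarith
  have hk0 : (0 : ℝ) < k := by positivity
  exact pos_of_mul_pos_right ((div_pos_iff_of_pos_right hk0).mp h2) (by linarith)

lemma pow_le_sigma {n r : ℕ} (hn : n ≠ 0) : (n : ℝ) ^ r ≤ σ r n := by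
  rw [ArithmeticFunction.sigma_apply]
  exact_mod_cast Finset.single_le_sum (f := fun d => d ^ r) (fun _ _ => Nat.zero_le _)
    (Nat.mem_divisors_self n hn)

lemma sigma_le_mul_pow (n : ℕ) {r : ℕ} (hr : 2 ≤ r) : (σ r n : ℝ) ≤ 1.65 * (n : ℝ) ^ r := by
  have hπ : π ^ 2 / 6 ≤ 1.65 := by nlinarith [Real.pi_lt_d4, Real.pi_pos]
  have hsum : ∑ d ∈ n.divisors, 1 / (d : ℝ) ^ 2 ≤ π ^ 2 / 6 :=
    sum_le_hasSum _ (fun _ _ => by positivity) hasSum_zeta_two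
  calc (σ r n : ℝ) = ∑ d ∈ n.divisors, ((n / d : ℕ) : ℝ) ^ r := by
        rw [ArithmeticFunction.sigma_apply, ← Nat.sum_div_divisors n (fun d => d ^ r)]
        push_cast
        rfl
    _ ≤ ∑ d ∈ n.divisors, (n : ℝ) ^ r * (1 / (d : ℝ) ^ 2) := by
        refine Finset.sum_le_sum fun d hd => ?_
        have hd0 : (1 : ℝ) ≤ d := by exact_mod_cast Nat.pos_of_mem_divisors hd
        rw [Nat.cast_div (Nat.dvd_of_mem_divisors hd) (by positivity), div_pow, div_eq_mul_one_div]
        gcongr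
    _ = (n : ℝ) ^ r * ∑ d ∈ n.divisors, 1 / (d : ℝ) ^ 2 := by rw [Finset.mul_sum]
    _ ≤ 1.65 * (n : ℝ) ^ r := by
        rw [mul_comm]
        gcongr
        exact hsum.trans hπ

lemma one_add_mul_exp_le {s : ℝ} (h0 : 0 ≤ s) (h1 : s ≤ 1) :
    (1 + s) * Real.exp (-s) ≤ Real.exp (-(s ^ 2 / 6)) := by
  have h := Real.quadratic_le_exp_of_nonneg (show 0 ≤ s - s ^ 2 / 6 by nlinarith)
  have h2 : 1 + s ≤ Real.exp (s - s ^ 2 / 6) := by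
    refine le_trans ?_ h
    nlinarith [mul_nonneg (sq_nonneg s) (show 0 ≤ 1 - s by linarith), sq_nonneg (s ^ 2)]
  calc (1 + s) * Real.exp (-s) ≤ Real.exp (s - s ^ 2 / 6) * Real.exp (-s) := by gcongr
    _ = _ := by rw [← Real.exp_add]; ring_nf

lemma one_sub_mul_exp_le {s : ℝ} (h0 : 0 ≤ s) (h1 : s ≤ 1) :
    (1 - s) * Real.exp s ≤ Real.exp (-(s ^ 2 / 2)) := by
  rcases h1.eq_or_lt with rfl | h1
  · simp [Real.exp_nonneg]
  have hs : 0 < 1 - s := by linarith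
  have h := Real.le_log_one_add_of_nonneg (show 0 ≤ s / (1 - s) by positivity)
  rw [show 1 + s / (1 - s) = (1 - s)⁻¹ by field_simp; ring, Real.log_inv] at h
  have h2 : s + s ^ 2 / 2 ≤ 2 * (s / (1 - s)) / (s / (1 - s) + 2) := by
    have hs2 : 0 < 2 - s := by linarith
    rw [show s / (1 - s) + 2 = (2 - s) / (1 - s) by field_simp; ring,
      show 2 * (s / (1 - s)) / ((2 - s) / (1 - s)) = 2 * s / (2 - s) by field_simp,
      le_div_iff₀ hs2]
    nlinarith [pow_nonneg h0 3]
  calc (1 - s) * Real.exp s = Real.exp (Real.log (1 - s) + s) := by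
        rw [Real.exp_add, Real.exp_log hs]
    _ ≤ _ := Real.exp_le_exp.mpr (by linarith)

lemma exp_neg_div_pow (k m n : ℕ) :
    Real.exp (-((k : ℝ) / m)) ^ n = Real.exp (-((n : ℝ) / m)) ^ k := by
  rw [← Real.exp_nat_mul, ← Real.exp_nat_mul]
  ring_nf

lemma pow_mul_exp_add_le {k m : ℕ} (hm : 1 ≤ m) (h7 : 7 * m ^ 2 ≤ k) (n : ℕ) :
    ((m + n : ℕ) : ℝ) ^ k * Real.exp (-((k : ℝ) / m)) ^ (m + n) ≤
      (m : ℝ) ^ k * Real.exp (-((k : ℝ) / m)) ^ m * Real.exp (-(7 / 6)) ^ n := by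
  have hm1 : (1 : ℝ) ≤ m := by exact_mod_cast hm
  have hm0 : (0 : ℝ) < m := by linarith
  have h7' : 7 * (m : ℝ) ^ 2 ≤ k := by exact_mod_cast h7
  have hs1 : 1 / (m : ℝ) ≤ 1 := by rw [div_le_one hm0]; exact hm1
  have hb : 1 + (n : ℝ) * (1 / m) ≤ (1 + 1 / m) ^ n :=
    one_add_mul_le_pow (by linarith [show 0 < 1 / (m : ℝ) by positivity]) n
  have key : (1 + (n : ℝ) * (1 / m)) * Real.exp (-((n : ℝ) / m)) ≤
      Real.exp (-((1 / (m : ℝ)) ^ 2 / 6)) ^ n :=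
    calc (1 + (n : ℝ) * (1 / m)) * Real.exp (-((n : ℝ) / m))
        ≤ (1 + 1 / (m : ℝ)) ^ n * Real.exp (-(1 / (m : ℝ))) ^ n := by
          rw [← Real.exp_nat_mul, show (n : ℝ) * -(1 / (m : ℝ)) = -((n : ℝ) / m) by ring]
          gcongr
      _ = ((1 + 1 / (m : ℝ)) * Real.exp (-(1 / (m : ℝ)))) ^ n := by rw [mul_pow]
      _ ≤ _ := pow_le_pow_left₀ (by positivity) (one_add_mul_exp_le (by positivity) hs1) n
  have hk : Real.exp (-((1 / (m : ℝ)) ^ 2 / 6)) ^ k ≤ Real.exp (-(7 / 6)) := by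
    rw [← Real.exp_nat_mul]
    refine Real.exp_le_exp.mpr ?_
    have : 7 ≤ (k : ℝ) * (1 / (m : ℝ)) ^ 2 := by
      rw [div_pow, one_pow, mul_one_div, le_div_iff₀ (by positivity)]; exact h7'
    linarith
  calc ((m + n : ℕ) : ℝ) ^ k * Real.exp (-((k : ℝ) / m)) ^ (m + n)
      = (m : ℝ) ^ k * Real.exp (-((k : ℝ) / m)) ^ m *
        ((1 + (n : ℝ) * (1 / m)) * Real.exp (-((n : ℝ) / m))) ^ k := by
        rw [mul_pow, ← exp_neg_div_pow k m n, pow_add, show ((m + n : ℕ) : ℝ) = m * (1 + (n : ℝ) * (1 / m)) by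
          push_cast; field_simp, mul_pow]
        ring
    _ ≤ (m : ℝ) ^ k * Real.exp (-((k : ℝ) / m)) ^ m * (Real.exp (-((1 / (m : ℝ)) ^ 2 / 6)) ^ n) ^ k := by
        gcongr
    _ = (m : ℝ) ^ k * Real.exp (-((k : ℝ) / m)) ^ m * (Real.exp (-((1 / (m : ℝ)) ^ 2 / 6)) ^ k) ^ n := by
        rw [← pow_mul, ← pow_mul, mul_comm n k]
    _ ≤ _ := by gcongr

lemma pow_mul_exp_sub_le {k m : ℕ} (hm : 1 ≤ m) (h7 : 7 * m ^ 2 ≤ k) {i n : ℕ} (hin : i + n = m) :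
    (i : ℝ) ^ k * Real.exp (-((k : ℝ) / m)) ^ i ≤
      (m : ℝ) ^ k * Real.exp (-((k : ℝ) / m)) ^ m * Real.exp (-(7 / 2)) ^ n := by
  have hm1 : (1 : ℝ) ≤ m := by exact_mod_cast hm
  have hm0 : (0 : ℝ) < m := by linarith
  have h7' : 7 * (m : ℝ) ^ 2 ≤ k := by exact_mod_cast h7
  have hs1 : 1 / (m : ℝ) ≤ 1 := by rw [div_le_one hm0]; exact hm1
  have hi : (i : ℝ) = m * (1 - (n : ℝ) * (1 / m)) := by
    field_simp
    rw [← hin]; push_cast; ring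
  have hpos : 0 ≤ 1 - (n : ℝ) * (1 / m) := by
    have : 0 ≤ (m : ℝ) * (1 - (n : ℝ) * (1 / m)) := by rw [← hi]; positivity
    exact nonneg_of_mul_nonneg_right this hm0
  have hb : 1 - (n : ℝ) * (1 / m) ≤ (1 - 1 / m) ^ n := by
    have := one_add_mul_le_pow (a := -(1 / (m : ℝ))) (by linarith) n
    rwa [mul_neg, ← sub_eq_add_neg, ← sub_eq_add_neg] at this
  have key : (1 - (n : ℝ) * (1 / m)) * Real.exp ((n : ℝ) / m) ≤
      Real.exp (-((1 / (m : ℝ)) ^ 2 / 2)) ^ n :=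
    calc (1 - (n : ℝ) * (1 / m)) * Real.exp ((n : ℝ) / m)
        ≤ (1 - 1 / (m : ℝ)) ^ n * Real.exp (1 / (m : ℝ)) ^ n := by
          rw [← Real.exp_nat_mul, show (n : ℝ) * (1 / (m : ℝ)) = (n : ℝ) / m by ring] at *
          gcongr
      _ = ((1 - 1 / (m : ℝ)) * Real.exp (1 / (m : ℝ))) ^ n := by rw [mul_pow]
      _ ≤ _ := pow_le_pow_left₀ (mul_nonneg (by linarith) (Real.exp_nonneg _))
        (one_sub_mul_exp_le (by positivity) hs1) n
  have hk : Real.exp (-((1 / (m : ℝ)) ^ 2 / 2)) ^ k ≤ Real.exp (-(7 / 2)) := by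
    rw [← Real.exp_nat_mul]
    refine Real.exp_le_exp.mpr ?_
    have : 7 ≤ (k : ℝ) * (1 / (m : ℝ)) ^ 2 := by
      rw [div_pow, one_pow, mul_one_div, le_div_iff₀ (by positivity)]; exact h7'
    linarith
  have hexp : Real.exp (-((k : ℝ) / m)) ^ i =
      Real.exp (-((k : ℝ) / m)) ^ m * Real.exp ((n : ℝ) / m) ^ k := by
    rw [← hin, pow_add, hin, exp_neg_div_pow k m n, mul_assoc, ← mul_pow, ← Real.exp_add]
    simp
  calc (i : ℝ) ^ k * Real.exp (-((k : ℝ) / m)) ^ i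
      = (m : ℝ) ^ k * Real.exp (-((k : ℝ) / m)) ^ m *
        ((1 - (n : ℝ) * (1 / m)) * Real.exp ((n : ℝ) / m)) ^ k := by
        rw [hexp, hi, mul_pow, mul_pow]
        ring
    _ ≤ (m : ℝ) ^ k * Real.exp (-((k : ℝ) / m)) ^ m * (Real.exp (-((1 / (m : ℝ)) ^ 2 / 2)) ^ n) ^ k := by
        gcongr
    _ = (m : ℝ) ^ k * Real.exp (-((k : ℝ) / m)) ^ m * (Real.exp (-((1 / (m : ℝ)) ^ 2 / 2)) ^ k) ^ n := by
        rw [← pow_mul, ← pow_mul, mul_comm n k]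
    _ ≤ _ := by gcongr

lemma exp_neg_seven_sixths_le : Real.exp (-(7 / 6)) ≤ 0.32 := by
  have h1 := Real.exp_one_gt_d9
  have h2 := Real.quadratic_le_exp_of_nonneg (show (0 : ℝ) ≤ 1 / 6 by norm_num)
  rw [Real.exp_neg, inv_le_comm₀ (Real.exp_pos _) (by norm_num),
    show (7 / 6 : ℝ) = 1 + 1 / 6 by norm_num, Real.exp_add]
  norm_num at *
  nlinarith

lemma exp_neg_seven_halves_le : Real.exp (-(7 / 2)) ≤ 0.04 := by
  have h : Real.exp (-(7 / 2)) = Real.exp (-(7 / 6)) ^ 3 := by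
    rw [← Real.exp_nat_mul]; norm_num
  rw [h]
  calc Real.exp (-(7 / 6)) ^ 3 ≤ 0.32 ^ 3 :=
        pow_le_pow_left₀ (Real.exp_nonneg _) exp_neg_seven_sixths_le 3
    _ ≤ 0.04 := by norm_num

lemma hasSum_geometric_succ {r : ℝ} (h0 : 0 ≤ r) (h1 : r < 1) :
    HasSum (fun n : ℕ => r ^ (n + 1)) (r / (1 - r)) := by
  simpa [pow_succ', div_eq_mul_inv] using (hasSum_geometric_of_lt_one h0 h1).mul_left r

lemma lineSum_one_sign {k m : ℕ} (hk : 4 ≤ k) (hm : 1 ≤ m) (h7 : 7 * m ^ 2 ≤ k) :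
    0 < (-1) ^ m * lineSum k 1 (k / (2 * π * m)) := by
  set x : ℝ := Real.exp (-((k : ℝ) / m)) with hx
  have hx0 : 0 < x := Real.exp_pos _
  have hy : 0 < (k : ℝ) / (2 * π * m) := by positivity
  have hxe : Real.exp (-2 * π * (k / (2 * π * m))) = x := by
    rw [hx]
    congr 1
    field_simp
  set u : ℕ → ℝ := fun n => (n : ℝ) ^ k * x ^ n with hu
  set f : ℕ → ℝ := fun n => ((n : ℝ) ^ 1 * (σ (k - 1) n : ℝ)) * (-x) ^ n with hf
  have hS : lineSum k 1 (k / (2 * π * m)) = ∑' n, f n := by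
    rw [lineSum, hxe]
  have hnorm : ∀ n, |f n| = ((n : ℝ) * (σ (k - 1) n : ℝ)) * x ^ n := fun n => by
    rw [hf]
    simp only [abs_mul, abs_pow, abs_neg, abs_of_pos hx0, Nat.abs_cast, pow_one]
  have hk1 : ∀ n : ℕ, (n : ℝ) * (n : ℝ) ^ (k - 1) = (n : ℝ) ^ k := fun n => by
    rw [← pow_succ']
    congr 1
    omega
  have hle : ∀ n, |f n| ≤ 1.65 * u n := fun n => by
    rw [hnorm, hu]
    simp only
    rw [← hk1, ← mul_assoc]
    refine mul_le_mul_of_nonneg_right ?_ (by positivity)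
    have := mul_le_mul_of_nonneg_left (sigma_le_mul_pow n (by omega : 2 ≤ k - 1))
      (Nat.cast_nonneg n : (0 : ℝ) ≤ n)
    linarith
  have hge : u m ≤ (-1) ^ m * f m := by
    rw [hf, hu]
    simp only
    rw [neg_pow x, pow_one, ← hk1]
    have h1 : ((-1 : ℝ) ^ m) * (-1) ^ m = 1 := by rw [← mul_pow]; norm_num
    have := mul_le_mul_of_nonneg_left (pow_le_sigma (r := k - 1) (by omega : m ≠ 0))
      (Nat.cast_nonneg m : (0 : ℝ) ≤ m)
    calc (m : ℝ) * (m : ℝ) ^ (k - 1) * x ^ m ≤ (m * (σ (k - 1) m : ℝ)) * x ^ m := by gcongr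
      _ = _ := by linear_combination -((m : ℝ) * (σ (k - 1) m : ℝ) * x ^ m) * h1
  have hum : 0 < u m := by
    have : (0 : ℝ) < m := by exact_mod_cast hm
    positivity
  set r := Real.exp (-(7 / 6))
  set s := Real.exp (-(7 / 2))
  have hr := exp_neg_seven_sixths_le
  have hs := exp_neg_seven_halves_le
  have hr0 : 0 < r := Real.exp_pos _
  have hs0 : 0 < s := Real.exp_pos _
  have hgr := hasSum_geometric_succ hr0.le (by linarith)
  have hgs := hasSum_geometric_succ hs0.le (by linarith)
  have htail : |∑' n, f (n + (m + 1))| ≤ 1.65 * u m * (r / (1 - r)) := by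
    rw [← Real.norm_eq_abs]
    refine tsum_of_norm_bounded (hgr.mul_left (1.65 * u m)) fun n => ?_
    refine (hle _).trans ?_
    have := pow_mul_exp_add_le hm h7 (n + 1)
    rw [show n + (m + 1) = m + (n + 1) by ring, mul_assoc]
    exact mul_le_mul_of_nonneg_left this (by norm_num)
  have hhead : |∑ n ∈ Finset.range m, f n| ≤ 1.65 * u m * (s / (1 - s)) := by
    rw [← Finset.sum_range_reflect]
    refine (Finset.abs_sum_le_sum_abs _ _).trans ?_
    have hb : ∑ j ∈ Finset.range m, |f (m - 1 - j)| ≤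
        ∑ j ∈ Finset.range m, 1.65 * u m * s ^ (j + 1) := by
      refine Finset.sum_le_sum fun j hj => (hle _).trans ?_
      have := pow_mul_exp_sub_le hm h7 (i := m - 1 - j) (n := j + 1)
        (by have := Finset.mem_range.mp hj; omega)
      rw [mul_assoc]
      exact mul_le_mul_of_nonneg_left this (by norm_num)
    refine hb.trans ?_
    rw [← Finset.mul_sum]
    gcongr
    exact sum_le_hasSum _ (fun _ _ => by positivity) hgs
  have hfs : Summable f := by
    refine Summable.of_norm_bounded (summable_sigmaSeries_bound k hy |>.mul_left 1.65) fun n => ?_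
    rw [hxe]
    exact hle n
  have hsplit := hfs.sum_add_tsum_nat_add (m + 1)
  rw [Finset.sum_range_succ] at hsplit
  have hrb : r / (1 - r) ≤ 0.4706 := by
    rw [div_le_iff₀ (by linarith)]; linarith
  have hsb : s / (1 - s) ≤ 0.0417 := by
    rw [div_le_iff₀ (by linarith)]; linarith
  have hsgn : ∀ a : ℝ, -|a| ≤ (-1) ^ m * a := fun a => by
    have := neg_abs_le ((-1) ^ m * a)
    rwa [abs_mul, abs_pow, abs_neg, abs_one, one_pow, one_mul] at this
  rw [hS, ← hsplit, mul_add, mul_add]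
  have h1 := hsgn (∑ n ∈ Finset.range m, f n)
  have h2 := hsgn (∑' n, f (n + (m + 1)))
  nlinarith

lemma hasSum_inv_sq_add_nat : HasSum (fun n : ℕ => 1 / ((n : ℝ) ^ 2 + n)) 1 := by
  rw [← hasSum_nat_add_iff' 1, hasSum_iff_tendsto_nat_of_nonneg (fun _ => by positivity)]
  have h : ∀ N : ℕ, ∑ i ∈ Finset.range N, 1 / (((i + 1 : ℕ) : ℝ) ^ 2 + ((i + 1 : ℕ) : ℝ)) =
      1 - 1 / ((N : ℝ) + 1) := fun N => by
    induction N with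
    | zero => simp
    | succ N ih =>
      rw [Finset.sum_range_succ, ih]
      push_cast
      field_simp
      ring
  simp only [h]
  simpa using (tendsto_one_div_add_atTop_nhds_zero_nat (𝕜 := ℝ)).const_sub 1

lemma hasSum_inv_sq_add_int : HasSum (fun d : ℤ => 1 / ((d : ℝ) ^ 2 + d)) 2 := by
  have h := HasSum.of_nat_of_neg_add_one (f := fun d : ℤ => 1 / ((d : ℝ) ^ 2 + d))
    (by simpa using hasSum_inv_sq_add_nat) (m' := 1) (by
      refine hasSum_inv_sq_add_nat.congr_fun fun n => ?_
      push_cast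
      ring_nf)
  norm_num at h
  simpa using h

lemma int_sq_add_nonneg (d : ℤ) : (0 : ℝ) ≤ (d : ℝ) ^ 2 + d := by
  have : 0 ≤ d ^ 2 + d := by
    rcases le_or_gt 0 d with h | h
    · positivity
    · nlinarith
  exact_mod_cast this

/-- The contribution of the row `c = 1` to the majorant of the lattice sum. -/
noncomputable def rowMajorant (p : ℕ+ × ℤ) : ℝ :=
  (if p.1 = 1 then 1 else 0) * (1 / ((p.2 : ℝ) ^ 2 + p.2))

lemma rowMajorant_nonneg (p : ℕ+ × ℤ) : 0 ≤ rowMajorant p := by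
  have := int_sq_add_nonneg p.2
  rw [rowMajorant]
  split_ifs <;> positivity

lemma hasSum_rowMajorant : HasSum rowMajorant 2 := by
  have h := hasSum_inv_sq_add_int
  have hinj : Function.Injective (fun d : ℤ => ((1, d) : ℕ+ × ℤ)) := fun a b hab => by
    simpa using hab
  rw [← hinj.hasSum_iff]
  · simpa [Function.comp_def, rowMajorant] using h
  · rintro ⟨c, d⟩ hcd
    have : c ≠ 1 := fun hc => hcd ⟨d, by rw [hc]⟩
    simp [rowMajorant, this]

lemma inv_pow_succ_le {k : ℕ} {R N b : ℝ} (hR : 0 < R) (hRN : R ≤ N)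
    (hb : R ^ 2 * b ≤ N ^ 2) (hb0 : 0 < b) :
    1 / N ^ (k + 1) ≤ (1 / R) ^ (k + 1) * (1 / b ^ (k / 2)) := by
  have hN : 0 < N := hR.trans_le hRN
  have h1 : (R / N) ^ (k + 1) ≤ (1 / b) ^ (k / 2) :=
    calc (R / N) ^ (k + 1) ≤ (R / N) ^ (2 * (k / 2)) :=
          pow_le_pow_of_le_one (by positivity) ((div_le_one hN).mpr hRN) (by omega)
      _ = ((R / N) ^ 2) ^ (k / 2) := pow_mul _ _ _
      _ ≤ (1 / b) ^ (k / 2) := by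
          gcongr
          rw [div_pow, div_le_div_iff₀ (by positivity) hb0]
          linarith
  calc 1 / N ^ (k + 1) = (1 / R) ^ (k + 1) * (R / N) ^ (k + 1) := by
        rw [← mul_pow]
        rw [one_div_mul_eq_div, div_div_cancel_left' hR.ne', inv_pow, one_div]
    _ ≤ _ := by
        rw [← one_div_pow]
        gcongr

lemma row_term_le {k : ℕ} (hk : 2 ≤ k) {y R : ℝ} (hR0 : 0 < R)
    (hR : R ^ 2 = y ^ 2 + 1 / 4) {d : ℤ} (h0 : d ≠ 0) (h1 : d ≠ -1) :
    1 / ‖linePt y + d‖ ^ (k + 1) ≤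
      (1 / R) ^ (k + 1) * (R ^ 2 / (k / 2 : ℕ) * (1 / ((d : ℝ) ^ 2 + d))) := by
  have hd : (0 : ℝ) < (d : ℝ) ^ 2 + d := by
    have : 0 < d ^ 2 + d := by
      rcases le_or_gt 0 d with h | h
      · positivity
      · have : d ≤ -2 := by omega
        nlinarith
    exact_mod_cast this
  have hn := normSq_linePt_pnat (1, d) y
  simp only [PNat.one_coe, Nat.cast_one, one_mul, one_pow] at hn
  have hκ : (0 : ℝ) < (k / 2 : ℕ) := by exact_mod_cast (by omega : 0 < k / 2)
  set t := ((d : ℝ) ^ 2 + d) / R ^ 2 with ht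
  have ht0 : 0 < t := by positivity
  have hn' : R ^ 2 * (1 + t) = ‖linePt y + d‖ ^ 2 := by
    rw [hn, ht]
    field_simp
    rw [hR]
    ring
  have hRle : R ≤ ‖linePt y + d‖ := by
    refine le_of_sq_le_sq ?_ (norm_nonneg _)
    rw [hn]
    nlinarith
  refine (inv_pow_succ_le hR0 hRle hn'.le (by positivity)).trans ?_
  gcongr
  have hb := one_add_mul_le_pow (a := t) (by linarith) (k / 2)
  calc 1 / (1 + t) ^ (k / 2) ≤ 1 / ((k / 2 : ℕ) * t) := by
        refine one_div_le_one_div_of_le (by positivity) (by linarith)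
    _ = _ := by
        rw [ht]
        field_simp

lemma lattice_term_le {k : ℕ} (hk : 10 ≤ k) {y R : ℝ} (hy : √3 / 2 ≤ y)
    (hR0 : 0 < R) (hR : R ^ 2 = y ^ 2 + 1 / 4) (hyk : 2 * y ^ 2 ≤ (k / 2 : ℕ)) {p : ℕ+ × ℤ}
    (hp : 2 ≤ p.1) : (p.1 : ℝ) / ‖(p.1 : ℂ) * linePt y + p.2‖ ^ (k + 1) ≤
      (1 / R) ^ (k + 1) * (32 * (1 / 3) ^ (k / 2) * latticeMajorant p) := by
  obtain ⟨c, d⟩ := p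
  simp only at hp ⊢
  have hc : (2 : ℝ) ≤ ((c : ℕ) : ℝ) := by exact_mod_cast hp
  have hn := normSq_linePt_pnat (c, d) y
  simp only at hn
  have hy0 : 0 < y := sqrt_three_half_pos.trans_le hy
  have hy2 := three_quarters_le_sq hy
  rw [latticeMajorant]
  simp only
  set C : ℝ := ((c : ℕ) : ℝ)
  set D : ℝ := (d : ℝ)
  set κ := k / 2
  set N := ‖((c : ℕ) : ℂ) * linePt y + (d : ℂ)‖
  set s := (C / 2 + D) ^ 2 / (C ^ 2 * y ^ 2) with hs
  have hC0 : 0 < C := by linarith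
  have hs0 : 0 ≤ s := by positivity
  have hN : C ^ 2 * y ^ 2 * (1 + s) = N ^ 2 := by
    rw [hn, hs]
    field_simp
    ring
  have hRN : R ^ 2 * (3 / 4 * C ^ 2 * (1 + s)) ≤ N ^ 2 := by
    rw [← hN]
    have : 0 ≤ C ^ 2 * (1 + s) := by positivity
    nlinarith
  have hRle : R ≤ N := by
    refine le_of_sq_le_sq ?_ (norm_nonneg _)
    have : 4 * y ^ 2 ≤ C ^ 2 * y ^ 2 * (1 + s) := by
      have h4 : 4 ≤ C ^ 2 := by nlinarith
      have := mul_nonneg (mul_nonneg (sq_nonneg C) (sq_nonneg y)) hs0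
      nlinarith
    linarith
  have hmax : max 1 (D ^ 2) ≤ C ^ 2 * (1 + s) ^ κ := by
    have hb := one_add_mul_le_pow (a := s) (by linarith) κ
    have h2 : C ^ 2 + 2 * (C / 2 + D) ^ 2 ≤ C ^ 2 * (1 + κ * s) := by
      have : 2 * (C / 2 + D) ^ 2 ≤ C ^ 2 * (κ * s) := by
        rw [hs, show C ^ 2 * (κ * ((C / 2 + D) ^ 2 / (C ^ 2 * y ^ 2))) =
          κ / y ^ 2 * (C / 2 + D) ^ 2 by field_simp]
        gcongr
        rw [le_div_iff₀ (by positivity)]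
        exact hyk
      linarith
    have h3 := mul_le_mul_of_nonneg_left hb (sq_nonneg C)
    refine max_le ?_ ?_
    · nlinarith [sq_nonneg (C / 2 + D)]
    · nlinarith [sq_nonneg (2 * C + D), sq_nonneg (C + D)]
  have hpow : C ^ 5 * (4 / C ^ 2) ^ κ ≤ 32 := by
    have h1 : (4 / C ^ 2) ^ κ ≤ (2 / C) ^ 5 := by
      rw [show 4 / C ^ 2 = (2 / C) ^ 2 by rw [div_pow]; norm_num, ← pow_mul]
      exact pow_le_pow_of_le_one (by positivity) ((div_le_one hC0).mpr hc) (by omega)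
    calc C ^ 5 * (4 / C ^ 2) ^ κ ≤ C ^ 5 * (2 / C) ^ 5 := by gcongr
      _ = 32 := by field_simp; norm_num
  have hterm : C * (1 / (3 / 4 * C ^ 2 * (1 + s)) ^ κ) ≤
      32 * (1 / 3) ^ κ * (1 / C ^ 2 * (1 / max 1 (D ^ 2))) :=
    calc C * (1 / (3 / 4 * C ^ 2 * (1 + s)) ^ κ)
        = (C ^ 5 * (4 / C ^ 2) ^ κ) * ((1 / 3) ^ κ * (1 / C ^ 2 * (1 / (C ^ 2 * (1 + s) ^ κ)))) := by
          rw [show 3 / 4 * C ^ 2 * (1 + s) = (4 / C ^ 2)⁻¹ * (1 / 3)⁻¹ * (1 + s) by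
            field_simp, mul_pow, mul_pow, inv_pow, inv_pow]
          field_simp
      _ ≤ 32 * ((1 / 3) ^ κ * (1 / C ^ 2 * (1 / max 1 (D ^ 2)))) := by gcongr
      _ = _ := by ring
  calc C / N ^ (k + 1) = C * (1 / N ^ (k + 1)) := by ring
    _ ≤ C * ((1 / R) ^ (k + 1) * (1 / (3 / 4 * C ^ 2 * (1 + s)) ^ κ)) := by
        gcongr
        exact inv_pow_succ_le hR0 hRle hRN (by positivity)
    _ = (1 / R) ^ (k + 1) * (C * (1 / (3 / 4 * C ^ 2 * (1 + s)) ^ κ)) := by ring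
    _ ≤ _ := by gcongr

/-- On the part of the line `Re z = 1 / 2` where `|z| ^ 2 ≤ 0.219 (k + 1)`, the derivative of the
Eisenstein series is governed by the two lattice points of smallest norm. -/
lemma lineEk'_dominant {k : ℕ} (hk : 10 ≤ k) (hke : Even k) {y R : ℝ} (hy : √3 / 2 ≤ y)
    (hR0 : 0 < R) (hR : R ^ 2 = y ^ 2 + 1 / 4) (hRk : R ^ 2 ≤ 0.219 * (k + 1)) :
    |realZeta k * lineEk' k y / k - 2 * (1 / linePt y ^ (k + 1)).im| < 2 * (1 / R) ^ (k + 1) := by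
  obtain ⟨s, hs, hS⟩ := exists_hasSum_latticeMajorant
  have hk' : (10 : ℝ) ≤ k := by exact_mod_cast hk
  have hκ : ((k / 2 : ℕ) : ℝ) = k / 2 := Nat.cast_div hke.two_dvd (by norm_num)
  have hκ0 : (0 : ℝ) < (k / 2 : ℕ) := by rw [hκ]; positivity
  have hM := ((hasSum_rowMajorant.mul_left (R ^ 2 / (k / 2 : ℕ))).add
    (hS.mul_left (32 * (1 / 3) ^ (k / 2)))).mul_left ((1 / R) ^ (k + 1))
  have hest := lineEk'_estimate_of_majorant (by omega) hke (sqrt_three_half_pos.trans_le hy) hM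
    (fun p => by
      have := rowMajorant_nonneg p
      have := latticeMajorant_nonneg p
      positivity)
    (fun p h0 h1 => by
      obtain ⟨c, d⟩ := p
      have hrow := rowMajorant_nonneg (c, d)
      have hlat := latticeMajorant_nonneg (c, d)
      by_cases hc : c = 1
      · subst hc
        have h := row_term_le (k := k) (by omega) hR0 hR (d := d) (by rintro rfl; exact h0 rfl)
          (by rintro rfl; exact h1 rfl)
        simp only [PNat.one_coe, Nat.cast_one, one_mul]
        refine h.trans ?_
        gcongr
        simp only [rowMajorant, if_true, one_mul]
        linarith [show 0 ≤ 32 * (1 / 3) ^ (k / 2) * latticeMajorant (1, d) by positivity]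
      · have hc2 : 2 ≤ c := by
          rcases lt_or_eq_of_le (one_le : 1 ≤ c) with h | h
          · exact h
          · exact absurd h.symm hc
        refine (lattice_term_le hk hy hR0 hR ?_ (p := (c, d)) hc2).trans ?_
        · rw [hκ]
          linarith
        · gcongr
          linarith [show 0 ≤ R ^ 2 / (k / 2 : ℕ) * rowMajorant (c, d) by positivity])
  refine hest.trans_lt ?_
  rw [mul_comm 2]
  have h1 : R ^ 2 / (k / 2 : ℕ) ≤ 0.4819 := by
    rw [div_le_iff₀ hκ0, hκ]
    linarith
  have h2 : ((1 : ℝ) / 3) ^ (k / 2) ≤ (1 / 3) ^ 5 :=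
    pow_le_pow_of_le_one (by norm_num) (by norm_num) (by omega)
  have h3 : (0 : ℝ) ≤ (1 / 3) ^ (k / 2) := by positivity
  gcongr
  have h4 : ((1 : ℝ) / 3) ^ (k / 2) * s ≤ (1 / 3) ^ 5 * 7.1 :=
    (mul_le_mul_of_nonneg_left hs h3).trans (mul_le_mul_of_nonneg_right h2 (by norm_num))
  norm_num at h1 h4 ⊢
  linarith

/-- Sample points on the line `Re z = 1 / 2` at which the sign of `lineEk' k` is known. -/
noncomputable def samplePt (k m : ℕ) : ℝ :=
  if 7 * m ^ 2 ≤ k then k / (2 * π * m) else Real.tan (π / 2 - π * m / (k + 1)) / 2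

lemma sampleAngle_pos {k m : ℕ} (hm : 1 ≤ m) : 0 < π * m / ((k : ℝ) + 1) := by
  have : (0 : ℝ) < m := by exact_mod_cast hm
  have := Real.pi_pos
  positivity

lemma sampleAngle_lt {k m : ℕ} (hmk : 6 * m ≤ k) : π * m / ((k : ℝ) + 1) < π / 6 := by
  have h : 6 * (m : ℝ) ≤ k := by exact_mod_cast hmk
  rw [div_lt_div_iff₀ (by positivity) (by norm_num)]
  nlinarith [Real.pi_pos]

lemma sqrt_three_half_lt_tan {k m : ℕ} (hm : 1 ≤ m) (hmk : 6 * m ≤ k) :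
    √3 / 2 < Real.tan (π / 2 - π * m / (k + 1)) / 2 := by
  have h0 := sampleAngle_pos (k := k) hm
  have h1 := sampleAngle_lt hmk
  rw [← Real.tan_pi_div_three]
  have := Real.tan_lt_tan_of_lt_of_lt_pi_div_two (x := π / 3) (y := π / 2 - π * m / (k + 1))
    (by linarith [Real.pi_pos]) (by linarith) (by linarith)
  linarith

lemma sqrt_three_half_lt_samplePt {k m : ℕ} (hm : 1 ≤ m) (hmk : 6 * m ≤ k) :
    √3 / 2 < samplePt k m := by
  rw [samplePt]
  split_ifs with h
  · have hm0 : (0 : ℝ) < m := by exact_mod_cast hm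
    have hmk' : 6 * (m : ℝ) ≤ k := by exact_mod_cast hmk
    have hπ0 := Real.pi_pos
    rw [lt_div_iff₀ (by positivity)]
    have h3 := sqrt_three_lt
    have hπ := Real.pi_lt_d2
    have : √3 / 2 * (2 * π) < 6 := by nlinarith
    nlinarith
  · exact sqrt_three_half_lt_tan hm hmk

lemma samplePt_lt {k m n : ℕ} (hm : 1 ≤ m) (hmn : m < n) (hnk : 6 * n ≤ k) :
    samplePt k n < samplePt k m := by
  have hm0 : (0 : ℝ) < m := by exact_mod_cast hm
  have hn0 : (0 : ℝ) < n := by exact_mod_cast (by omega : 0 < n)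
  have hmn' : (m : ℝ) + 1 ≤ n := by exact_mod_cast hmn
  have hnk' : 6 * (n : ℝ) ≤ k := by exact_mod_cast hnk
  have hk0 : (0 : ℝ) < k := by linarith
  have hπ := Real.pi_pos
  have hβ := sampleAngle_pos (k := k) (by omega : 1 ≤ n)
  have hβ' := sampleAngle_lt hnk
  rw [samplePt, samplePt]
  split_ifs with h1 h2 h2
  · gcongr
  · exact absurd (le_trans (by gcongr) h1) h2
  · rw [Real.tan_pi_div_two_sub]
    have ht := Real.lt_tan hβ (by linarith)
    calc (Real.tan (π * n / (k + 1)))⁻¹ / 2 < (π * n / (k + 1))⁻¹ / 2 := by gcongr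
      _ = ((k : ℝ) + 1) / (2 * π * n) := by field_simp
      _ ≤ k / (2 * π * m) := by
        rw [div_le_div_iff₀ (by positivity) (by positivity)]
        have : ((k : ℝ) + 1) * m ≤ k * n := by nlinarith
        nlinarith
  · have hα := sampleAngle_pos (k := k) hm
    have := Real.tan_lt_tan_of_lt_of_lt_pi_div_two (x := π / 2 - π * n / (k + 1))
      (y := π / 2 - π * m / (k + 1)) (by linarith) (by linarith) (by gcongr)
    linarith

lemma lineEk'_sign_of_fourier {k m : ℕ} (hk : 4 ≤ k) (hke : Even k) (hm : 1 ≤ m)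
    (h7 : 7 * m ^ 2 ≤ k) : 0 < -((-1) ^ (m + k / 2) * lineEk' k (k / (2 * π * m))) := by
  have h1 := lineSum_one_sign hk hm h7
  have h2 := eisCoeff_sign (by omega : 3 ≤ k) hke
  have h3 : 0 < 2 * π * (((-1) ^ (k / 2) * eisCoeff k) *
    ((-1) ^ m * lineSum k 1 (k / (2 * π * m)))) := by
    have := Real.pi_pos
    positivity
  rw [lineEk', pow_add]
  linarith

lemma sin_odd_mul_pi_div_two_sub {k : ℕ} (hke : Even k) (m : ℕ) :
    Real.sin (((k + 1 : ℕ) : ℝ) * (π / 2 - π * m / (k + 1))) = (-1) ^ (m + k / 2) := by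
  obtain ⟨l, rfl⟩ := hke
  have hk : (((l + l : ℕ) : ℝ) + 1) ≠ 0 := by positivity
  rw [show ((l + l + 1 : ℕ) : ℝ) * (π / 2 - π * m / (((l + l : ℕ) : ℝ) + 1)) =
      π / 2 + (l : ℝ) * π - (m : ℝ) * π by push_cast at *; field_simp; ring,
    Real.sin_sub_nat_mul_pi, Real.sin_add_nat_mul_pi, Real.sin_pi_div_two,
    show (l + l) / 2 = l by omega, pow_add, mul_one]

lemma lineEk'_sign_of_lattice {k m : ℕ} (hk : 10 ≤ k) (hke : Even k) (hm : 1 ≤ m)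
    (hmk : 6 * m ≤ k) (h7 : k < 7 * m ^ 2) :
    0 < -((-1) ^ (m + k / 2) * lineEk' k (Real.tan (π / 2 - π * m / (k + 1)) / 2)) := by
  have hy := sqrt_three_half_lt_tan hm hmk
  have hsin := sin_odd_mul_pi_div_two_sub hke m
  have hβ0 := sampleAngle_pos (k := k) hm
  have hβ1 := sampleAngle_lt hmk
  have hπ := Real.pi_gt_d4
  have hm0 : (0 : ℝ) < m := by exact_mod_cast hm
  have hmk' : ((k : ℝ) + 1) ≤ 7 * (m : ℝ) ^ 2 := by exact_mod_cast h7
  set β : ℝ := π * m / (k + 1) with hβ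
  have hs := nine_tenths_mul_le_sin hβ0.le hβ1.le
  have hs0 : 0 < Real.sin β := by linarith
  have hcos : Real.cos (π / 2 - β) = Real.sin β := Real.cos_pi_div_two_sub β
  have him := linePt_tan_pow_im (α := π / 2 - β) (by rw [hcos]; exact hs0.ne') (k + 1)
  rw [hsin, hcos] at him
  set y := Real.tan (π / 2 - β) / 2 with hydef
  set R := 1 / (2 * Real.sin β) with hRdef
  have hR0 : 0 < R := by positivity
  have hR : R ^ 2 = y ^ 2 + 1 / 4 := by
    rw [hydef, Real.tan_pi_div_two_sub, Real.tan_eq_sin_div_cos, hRdef, inv_div]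
    field_simp
    have := Real.sin_sq_add_cos_sq β
    linarith
  have hRk : R ^ 2 ≤ 0.219 * (k + 1) := by
    have hk0 : (0 : ℝ) < (k : ℝ) + 1 := by positivity
    have hβm : β * (k + 1) = π * m := by rw [hβ]; field_simp
    have h1 : (0.9 * β) ^ 2 ≤ Real.sin β ^ 2 := pow_le_pow_left₀ (by positivity) hs 2
    have h2 : 9.869 * (m : ℝ) ^ 2 ≤ (β * (k + 1)) ^ 2 := by
      rw [hβm, mul_pow]
      gcongr
      nlinarith
    have h3 : 9.869 ≤ 7 * (β ^ 2 * (k + 1)) := by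
      by_contra! hlt
      nlinarith
    rw [hRdef, div_pow, one_pow, div_le_iff₀ (by positivity)]
    have h4 : (0.9 * β) ^ 2 * (k + 1) ≤ Real.sin β ^ 2 * (k + 1) := by gcongr
    nlinarith
  have hdom := lineEk'_dominant hk hke hy.le hR0 hR hRk
  rw [him, show (1 / R) = 2 * Real.sin β by rw [hRdef, one_div_one_div]] at hdom
  set P := (2 * Real.sin β) ^ (k + 1)
  have hε : ((-1 : ℝ) ^ (m + k / 2)) * (-1) ^ (m + k / 2) = 1 := by rw [← mul_pow]; norm_num
  set ε := (-1 : ℝ) ^ (m + k / 2)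
  have habs : |ε| = 1 := by
    rw [abs_pow, abs_neg, abs_one, one_pow]
  have h2 : |ε * (realZeta k * lineEk' k y / k) + 2 * P| < 2 * P := by
    refine lt_of_eq_of_lt ?_ hdom
    rw [show ε * (realZeta k * lineEk' k y / k) + 2 * P =
      ε * (realZeta k * lineEk' k y / k - 2 * -(P * ε)) by linear_combination (-2 * P) * hε,
      abs_mul, habs, one_mul]
  have h3 := (abs_lt.mp h2).2
  have h4 : 0 < realZeta k / k * -(ε * lineEk' k y) := by
    have : realZeta k / k * -(ε * lineEk' k y) = -(ε * (realZeta k * lineEk' k y / k)) := by ring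
    linarith
  have hζ := one_le_realZeta (by omega : 3 ≤ k)
  exact pos_of_mul_pos_right h4 (by positivity)

lemma lineEk'_samplePt_sign {k m : ℕ} (hk : 10 ≤ k) (hke : Even k) (hm : 1 ≤ m)
    (hmk : 6 * m ≤ k) : 0 < -((-1) ^ (m + k / 2) * lineEk' k (samplePt k m)) := by
  rw [samplePt]
  split_ifs with h
  · exact lineEk'_sign_of_fourier (by omega) hke hm h
  · exact lineEk'_sign_of_lattice hk hke hm hmk (by omega)

lemma exists_zero_of_mul_neg {g : ℝ → ℝ} {a b : ℝ} (hab : a < b) (hg : ContinuousOn g (Set.Icc a b))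
    (h : g b * g a < 0) : ∃ x, a < x ∧ x < b ∧ g x = 0 := by
  rcases mul_neg_iff.mp h with ⟨h1, h2⟩ | ⟨h1, h2⟩
  · obtain ⟨x, hx, h0⟩ := intermediate_value_Ioo hab.le hg ⟨h2, h1⟩
    exact ⟨x, hx.1, hx.2, h0⟩
  · obtain ⟨x, hx, h0⟩ := intermediate_value_Ioo' hab.le hg ⟨h1, h2⟩
    exact ⟨x, hx.1, hx.2, h0⟩

lemma continuousOn_lineEk' (k : ℕ) {a b : ℝ} (ha : 0 < a) :
    ContinuousOn (lineEk' k) (Set.Icc a b) := fun _ hx =>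
  (hasDerivAt_lineEk' k (ha.trans_le hx.1)).continuousAt.continuousWithinAt

lemma exists_zeros_gt_samplePt {k : ℕ} (hk : 10 ≤ k) (hke : Even k) (n : ℕ) (hn : 6 * (n + 1) ≤ k) :
    ∃ A : Finset ℝ, A.card = n ∧ ∀ y ∈ A, samplePt k (n + 1) < y ∧ lineEk' k y = 0 := by
  induction n with
  | zero => exact ⟨∅, rfl, by simp⟩
  | succ n ih =>
    obtain ⟨A, hA, h⟩ := ih (by omega)
    have hlt := samplePt_lt (k := k) (m := n + 1) (n := n + 2) (by omega) (by omega) hn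
    obtain ⟨x, h1, h2, h3⟩ := exists_zero_of_mul_neg hlt
      (continuousOn_lineEk' k (sqrt_three_half_pos.trans
        (sqrt_three_half_lt_samplePt (by omega) hn))) (by
        have h1 := lineEk'_samplePt_sign hk hke (m := n + 1) (by omega) (by omega)
        have h2 := lineEk'_samplePt_sign hk hke (m := n + 2) (by omega) hn
        have hε : ((-1 : ℝ) ^ (n + 1 + k / 2)) * (-1) ^ (n + 1 + k / 2) = 1 := by
          rw [← mul_pow]; norm_num
        rw [show n + 2 + k / 2 = n + 1 + k / 2 + 1 by ring, pow_succ] at h2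
        have := mul_pos h1 h2
        generalize (-1 : ℝ) ^ (n + 1 + k / 2) = ε at *
        have e : lineEk' k (samplePt k (n + 1)) * lineEk' k (samplePt k (n + 2)) =
          -(-(ε * lineEk' k (samplePt k (n + 1))) *
            -(ε * -1 * lineEk' k (samplePt k (n + 2)))) := by
          linear_combination -(lineEk' k (samplePt k (n + 1)) *
            lineEk' k (samplePt k (n + 2))) * hε
        linarith)
    refine ⟨insert x A, ?_, fun y hy => ?_⟩
    · rw [Finset.card_insert_of_notMem (fun hx => by linarith [(h x hx).1]), hA]
    · rcases Finset.mem_insert.mp hy with rfl | hy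
      · exact ⟨h1, h3⟩
      · exact ⟨hlt.trans (h y hy).1, (h y hy).2⟩

lemma exists_lineEk'_zeros {k : ℕ} (hk : 10 ≤ k) (hke : Even k) :
    ∃ A : Finset ℝ, A.card = (if k % 6 = 4 then k / 6 else k / 6 - 1) ∧
      ∀ y ∈ A, √3 / 2 < y ∧ lineEk' k y = 0 := by
  obtain ⟨A, hA, h⟩ := exists_zeros_gt_samplePt hk hke (k / 6 - 1) (by omega)
  rw [show k / 6 - 1 + 1 = k / 6 by omega] at h
  have hlt := sqrt_three_half_lt_samplePt (k := k) (m := k / 6) (by omega) (by omega)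
  split_ifs with h6
  · obtain ⟨x, h1, h2, h3⟩ := exists_zero_of_mul_neg hlt
      (continuousOn_lineEk' k sqrt_three_half_pos) (by
        have h1 := lineEk'_samplePt_sign hk hke (m := k / 6) (by omega) (by omega)
        rw [Even.neg_one_pow (by rw [Nat.even_iff]; omega), one_mul] at h1
        exact mul_neg_of_neg_of_pos (by linarith) (lineEk'_sqrt_three_pos hk hke h6))
    refine ⟨insert x A, ?_, fun y hy => ?_⟩
    · rw [Finset.card_insert_of_notMem (fun hx => by linarith [(h x hx).1]), hA]
      omega
    · rcases Finset.mem_insert.mp hy with rfl | hy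
      · exact ⟨h1, h3⟩
      · exact ⟨hlt.trans (h y hy).1, (h y hy).2⟩
  · exact ⟨A, hA, fun y hy => ⟨hlt.trans (h y hy).1, (h y hy).2⟩⟩

lemma simple_zeros_large {k : ℕ} (hk : 10 ≤ k) (hke : Even k) {z : ℂ} (hz : 0 < z.im)
    (h0 : deriv (Ek k) z = 0) : deriv (deriv (Ek k)) z ≠ 0 := by
  obtain ⟨A, hcard, hA⟩ := exists_lineEk'_zeros hk hke
  have hk0 : (0 : ℝ) < k := by positivity
  have hk2 : k % 2 = 0 := Nat.even_iff.mp hke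
  obtain ⟨a, ha, hj⟩ : ∃ a ≤ 2, k + 2 = 6 * (A.card + 1) + 2 * a := by
    rw [hcard]
    rcases (show k % 6 = 0 ∨ k % 6 = 2 ∨ k % 6 = 4 by omega) with h | h | h
    · exact ⟨1, by norm_num, by rw [if_neg (by omega)]; omega⟩
    · exact ⟨2, by norm_num, by rw [if_neg (by omega)]; omega⟩
    · exact ⟨0, by norm_num, by rw [if_pos h]; omega⟩
  refine simple_zeros_of_lineEk (by omega) hke hj ha (fun h6 => ?_) (fun h6 => ?_)
    (fun y hy => lineEk_pos hk hke hy) (fun y hy => ?_) A hA rfl hz h0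
  · rw [rhoPt, Ek_linePt]
    exact_mod_cast (lineEk_sqrt_three_pos hk hke h6).ne'
  · rw [rhoPt, deriv_deriv_Ek_linePt k sqrt_three_half_pos, neg_ne_zero]
    have := lineEk''_pos (by omega) hke h6 le_rfl (by
      rw [lineAngle_sqrt_three, mul_zero]; positivity)
    exact_mod_cast this.ne'
  · have h : k * lineEk k y + y * lineEk' k y = k * lineW k y := by
      rw [lineW]
      field_simp
    rw [h]
    exact mul_pos hk0 (lineW_pos hk hke hy)

theorem stmt3 (k : ℕ) (hke : Even k) (hk4 : 4 ≤ k) (z : ℂ) (hz : 0 < z.im)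
    (h0 : deriv (Ek k) z = 0) :
    deriv (deriv (Ek k)) z ≠ 0 := by
  have hk2 : k % 2 = 0 := Nat.even_iff.mp hke
  rcases (show k ≤ 8 ∨ 10 ≤ k by omega) with h | h
  · exact simple_zeros_small hk4 h hke hz h0
  · exact simple_zeros_large h hke hz h0
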